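/- Let n ≥ 5 be an integer, let 𝕂 be an infinite field, and let M be a finite matroid representable over 𝕂. Then there exists a finite matroid N such that: (i) M is a minor of N; (ii) N satisfies the n-th Kinser inequality for every family of n subsets of its ground set (N ∈ K_n); and (iii) N is an excluded minor for K_{n+1}, i.e. N violates the (n+1)-th Kinser inequality for some family of n+1 subsets of its ground set, but every proper minor of N satisfies the (n+1)-th Kinser inequality for all families. -/

import Mathlib

open Finset

universe u v

namespace Matroid

variable {α : Type*}

/-- The rank of a set in a matroid: the cardinality of a largest independent subset. -/
noncomputable def rnk (M : Matroid α) (X : Set α) : ℕ :=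
  sSup {n : ℕ | ∃ I, M.Indep I ∧ I ⊆ X ∧ I.ncard = n}

/-- The `n`-th Kinser inequality for the family `X 1, …, X n`. -/
def KinserIneq (M : Matroid α) (n : ℕ) (X : ℕ → Set α) : Prop :=
  (∑ i ∈ Finset.Icc 3 n, M.rnk (X i)) + M.rnk (X 1 ∪ X 2) + M.rnk (X 1 ∪ X 3 ∪ X n)
      + ∑ i ∈ Finset.Icc 4 n, M.rnk (X 2 ∪ X (i - 1) ∪ X i)
    ≤ M.rnk (X 1 ∪ X 3) + M.rnk (X 1 ∪ X n)
      + (∑ i ∈ Finset.Icc 3 n, M.rnk (X 2 ∪ X i))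
      + ∑ i ∈ Finset.Icc 4 n, M.rnk (X (i - 1) ∪ X i)

/-- `M` lies in the Kinser class `K n`: the `n`-th Kinser inequality holds for every
family of `n` subsets of the ground set. -/
def MemKinserClass (M : Matroid α) (n : ℕ) : Prop :=
  ∀ X : ℕ → Set α, (∀ i ∈ Finset.Icc 1 n, X i ⊆ M.E) → M.KinserIneq n X

/-- `M` is (isomorphic to) the matroid of linear dependence of a family of vectors of a
vector space over `𝔽`. -/
def IsRepOver {α : Type u} (M : Matroid α) (𝔽 : Type v) [Field 𝔽] : Prop :=
  ∃ (W : Type (max u v)) (_ : AddCommGroup W) (_ : Module 𝔽 W) (φ : α → W),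
    ∀ I : Set α, M.Indep I ↔ I ⊆ M.E ∧ LinearIndependent 𝔽 (fun x : I => φ x.1)

/-- Deletion of a set of elements from a matroid. -/
def del (M : Matroid α) (D : Set α) : Matroid α := M ↾ (M.E \ D)

/-- Contraction of a set of elements in a matroid. -/
def con (M : Matroid α) (C : Set α) : Matroid α := (M✶ ↾ (M✶.E \ C))✶

/-- `N` is a minor of `M`: it is obtained from `M` by contractions and deletions. -/
def IsMinorOf (N M : Matroid α) : Prop :=
  ∃ C D : Set α, C ⊆ M.E ∧ D ⊆ M.E ∧ Disjoint C D ∧ N = (M.con C).del D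

/-- `N` is a proper minor of `M`: at least one element is deleted or contracted. -/
def IsProperMinorOf (N M : Matroid α) : Prop :=
  ∃ C D : Set α, C ⊆ M.E ∧ D ⊆ M.E ∧ Disjoint C D ∧ (C ∪ D).Nonempty ∧
    N = (M.con C).del D

/-- A matroid isomorphism: a bijection of ground sets preserving independence. -/
def IsIsoTo {β : Type*} (M : Matroid α) (N : Matroid β) : Prop :=
  ∃ f : α → β, Set.BijOn f M.E N.E ∧ ∀ I ⊆ M.E, (M.Indep I ↔ N.Indep (f '' I))

/-- The Ingleton inequality (the 4th Kinser inequality) for four subsets. -/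
def IngletonIneq (M : Matroid α) (X₁ X₂ X₃ X₄ : Set α) : Prop :=
  M.rnk X₃ + M.rnk X₄ + M.rnk (X₁ ∪ X₂) + M.rnk (X₁ ∪ X₃ ∪ X₄) + M.rnk (X₂ ∪ X₃ ∪ X₄)
    ≤ M.rnk (X₁ ∪ X₃) + M.rnk (X₁ ∪ X₄) + M.rnk (X₂ ∪ X₃) + M.rnk (X₂ ∪ X₄)
      + M.rnk (X₃ ∪ X₄)

end Matroid

namespace KinserAux

/-- Left side of the reindexed Kinser inequality. -/
def KLhs {E : Type*} (ρ : Set E → ℕ) (A B : Set E) (W : ℕ → Set E) (k : ℕ) : ℕ :=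
  (∑ j ∈ range (k+1), ρ (W j)) + ρ (A ∪ B) + ρ (A ∪ W 0 ∪ W k)
    + ∑ j ∈ range k, ρ (B ∪ W j ∪ W (j+1))

/-- Right side of the reindexed Kinser inequality. -/
def KRhs {E : Type*} (ρ : Set E → ℕ) (A B : Set E) (W : ℕ → Set E) (k : ℕ) : ℕ :=
  ρ (A ∪ W 0) + ρ (A ∪ W k) + (∑ j ∈ range (k+1), ρ (B ∪ W j))
    + ∑ j ∈ range k, ρ (W j ∪ W (j+1))

theorem sum_Icc_three (f : ℕ → ℕ) (k : ℕ) :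
    ∑ i ∈ Icc 3 (k+3), f i = ∑ j ∈ range (k+1), f (j+3) := by
  induction k with
  | zero => simp
  | succ k ih =>
    rw [sum_range_succ, ← ih, show k+1+3 = (k+3)+1 by omega, sum_Icc_succ_top (by omega)]

theorem sum_Icc_four (f : ℕ → ℕ) (k : ℕ) :
    ∑ i ∈ Icc 4 (k+3), f i = ∑ j ∈ range k, f (j+4) := by
  induction k with
  | zero => simp
  | succ k ih =>
    rw [sum_range_succ, ← ih, show k+1+3 = (k+3)+1 by omega, sum_Icc_succ_top (by omega)]

theorem kinserIneq_iff {E : Type*} (N : Matroid E) (k : ℕ) (X : ℕ → Set E) :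
    N.KinserIneq (k+3) X ↔
      KLhs N.rnk (X 1) (X 2) (fun j => X (j+3)) k ≤ KRhs N.rnk (X 1) (X 2) (fun j => X (j+3)) k := by
  unfold Matroid.KinserIneq KLhs KRhs
  simp only [sum_Icc_three, sum_Icc_four]
  have h : ∀ j, j + 4 - 1 = j + 3 := fun j => by omega
  have h' : ∀ j, j + 1 + 3 = j + 4 := fun j => by omega
  simp only [h, h', zero_add]

theorem cast_rnk {E : Type*} [Finite E] (N : Matroid E) (X : Set E) :
    (N.rnk X : ℕ∞) = N.eRk X := by
  obtain ⟨I, hI⟩ := N.exists_isBasis' X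
  have h1 : N.rnk X = I.ncard := by
    unfold Matroid.rnk
    apply le_antisymm
    · refine csSup_le ⟨I.ncard, I, hI.indep, hI.subset, rfl⟩ ?_
      rintro _ ⟨J, hJ, hJX, rfl⟩
      have := hJ.encard_le_eRk_of_subset hJX
      rw [← hI.encard_eq_eRk, ← Set.Finite.cast_ncard_eq (Set.toFinite _),
        ← Set.Finite.cast_ncard_eq (Set.toFinite _)] at this
      exact_mod_cast this
    · apply le_csSup
      · refine ⟨Nat.card E, ?_⟩
        rintro _ ⟨J, _, _, rfl⟩
        exact Set.ncard_le_card J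
      · exact ⟨I, hI.indep, hI.subset, rfl⟩
  rw [h1, Set.Finite.cast_ncard_eq (Set.toFinite _), hI.encard_eq_eRk]

theorem rnk_mono {E : Type*} [Finite E] (N : Matroid E) {X Y : Set E} (h : X ⊆ Y) :
    N.rnk X ≤ N.rnk Y := by
  have := N.eRk_mono h
  rw [← cast_rnk, ← cast_rnk] at this
  exact_mod_cast this

theorem rnk_submod {E : Type*} [Finite E] (N : Matroid E) (X Y : Set E) :
    N.rnk (X ∩ Y) + N.rnk (X ∪ Y) ≤ N.rnk X + N.rnk Y := by
  have := N.eRk_inter_add_eRk_union_le X Y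
  simp only [← cast_rnk] at this
  exact_mod_cast this

theorem rnk_con {E : Type*} [Finite E] (N : Matroid E) (C X : Set E)
    (hX : Disjoint X C) :
    (N.con C).rnk X + N.rnk C = N.rnk (X ∪ C) := by
  have hcon : N.con C = N.contract C := rfl
  rw [hcon]
  obtain ⟨J, hJ⟩ := N.exists_isBasis' C
  obtain ⟨B, hB, hJB⟩ := hJ.indep.subset_isBasis'_of_subset
    (hJ.subset.trans Set.subset_union_right : J ⊆ X ∪ C)
  have hBC : B ∩ C = J := by
    refine (hJ.eq_of_subset_indep (hB.indep.subset Set.inter_subset_left)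
      (Set.subset_inter hJB hJ.subset) Set.inter_subset_right).symm
  have h1 : (N.contract C).IsBasis' (B \ C) ((X ∪ C) \ C) := by
    refine hB.contract_isBasis' hJ (hB.indep.subset ?_)
    exact Set.union_subset Set.sdiff_subset hJB
  rw [Set.union_sdiff_right, hX.sdiff_eq_left] at h1
  have : (((N.contract C).rnk X + N.rnk C : ℕ) : ℕ∞) = (N.rnk (X ∪ C) : ℕ) := by
    push_cast
    rw [cast_rnk, cast_rnk, cast_rnk, ← h1.encard_eq_eRk, ← hJ.encard_eq_eRk,
      ← hB.encard_eq_eRk, ← hBC, Set.encard_sdiff_add_encard_inter]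
  exact_mod_cast this

theorem rnk_del {E : Type*} [Finite E] (N : Matroid E) (D X : Set E) 
    (hX : X ⊆ N.E \ D) : (N.del D).rnk X = N.rnk X := by
  have : ((N.del D).rnk X : ℕ∞) = N.rnk X := by
    rw [cast_rnk, cast_rnk]
    exact N.restrict_eRk_eq hX
  exact_mod_cast this

theorem rnk_conDel {E : Type*} [Finite E] (N : Matroid E) (hE : N.E = Set.univ) (C D X : Set E)
    (hX : X ⊆ ((N.con C).del D).E) :
    ((N.con C).del D).rnk X + N.rnk C = N.rnk (X ∪ C) := by
  have h1 : ((N.con C).del D).E = (N.E \ C) \ D := rfl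
  rw [h1] at hX
  rw [rnk_del _ _ _ hX, rnk_con]
  rw [Set.disjoint_left]
  intro x hx hC
  exact (hX hx).1.2 hC

theorem excluded_of {E : Type*} [Finite E] (N : Matroid E) (hE : N.E = Set.univ) (n : ℕ)
    (hn : 5 ≤ n)
    (hV : ∃ A B W, KRhs N.rnk A B W (n-2) < KLhs N.rnk A B W (n-2))
    (hU : ∀ k, k ≤ n - 2 → ∀ A B W, KRhs N.rnk A B W k < KLhs N.rnk A B W k →
      k = n - 2 ∧ (∀ e, e ∈ A ∨ e ∈ B ∨ ∃ j ≤ k, e ∈ W j) ∧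
        ¬ ∃ e, e ∈ A ∧ e ∈ B ∧ ∀ j ≤ k, e ∈ W j) :
    N.MemKinserClass n ∧ ¬ N.MemKinserClass (n + 1) ∧
      ∀ P : Matroid E, P.IsProperMinorOf N → P.MemKinserClass (n + 1) := by
  refine ⟨?_, ?_, ?_⟩
  · intro X _
    obtain ⟨k, rfl⟩ : ∃ k, n = k + 3 := ⟨n - 3, by omega⟩
    rw [kinserIneq_iff]
    by_contra h
    have := (hU k (by omega) _ _ _ (not_le.mp h)).1
    omega
  · intro h
    obtain ⟨A, B, W, hW⟩ := hV
    obtain ⟨k, hk⟩ : ∃ k, n + 1 = k + 3 := ⟨n - 2, by omega⟩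
    have hk2 : n - 2 = k := by omega
    rw [hk2] at hW
    rw [hk] at h
    have := h (fun i => match i with
      | 0 => ∅
      | 1 => A
      | 2 => B
      | (j+3) => W j) (fun i _ => by rw [hE]; exact Set.subset_univ _)
    rw [kinserIneq_iff] at this
    exact absurd hW (not_lt.mpr this)
  · rintro P ⟨C, D, hC, hD, hCD, hne, rfl⟩ X hX
    obtain ⟨k, hk⟩ : ∃ k, n + 1 = k + 3 := ⟨n - 2, by omega⟩
    rw [hk] at hX ⊢
    rw [kinserIneq_iff]
    by_contra hcon
    rw [not_le] at hcon
    set P := (N.con C).del D with hP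
    have hr : ∀ Y, Y ⊆ P.E → P.rnk Y + N.rnk C = N.rnk (Y ∪ C) :=
      fun Y hY => rnk_conDel N hE C D Y hY
    have hX1 : X 1 ⊆ P.E := hX 1 (by simp)
    have hX2 : X 2 ⊆ P.E := hX 2 (by simp)
    have hXW : ∀ j, j ≤ k → X (j+3) ⊆ P.E := fun j hj => hX _ (by simp; omega)
    have key : KRhs N.rnk (X 1 ∪ C) (X 2 ∪ C) (fun j => X (j+3) ∪ C) k
        < KLhs N.rnk (X 1 ∪ C) (X 2 ∪ C) (fun j => X (j+3) ∪ C) k := by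
      have e2 : ∀ A B : Set E, (A ∪ C) ∪ (B ∪ C) = (A ∪ B) ∪ C := by
        intro A B; ext; simp; tauto
      unfold KRhs KLhs at hcon ⊢
      simp only [e2]
      beta_reduce at hcon
      have s1 : ∑ j ∈ range (k+1), N.rnk (X (j+3) ∪ C) =
          ∑ j ∈ range (k+1), P.rnk (X (j+3)) + (k+1) * N.rnk C := by
        have : ((k+1) * N.rnk C) = ∑ j ∈ range (k+1), N.rnk C := by simp
        rw [this, ← sum_add_distrib]
        refine sum_congr rfl fun j hj => (hr _ (hXW j (by simp at hj; omega))).symm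
      have s2 : ∑ j ∈ range (k+1), N.rnk (X 2 ∪ X (j+3) ∪ C) =
          ∑ j ∈ range (k+1), P.rnk (X 2 ∪ X (j+3)) + (k+1) * N.rnk C := by
        have : ((k+1) * N.rnk C) = ∑ j ∈ range (k+1), N.rnk C := by simp
        rw [this, ← sum_add_distrib]
        refine sum_congr rfl fun j hj => (hr _ ?_).symm
        exact Set.union_subset hX2 (hXW j (by simp at hj; omega))
      have s3 : ∑ j ∈ range k, N.rnk (X (j+3) ∪ X (j+1+3) ∪ C) =
          ∑ j ∈ range k, P.rnk (X (j+3) ∪ X (j+1+3)) + k * N.rnk C := by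
        have : (k * N.rnk C) = ∑ j ∈ range k, N.rnk C := by simp
        rw [this, ← sum_add_distrib]
        refine sum_congr rfl fun j hj => (hr _ ?_).symm
        simp at hj
        exact Set.union_subset (hXW j (by omega)) (hXW (j+1) (by omega))
      have s4 : ∑ j ∈ range k, N.rnk (X 2 ∪ X (j+3) ∪ X (j+1+3) ∪ C) =
          ∑ j ∈ range k, P.rnk (X 2 ∪ X (j+3) ∪ X (j+1+3)) + k * N.rnk C := by
        have : (k * N.rnk C) = ∑ j ∈ range k, N.rnk C := by simp
        rw [this, ← sum_add_distrib]
        refine sum_congr rfl fun j hj => (hr _ ?_).symm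
        simp at hj
        exact Set.union_subset (Set.union_subset hX2 (hXW j (by omega))) (hXW (j+1) (by omega))
      have h0 := hXW 0 (by omega)
      have hk' := hXW k le_rfl
      rw [s1, s2, s3, s4, ← hr _ (Set.union_subset hX1 h0), ← hr _ (Set.union_subset hX1 hk'),
        ← hr _ (Set.union_subset hX1 hX2), ← hr _ (Set.union_subset (Set.union_subset hX1 h0) hk')]
      omega
    obtain ⟨-, hun, hIn⟩ := hU k (by omega) _ _ _ key
    obtain ⟨e, he⟩ := hne
    rcases he with he | he
    · exact hIn ⟨e, Or.inr he, Or.inr he, fun j _ => Or.inr he⟩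
    · have hnC : e ∉ C := fun h => Set.disjoint_left.mp hCD h he
      have hnP : e ∉ P.E := fun h => h.2 he
      rcases hun e with (h | h) | (h | h) | ⟨j, hj, h | h⟩
      · exact hnP (hX1 h)
      · exact hnC h
      · exact hnP (hX2 h)
      · exact hnC h
      · exact hnP (hXW j hj h)
      · exact hnC h

end KinserAux

namespace KinserAux

/-- Remove the `j`-th set from a family. -/
def dropW {E : Type*} (W : ℕ → Set E) (j : ℕ) : ℕ → Set E :=
  fun i => if i < j then W i else W (i+1)

theorem sum_drop {E : Type*} (W : ℕ → Set E) (f : Set E → ℕ) (j k : ℕ) (h : j ≤ k + 1) :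
    ∑ i ∈ range (k+1+1), f (W i) = ∑ i ∈ range (k+1), f (dropW W j i) + f (W j) := by
  by_cases hj : j = k + 1
  · subst hj
    rw [sum_range_succ _ (k+1)]
    congr 1
    refine sum_congr rfl fun i hi => ?_
    simp at hi
    simp [dropW, show i < k + 1 by omega]
  · induction k with
    | zero =>
      obtain rfl : j = 0 := by omega
      simp [sum_range_succ, dropW]; omega
    | succ k ih =>
      rw [sum_range_succ, sum_range_succ (fun i => f (dropW W j i)) (k+1)]
      have e : dropW W j (k+1) = W (k+2) := by
        simp [dropW, show ¬ (k + 1 < j) by omega]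
      rw [e]
      by_cases hj' : j = k + 1
      · subst hj'
        have : ∑ i ∈ range (k+1), f (W i) = ∑ i ∈ range (k+1), f (dropW W (k+1) i) := by
          refine sum_congr rfl fun i hi => ?_
          simp at hi
          simp [dropW, show i < k + 1 by omega]
        rw [sum_range_succ, this]; lia
      · rw [ih (by omega) hj']; lia

theorem sum_drop_zero {E : Type*} (W : ℕ → Set E) (g : Set E → Set E → ℕ) (k : ℕ) :
    ∑ i ∈ range (k+1), g (W i) (W (i+1)) =
      ∑ i ∈ range k, g (dropW W 0 i) (dropW W 0 (i+1)) + g (W 0) (W 1) := by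
  rw [sum_range_succ']
  simp [dropW]

theorem sum_drop_last {E : Type*} (W : ℕ → Set E) (g : Set E → Set E → ℕ) (k : ℕ) :
    ∑ i ∈ range (k+1), g (W i) (W (i+1)) =
      ∑ i ∈ range k, g (dropW W (k+1) i) (dropW W (k+1) (i+1)) + g (W k) (W (k+1)) := by
  rw [sum_range_succ]
  congr 1
  refine sum_congr rfl fun i hi => ?_
  simp at hi
  simp [dropW, show i < k + 1 by omega, show i < k by omega]

theorem sum_drop_mid {E : Type*} (W : ℕ → Set E) (g : Set E → Set E → ℕ) (j k : ℕ) (h : j < k) :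
    ∑ i ∈ range (k+1), g (W i) (W (i+1)) + g (W j) (W (j+2)) =
      ∑ i ∈ range k, g (dropW W (j+1) i) (dropW W (j+1) (i+1)) + g (W j) (W (j+1))
        + g (W (j+1)) (W (j+2)) := by
  induction k with
  | zero => omega
  | succ k ih =>
    rw [sum_range_succ, sum_range_succ (fun i => g (dropW W (j+1) i) (dropW W (j+1) (i+1))) k]
    by_cases hj : j = k
    · subst hj
      have e1 : dropW W (j+1) j = W j := by simp [dropW]
      have e2 : dropW W (j+1) (j+1) = W (j+2) := by simp [dropW]
      have e3 := sum_drop_last W g j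
      rw [e1, e2, e3, show j+1+1 = j+2 by omega]
      omega
    · have e1 : dropW W (j+1) k = W (k+1) := by simp [dropW]; omega
      have e2 : dropW W (j+1) (k+1) = W (k+1+1) := by simp [dropW]; omega
      rw [e1, e2]
      have := ih (by omega)
      omega

theorem drop_violation {E : Type*} (ρ : Set E → ℕ) (hmono : ∀ X Y, X ⊆ Y → ρ X ≤ ρ Y)
    (hsub : ∀ X Y, ρ (X ∩ Y) + ρ (X ∪ Y) ≤ ρ X + ρ Y) (R : ℕ) (hR : ∀ X, ρ X ≤ R)
    (A B : Set E) (W : ℕ → Set E) (k j : ℕ) (hj : j ≤ k + 1)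
    (hv : KRhs ρ A B W (k+1) < KLhs ρ A B W (k+1)) (hfull : ρ (B ∪ W j) = R) :
    KRhs ρ A B (dropW W j) k < KLhs ρ A B (dropW W j) k := by
  have sub' : ∀ X Y S T, S ⊆ X ∩ Y → T ⊆ X ∪ Y → ρ S + ρ T ≤ ρ X + ρ Y := by
    intro X Y S T h1 h2
    have := hsub X Y
    have := hmono _ _ h1
    have := hmono _ _ h2
    omega
  have full : ∀ X, B ∪ W j ⊆ X → ρ X = R := by
    intro X h
    have := hmono _ _ h
    have := hR X
    omega
  unfold KRhs KLhs at *
  have s1 := sum_drop W (fun X => ρ X) j k hj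
  have s2 := sum_drop W (fun X => ρ (B ∪ X)) j k hj
  beta_reduce at s1 s2
  rw [s1, s2, hfull] at hv
  rcases Nat.eq_zero_or_pos j with rfl | hpos
  · have s3 := sum_drop_zero W (fun X Y => ρ (X ∪ Y)) k
    have s4 := sum_drop_zero W (fun X Y => ρ (B ∪ X ∪ Y)) k
    beta_reduce at s3 s4
    rw [s3, s4] at hv
    have e0 : dropW W 0 0 = W 1 := by simp [dropW]
    have ek : dropW W 0 k = W (k+1) := by simp [dropW]
    have f1 := full (B ∪ W 0 ∪ W 1) (by intro x; simp; tauto)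
    rw [e0, ek]
    have i1 := sub' (A ∪ W 0) (W 0 ∪ W 1) (W 0) (A ∪ W 0 ∪ W 1) (by intro x; simp; tauto)
      (by intro x; simp; tauto)
    have i2 := sub' (A ∪ W 0 ∪ W 1) (A ∪ W 1 ∪ W (k+1)) (A ∪ W 1) (A ∪ W 0 ∪ W (k+1))
      (by intro x; simp; tauto) (by intro x; simp; tauto)
    omega
  by_cases hl : j = k + 1
  · subst hl
    have s3 := sum_drop_last W (fun X Y => ρ (X ∪ Y)) k
    have s4 := sum_drop_last W (fun X Y => ρ (B ∪ X ∪ Y)) k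
    beta_reduce at s3 s4
    rw [s3, s4] at hv
    have e0 : dropW W (k+1) 0 = W 0 := by simp [dropW]
    have ek : dropW W (k+1) k = W k := by simp [dropW]
    have f1 := full (B ∪ W k ∪ W (k+1)) (by intro x; simp; tauto)
    rw [e0, ek]
    have i1 := sub' (A ∪ W (k+1)) (W k ∪ W (k+1)) (W (k+1)) (A ∪ W k ∪ W (k+1))
      (by intro x; simp; tauto) (by intro x; simp; tauto)
    have i2 := sub' (A ∪ W k ∪ W (k+1)) (A ∪ W 0 ∪ W k) (A ∪ W k) (A ∪ W 0 ∪ W (k+1))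
      (by intro x; simp; tauto) (by intro x; simp; tauto)
    omega
  · obtain ⟨i, rfl⟩ : ∃ i, j = i + 1 := ⟨j - 1, by omega⟩
    have s3 := sum_drop_mid W (fun X Y => ρ (X ∪ Y)) i k (by omega)
    have s4 := sum_drop_mid W (fun X Y => ρ (B ∪ X ∪ Y)) i k (by omega)
    beta_reduce at s3 s4
    have e0 : dropW W (i+1) 0 = W 0 := by simp [dropW]
    have ek : dropW W (i+1) k = W (k+1) := by simp [dropW]; omega
    rw [e0, ek]
    have f1 := full (B ∪ W i ∪ W (i+1)) (by intro x; simp; tauto)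
    have f2 := full (B ∪ W (i+1) ∪ W (i+2)) (by intro x; simp; tauto)
    have f3 := full (B ∪ W i ∪ W (i+1) ∪ W (i+2)) (by intro x; simp; tauto)
    have i1 := sub' (W i ∪ W (i+1)) (W (i+1) ∪ W (i+2)) (W (i+1)) (W i ∪ W (i+1) ∪ W (i+2))
      (by intro x; simp; tauto) (by intro x; simp; tauto)
    have i2 := sub' (W i ∪ W (i+1) ∪ W (i+2)) (B ∪ W i ∪ W (i+2)) (W i ∪ W (i+2))
      (B ∪ W i ∪ W (i+1) ∪ W (i+2))
      (by intro x; simp; tauto) (by intro x; simp; tauto)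
    omega

theorem not_violation_zero {E : Type*} (ρ : Set E → ℕ) (hmono : ∀ X Y, X ⊆ Y → ρ X ≤ ρ Y)
    (hsub : ∀ X Y, ρ (X ∩ Y) + ρ (X ∪ Y) ≤ ρ X + ρ Y)
    (A B : Set E) (W : ℕ → Set E) : ¬ KRhs ρ A B W 0 < KLhs ρ A B W 0 := by
  unfold KRhs KLhs
  simp
  have e : A ∪ W 0 ∪ W 0 = A ∪ W 0 := by rw [Set.union_assoc, Set.union_self]
  rw [e]
  have h1 := hsub (A ∪ W 0) (B ∪ W 0)
  have h2 := hmono (W 0) ((A ∪ W 0) ∩ (B ∪ W 0)) (by intro x; simp; tauto)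
  have h3 := hmono (A ∪ B) ((A ∪ W 0) ∪ (B ∪ W 0)) (by intro x; simp only [Set.mem_union]; tauto)
  omega

/-- Reduction to families where no `B ∪ W j` has full rank. -/
theorem reduce_nonfull {E : Type*} (ρ : Set E → ℕ) (hmono : ∀ X Y, X ⊆ Y → ρ X ≤ ρ Y)
    (hsub : ∀ X Y, ρ (X ∩ Y) + ρ (X ∪ Y) ≤ ρ X + ρ Y) (R : ℕ) (hR : ∀ X, ρ X ≤ R)
    (N : ℕ) (P : Set E → Set E → (ℕ → Set E) → Prop)
    (hmain : ∀ k, k + 1 ≤ N → ∀ A B W, KRhs ρ A B W (k+1) < KLhs ρ A B W (k+1) →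
      (∀ j ≤ k+1, ρ (B ∪ W j) < R) → k + 1 = N ∧ P A B W)
    (k : ℕ) (hk : k ≤ N) (A B : Set E) (W : ℕ → Set E)
    (hv : KRhs ρ A B W k < KLhs ρ A B W k) : k = N ∧ P A B W := by
  have low : ∀ k, k < N → ∀ W, ¬ KRhs ρ A B W k < KLhs ρ A B W k := by
    intro k
    induction k with
    | zero => intro _ W; exact not_violation_zero ρ hmono hsub A B W
    | succ k ih =>
      intro hk W hv
      by_cases hf : ∀ j ≤ k+1, ρ (B ∪ W j) < R
      · have := (hmain k (by omega) A B W hv hf).1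
        omega
      · push Not at hf
        obtain ⟨j, hj, hf⟩ := hf
        exact ih (by omega) _ (drop_violation ρ hmono hsub R hR A B W k j hj hv
          (le_antisymm (hR _) hf))
  cases k with
  | zero => exact absurd hv (not_violation_zero ρ hmono hsub A B W)
  | succ k =>
    by_cases hf : ∀ j ≤ k+1, ρ (B ∪ W j) < R
    · exact hmain k hk A B W hv hf
    · push Not at hf
      obtain ⟨j, hj, hf⟩ := hf
      exact absurd (drop_violation ρ hmono hsub R hR A B W k j hj hv
          (le_antisymm (hR _) hf)) (low k (by omega) _)

theorem KLhs_rev {E : Type*} (ρ : Set E → ℕ) (A B : Set E) (W : ℕ → Set E) (k : ℕ) :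
    KLhs ρ A B (fun j => W (k - j)) k = KLhs ρ A B W k := by
  unfold KLhs
  have s1 := sum_range_reflect (fun j => ρ (W j)) (k+1)
  have s2 := sum_range_reflect (fun j => ρ (B ∪ W j ∪ W (j+1))) k
  simp only [Nat.sub_self, Nat.sub_zero, Nat.add_sub_cancel] at *
  rw [s1, ← s2]
  have e : A ∪ W k ∪ W 0 = A ∪ W 0 ∪ W k := by ext; simp; tauto
  rw [e]
  congr 1
  refine sum_congr rfl fun j hj => ?_
  simp at hj
  rw [show k - 1 - j = k - (j+1) by omega, show k - (j+1) + 1 = k - j by omega,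
    Set.union_assoc, Set.union_assoc, Set.union_comm (W _)]

theorem KRhs_rev {E : Type*} (ρ : Set E → ℕ) (A B : Set E) (W : ℕ → Set E) (k : ℕ) :
    KRhs ρ A B (fun j => W (k - j)) k = KRhs ρ A B W k := by
  unfold KRhs
  have s1 := sum_range_reflect (fun j => ρ (B ∪ W j)) (k+1)
  have s2 := sum_range_reflect (fun j => ρ (W j ∪ W (j+1))) k
  simp only [Nat.sub_self, Nat.sub_zero, Nat.add_sub_cancel] at *
  rw [s1, ← s2, add_comm (ρ (A ∪ W k))]
  congr 1
  refine sum_congr rfl fun j hj => ?_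
  simp at hj
  rw [show k - 1 - j = k - (j+1) by omega, show k - (j+1) + 1 = k - j by omega,
     Set.union_comm (W _)]

end KinserAux

set_option linter.unusedSectionVars false
set_option linter.unusedVariables false

namespace KinserAux
open Module Submodule

section LinAlg
variable {K V : Type*} [Field K] [AddCommGroup V] [Module K V] [FiniteDimensional K V]

theorem fr_add (S T : Submodule K V) :
    finrank K ↥(S ⊔ T) + finrank K ↥(S ⊓ T) = finrank K S + finrank K T :=
  Submodule.finrank_sup_add_finrank_inf_eq S T

theorem fr_mono {S T : Submodule K V} (h : S ≤ T) : finrank K S ≤ finrank K T :=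
  Submodule.finrank_mono h

theorem eq_of_fr {S T : Submodule K V} (h : S ≤ T) (h' : finrank K T ≤ finrank K S) : S = T :=
  Submodule.eq_of_le_of_finrank_le h h'

theorem step_lemma (D a b : Submodule K V) : ∃ p : ℕ,
    finrank K ↥(a ⊔ b) + finrank K ↥(D ⊔ a) + finrank K ↥(D ⊔ b)
        + finrank K ↥((D ⊓ a) ⊓ (D ⊓ b))
      = finrank K ↥(D ⊔ a ⊔ b) + finrank K a + finrank K b + finrank K D + p ∧
    (p = 0 → D ⊓ (a ⊔ b) ≤ (D ⊓ a) ⊔ (D ⊓ b)) := by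
  have hle : (D ⊓ a) ⊔ (D ⊓ b) ≤ D ⊓ (a ⊔ b) :=
    sup_le (inf_le_inf le_rfl le_sup_left) (inf_le_inf le_rfl le_sup_right)
  have h1 := fr_add D a
  have h2 := fr_add D b
  have h3 := fr_add D (a ⊔ b)
  have h4 := fr_add (D ⊓ a) (D ⊓ b)
  rw [← sup_assoc] at h3
  have h5 := fr_mono hle
  refine ⟨finrank K ↥(D ⊓ (a ⊔ b)) - finrank K ↥((D ⊓ a) ⊔ (D ⊓ b)), by omega, fun h => ?_⟩
  exact (eq_of_fr hle (by omega)).ge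

theorem chain_lemma (Q : ℕ → Submodule K V) (k : ℕ) : ∃ c : ℕ,
    ∑ j ∈ range (k+1), finrank K ↥(Q j ⊓ Q (j+1)) + c
      = ∑ j ∈ range k, finrank K (Q (j+1)) + finrank K ↥(Q 0 ⊓ Q (k+1)) ∧
    (c = 0 → ∀ j ≤ k + 1, Q 0 ⊓ Q (k+1) ≤ Q j ∧ Q j ≤ Q 0 ⊔ Q (k+1)) := by
  induction k with
  | zero =>
    refine ⟨0, by simp, fun _ j hj => ?_⟩
    interval_cases j
    · exact ⟨inf_le_left, le_sup_left⟩
    · exact ⟨inf_le_right, le_sup_right⟩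
  | succ k ih =>
    obtain ⟨c, hc, hc0⟩ := ih
    have h1 := fr_add (Q 0 ⊓ Q (k+1)) (Q (k+1) ⊓ Q (k+2))
    have l1 : (Q 0 ⊓ Q (k+1)) ⊔ (Q (k+1) ⊓ Q (k+2)) ≤ Q (k+1) := sup_le inf_le_right inf_le_left
    have l2 : (Q 0 ⊓ Q (k+1)) ⊓ (Q (k+1) ⊓ Q (k+2)) ≤ Q 0 ⊓ Q (k+2) :=
      inf_le_inf inf_le_left inf_le_right
    have h2 := fr_mono l1
    have h3 := fr_mono l2
    rw [sum_range_succ, sum_range_succ (fun j => finrank K (Q (j+1))) k]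
    rw [show k + 1 + 1 = k + 2 by omega]
    refine ⟨finrank K (Q (k+1)) + finrank K ↥(Q 0 ⊓ Q (k+2)) + c
      - finrank K ↥(Q 0 ⊓ Q (k+1)) - finrank K ↥(Q (k+1) ⊓ Q (k+2)), by omega, fun h j hj => ?_⟩
    have e1 := eq_of_fr l1 (by omega)
    have e2 := eq_of_fr l2 (by omega)
    have hc1 := hc0 (by omega)
    have t1 : Q 0 ⊓ Q (k+2) ≤ Q 0 ⊓ Q (k+1) := by
      rw [← e2]; exact inf_le_left
    have t2 : Q (k+1) ≤ Q 0 ⊔ Q (k+2) := by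
      rw [← e1]; exact sup_le_sup inf_le_left inf_le_right
    by_cases hj2 : j = k + 2
    · subst hj2; exact ⟨inf_le_right, le_sup_right⟩
    · obtain ⟨a, b⟩ := hc1 j (by omega)
      exact ⟨t1.trans a, b.trans (sup_le le_sup_left t2)⟩

theorem bracket_lemma (A D a b : Submodule K V) : ∃ s : ℕ,
    finrank K ↥(A ⊔ a) + finrank K ↥(A ⊔ b) + finrank K D
      = finrank K ↥(A ⊔ a ⊔ b) + finrank K ↥(A ⊔ D) + finrank K ↥((D ⊓ a) ⊓ (D ⊓ b)) + s ∧
    (s = 0 → (A ⊔ a) ⊓ (A ⊔ b) ≤ A ⊔ ((D ⊓ a) ⊓ (D ⊓ b)) ∧ A ⊓ D ≤ (D ⊓ a) ⊓ (D ⊓ b)) := by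
  set T := (D ⊓ a) ⊓ (D ⊓ b) with hT
  have h1 := fr_add (A ⊔ a) (A ⊔ b)
  have h2 := fr_add A D
  have h3 := fr_add A T
  have l1 : A ⊔ T ≤ (A ⊔ a) ⊓ (A ⊔ b) := by
    refine le_inf (sup_le_sup le_rfl ?_) (sup_le_sup le_rfl ?_)
    · exact inf_le_left.trans inf_le_right
    · exact inf_le_right.trans inf_le_right
  have l2 : A ⊓ T ≤ A ⊓ D := inf_le_inf le_rfl (inf_le_left.trans inf_le_left)
  have e : A ⊔ a ⊔ (A ⊔ b) = A ⊔ a ⊔ b := by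
    rw [sup_sup_sup_comm, sup_idem, sup_assoc]
  rw [e] at h1
  have m1 := fr_mono l1
  have m2 := fr_mono l2
  refine ⟨(finrank K ↥((A ⊔ a) ⊓ (A ⊔ b)) - finrank K ↥(A ⊔ T))
    + (finrank K ↥(A ⊓ D) - finrank K ↥(A ⊓ T)), by omega, fun h => ⟨?_, ?_⟩⟩
  · exact (eq_of_fr l1 (by omega)).ge
  · rw [← eq_of_fr l2 (by omega)]; exact inf_le_right

theorem sum_identity (d2 : ℕ) (e d q u t a p : ℕ → ℕ) (k : ℕ)
    (h1 : ∀ j ≤ k + 1, d j + d2 = e j + q j)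
    (h2 : ∀ j ≤ k, u j + e j + e (j+1) + a j = t j + d j + d (j+1) + d2 + p j) :
    ∑ j ∈ range (k+1+1), e j + ∑ j ∈ range (k+1), u j + ∑ j ∈ range (k+1), a j
      = ∑ j ∈ range (k+1+1), d j + ∑ j ∈ range (k+1), t j + ∑ j ∈ range k, q (j+1) + d2
        + ∑ j ∈ range (k+1), p j := by
  induction k with
  | zero =>
    have := h2 0 le_rfl
    simp [sum_range_succ] at *
    omega
  | succ k ih =>
    have i1 := ih (fun j hj => h1 j (by omega)) (fun j hj => h2 j (by omega))
    have i2 := h1 (k+1) (by omega)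
    have i3 := h2 (k+1) le_rfl
    rw [sum_range_succ e (k+1+1), sum_range_succ u, sum_range_succ a, sum_range_succ d (k+1+1),
      sum_range_succ t, sum_range_succ (fun j => q (j+1)), sum_range_succ p]
    omega

end LinAlg

/-- A vector configuration with a circuit-hyperplane `H`. -/
structure Cfg (K V E : Type*) [Field K] [AddCommGroup V] [Module K V] [Fintype E] where
  φ : E → V
  H : Set E
  hyp : finrank K (span K (φ '' H)) + 1 = finrank K V
  card : H.ncard = finrank K V
  out : ∀ y, y ∉ H → φ y ∉ span K (φ '' H)
  ind : ∀ X, X ⊂ H → LinearIndepOn K φ X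

namespace Cfg
variable {K V E : Type*} [Field K] [AddCommGroup V] [Module K V] [FiniteDimensional K V]
  [Fintype E] (c : Cfg K V E)

/-- span of a set of elements -/
def sp (X : Set E) : Submodule K V := span K (c.φ '' X)

open Classical in
/-- indicator of `X = H` -/
noncomputable def eps (X : Set E) : ℕ := if X = c.H then 1 else 0

/-- rank function of the relaxation -/
noncomputable def rho (X : Set E) : ℕ := finrank K (c.sp X) + c.eps X

/-- The hyperplane -/
def Om : Submodule K V := c.sp c.H

theorem sp_union (X Y : Set E) : c.sp (X ∪ Y) = c.sp X ⊔ c.sp Y := by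
  unfold sp; rw [Set.image_union, span_union]

theorem sp_mono {X Y : Set E} (h : X ⊆ Y) : c.sp X ≤ c.sp Y := span_mono (Set.image_mono h)

theorem mem_sp {X : Set E} {e : E} (h : e ∈ X) : c.φ e ∈ c.sp X :=
  subset_span (Set.mem_image_of_mem _ h)

theorem sp_le {X : Set E} {S : Submodule K V} (h : ∀ e ∈ X, c.φ e ∈ S) : c.sp X ≤ S := by
  unfold sp; rw [span_le]; rintro _ ⟨e, he, rfl⟩; exact h e he

theorem sp_le_iff {X : Set E} {S : Submodule K V} : c.sp X ≤ S ↔ ∀ e ∈ X, c.φ e ∈ S :=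
  ⟨fun h _ he => h (c.mem_sp he), c.sp_le⟩

theorem fr_sp {X : Set E} (h : X ⊂ c.H) : finrank K (c.sp X) = X.ncard := by
  have h1 := c.ind X h
  have : Fintype X := Fintype.ofFinite _
  have h2 := finrank_span_eq_card h1
  have e : Set.range (fun x : X => c.φ x) = c.φ '' X := by
    ext; simp
  rw [e] at h2
  rw [sp, h2, ← Nat.card_eq_fintype_card, Nat.card_coe_set_eq]

theorem rho_sub {X : Set E} (h : X ⊆ c.H) : c.rho X = X.ncard := by
  unfold rho eps
  split_ifs with h'
  · rw [h', c.card, ← c.hyp]; rfl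
  · rw [c.fr_sp (h.ssubset_of_ne h')]; rfl

theorem rho_H : c.rho c.H = finrank K V := by rw [c.rho_sub le_rfl, c.card]

theorem eps_H : c.eps c.H = 1 := by simp [eps]

theorem eps_ne {X : Set E} (h : X ≠ c.H) : c.eps X = 0 := by simp [eps, h]

theorem eps_not_sub {X : Set E} (h : ¬ X ⊆ c.H) : c.eps X = 0 :=
  c.eps_ne (fun h' => h h'.le)

theorem top_of_out {S : Submodule K V} (h : c.Om ≤ S) {x : V} (hx : x ∈ S) (hx' : x ∉ c.Om) :
    S = ⊤ := by
  apply eq_of_fr le_top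
  rw [finrank_top, ← c.hyp]
  apply finrank_lt_finrank_of_lt
  exact lt_of_le_of_ne h (fun e => hx' ((show c.Om = S from e) ▸ hx))

theorem sp_top_of {X : Set E} (h : c.Om ≤ c.sp X) (h' : ¬ X ⊆ c.H) : c.sp X = ⊤ := by
  obtain ⟨y, hy, hyH⟩ := Set.not_subset.mp h'
  exact c.top_of_out h (c.mem_sp hy) (c.out y hyH)

theorem not_mem_Om {y : E} (hy : y ∉ c.H) : c.φ y ∉ c.Om := c.out y hy

theorem rho_le (X : Set E) : c.rho X ≤ finrank K V := by
  by_cases h : X = c.H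
  · rw [h, c.rho_H]
  · rw [rho, c.eps_ne h]; exact Submodule.finrank_le _

/-- not of full rank -/
def NF (X : Set E) : Prop := c.rho X < finrank K V

variable {c} in
theorem NF.ne {X : Set E} (h : c.NF X) : X ≠ c.H := by
  rintro rfl
  unfold NF at h
  rw [c.rho_H] at h
  omega

variable {c} in
theorem NF.sp_ne {X : Set E} (h : c.NF X) : c.sp X ≠ ⊤ := by
  intro h'
  unfold NF rho at h
  rw [h', finrank_top] at h
  omega

variable {c} in
theorem NF.not_sub {X : Set E} (h : c.NF X) : ¬ c.H ⊆ X := by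
  intro h'
  by_cases hX : X ⊆ c.H
  · exact h.ne (hX.antisymm h')
  · exact h.sp_ne (c.sp_top_of (c.sp_mono h') hX)

variable {c} in
theorem NF.ssub {X : Set E} (h : c.NF X) (hX : X ⊆ c.H) : X ⊂ c.H :=
  hX.ssubset_of_ne h.ne

theorem rho_mono {X Y : Set E} (h : X ⊆ Y) : c.rho X ≤ c.rho Y := by
  by_cases hY : c.rho Y < finrank K V
  · have hY : c.NF Y := hY
    have : X ≠ c.H := by
      rintro rfl; exact hY.not_sub h
    rw [rho, rho, c.eps_ne this]
    have := fr_mono (c.sp_mono h)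
    omega
  · have := c.rho_le X
    omega

variable {c} in
theorem NF.mono {X Y : Set E} (h : c.NF Y) (hXY : X ⊆ Y) : c.NF X :=
  lt_of_le_of_lt (c.rho_mono hXY) h

variable {c} in
theorem NF.not_Om {X : Set E} (h : c.NF X) (hX : ¬ X ⊆ c.H) : ¬ c.Om ≤ c.sp X :=
  fun h' => h.sp_ne (c.sp_top_of h' hX)

theorem sp_inf {X Y : Set E} (h : X ∪ Y ⊂ c.H) : c.sp X ⊓ c.sp Y = c.sp (X ∩ Y) := by
  symm
  apply eq_of_fr
  · exact le_inf (c.sp_mono Set.inter_subset_left) (c.sp_mono Set.inter_subset_right)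
  · have h1 := fr_add (c.sp X) (c.sp Y)
    rw [← sp_union, c.fr_sp h, c.fr_sp (Set.subset_union_left.trans_ssubset h),
      c.fr_sp (Set.subset_union_right.trans_ssubset h)] at h1
    rw [c.fr_sp ((Set.inter_subset_left.trans Set.subset_union_left).trans_ssubset h)]
    have := Set.ncard_union_add_ncard_inter X Y
    omega

end Cfg
end KinserAux

set_option linter.unusedSectionVars false
set_option linter.unusedVariables false

namespace KinserAux
open Module Submodule
namespace Cfg
variable {K V E : Type*} [Field K] [AddCommGroup V] [Module K V] [FiniteDimensional K V]
  [Fintype E] (c : Cfg K V E)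

theorem rho_eq {X : Set E} (h : c.NF X) : c.rho X = finrank K (c.sp X) := by
  rw [rho, c.eps_ne h.ne]; rfl

theorem stepN (B a b : Set E) (ha : c.NF (B ∪ a)) (hb : c.NF (B ∪ b)) : ∃ p : ℕ,
    c.rho (a ∪ b) + c.rho (B ∪ a) + c.rho (B ∪ b)
        + finrank K ↥((c.sp B ⊓ c.sp a) ⊓ (c.sp B ⊓ c.sp b))
      = c.rho (B ∪ a ∪ b) + c.rho a + c.rho b + finrank K (c.sp B) + p ∧
    (p = 0 → c.eps (B ∪ a ∪ b) = 0 →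
      c.sp B ⊓ (c.sp a ⊔ c.sp b) ≤ (c.sp B ⊓ c.sp a) ⊔ (c.sp B ⊓ c.sp b)) := by
  have ha' := ha.mono (Set.subset_union_right : a ⊆ B ∪ a)
  have hb' := hb.mono (Set.subset_union_right : b ⊆ B ∪ b)
  have hB' := ha.mono (Set.subset_union_left : B ⊆ B ∪ a)
  by_cases h : B ∪ a ∪ b = c.H
  · have hB : B ⊆ c.H := fun x hx => h ▸ Or.inl (Or.inl hx)
    have haH : a ⊆ c.H := fun x hx => h ▸ Or.inl (Or.inr hx)
    have hbH : b ⊆ c.H := fun x hx => h ▸ Or.inr hx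
    have hle : c.sp (B ∩ (a ∩ b)) ≤ (c.sp B ⊓ c.sp a) ⊓ (c.sp B ⊓ c.sp b) := by
      refine le_inf (le_inf (c.sp_mono ?_) (c.sp_mono ?_)) (le_inf (c.sp_mono ?_) (c.sp_mono ?_)) <;>
      · rintro x ⟨h1, h2, h3⟩; assumption
    have h1 := fr_mono hle
    rw [c.fr_sp (Set.inter_subset_left.trans_ssubset (hB'.ssub hB))] at h1
    rw [h, c.rho_sub le_rfl, c.rho_sub haH, c.rho_sub hbH, ← c.rho_eq hB', c.rho_sub hB,
      c.rho_sub (Set.union_subset haH hbH), c.rho_sub (Set.union_subset hB haH),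
      c.rho_sub (Set.union_subset hB hbH), c.eps_H]
    have e1 := Set.ncard_union_add_ncard_inter a b
    have e2 := Set.ncard_union_add_ncard_inter B a
    have e3 := Set.ncard_union_add_ncard_inter B b
    have e4 := Set.ncard_union_add_ncard_inter B (a ∪ b)
    have e5 := Set.ncard_union_add_ncard_inter (B ∩ a) (B ∩ b)
    rw [← Set.union_assoc, h] at e4
    rw [← Set.inter_union_distrib_left, ← Set.inter_inter_distrib_left] at e5
    refine ⟨finrank K ↥((c.sp B ⊓ c.sp a) ⊓ (c.sp B ⊓ c.sp b)) - (B ∩ (a ∩ b)).ncard, by omega, ?_⟩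
    intro _ h; omega
  · obtain ⟨p, hp, hp0⟩ := step_lemma (c.sp B) (c.sp a) (c.sp b)
    refine ⟨p + c.eps (a ∪ b), ?_, fun h0 _ => hp0 (by omega)⟩
    rw [c.rho_eq ha, c.rho_eq hb, c.rho_eq ha', c.rho_eq hb', rho, rho, c.eps_ne h, sp_union,
      sp_union, sp_union, sp_union, sp_union]
    omega

/-- `T` -/
def TT (B : Set E) (W : ℕ → Set E) (k : ℕ) : Submodule K V :=
  (c.sp B ⊓ c.sp (W 0)) ⊓ (c.sp B ⊓ c.sp (W k))

theorem slack (A B : Set E) (W : ℕ → Set E) (k : ℕ) (hnf : ∀ j ≤ k+1, c.NF (B ∪ W j)) :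
    ∃ (P : ℕ → ℕ) (C : ℕ),
      KRhs c.rho A B W (k+1) + finrank K (c.TT B W (k+1)) + c.rho (A ∪ B)
          + c.rho (A ∪ W 0 ∪ W (k+1))
        = KLhs c.rho A B W (k+1) + c.rho (A ∪ W 0) + c.rho (A ∪ W (k+1)) + finrank K (c.sp B)
          + ∑ j ∈ range (k+1), P j + C ∧
      (∀ j ≤ k, P j = 0 → c.eps (B ∪ W j ∪ W (j+1)) = 0 →
        c.sp B ⊓ (c.sp (W j) ⊔ c.sp (W (j+1)))
          ≤ (c.sp B ⊓ c.sp (W j)) ⊔ (c.sp B ⊓ c.sp (W (j+1)))) ∧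
      (C = 0 → ∀ j ≤ k + 1, c.TT B W (k+1) ≤ c.sp B ⊓ c.sp (W j) ∧
        c.sp B ⊓ c.sp (W j) ≤ (c.sp B ⊓ c.sp (W 0)) ⊔ (c.sp B ⊓ c.sp (W (k+1)))) := by
  have hst : ∀ j, ∃ p : ℕ, j ≤ k → 
      (c.rho (W j ∪ W (j+1)) + c.rho (B ∪ W j) + c.rho (B ∪ W (j+1))
        + finrank K ↥((c.sp B ⊓ c.sp (W j)) ⊓ (c.sp B ⊓ c.sp (W (j+1))))
      = c.rho (B ∪ W j ∪ W (j+1)) + c.rho (W j) + c.rho (W (j+1)) + finrank K (c.sp B) + p ∧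
    (p = 0 → c.eps (B ∪ W j ∪ W (j+1)) = 0 →
      c.sp B ⊓ (c.sp (W j) ⊔ c.sp (W (j+1)))
        ≤ (c.sp B ⊓ c.sp (W j)) ⊔ (c.sp B ⊓ c.sp (W (j+1))))) := by
    intro j
    by_cases hj : j ≤ k
    · obtain ⟨p, hp⟩ := c.stepN B (W j) (W (j+1)) (hnf j (by omega)) (hnf (j+1) (by omega))
      exact ⟨p, fun _ => hp⟩
    · exact ⟨0, fun h => absurd h hj⟩
  choose P hP using hst
  obtain ⟨C, hC, hC0⟩ := chain_lemma (fun j => c.sp B ⊓ c.sp (W j)) k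
  refine ⟨P, C, ?_, fun j hj => (hP j hj).2, hC0⟩
  have key := sum_identity (finrank K (c.sp B)) (fun j => c.rho (B ∪ W j)) (fun j => c.rho (W j))
    (fun j => finrank K ↥(c.sp B ⊓ c.sp (W j))) (fun j => c.rho (W j ∪ W (j+1)))
    (fun j => c.rho (B ∪ W j ∪ W (j+1)))
    (fun j => finrank K ↥((c.sp B ⊓ c.sp (W j)) ⊓ (c.sp B ⊓ c.sp (W (j+1))))) P k
    (by
      intro j hj
      have h := hnf j hj
      have := fr_add (c.sp B) (c.sp (W j))
      rw [c.rho_eq h, c.rho_eq (h.mono Set.subset_union_right), sp_union]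
      omega)
    (fun j hj => (hP j hj).1)
  unfold KRhs KLhs
  unfold TT
  beta_reduce at key hC
  omega

theorem slack2 (A B : Set E) (W : ℕ → Set E) (k : ℕ) (hnf : ∀ j ≤ k+1, c.NF (B ∪ W j))
    (hv : KRhs c.rho A B W (k+1) < KLhs c.rho A B W (k+1)) :
    ((c.sp A ⊔ c.sp (W 0)) ⊓ (c.sp A ⊔ c.sp (W (k+1))) ≤ c.sp A ⊔ c.TT B W (k+1) ∧
      c.sp A ⊓ c.sp B ≤ c.TT B W (k+1)) ∧
    (∀ j ≤ k, c.eps (B ∪ W j ∪ W (j+1)) = 0 →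
        c.sp B ⊓ (c.sp (W j) ⊔ c.sp (W (j+1)))
          ≤ (c.sp B ⊓ c.sp (W j)) ⊔ (c.sp B ⊓ c.sp (W (j+1)))) ∧
    (∀ j ≤ k + 1, c.TT B W (k+1) ≤ c.sp B ⊓ c.sp (W j) ∧
        c.sp B ⊓ c.sp (W j) ≤ (c.sp B ⊓ c.sp (W 0)) ⊔ (c.sp B ⊓ c.sp (W (k+1)))) ∧
    A ∪ W 0 ≠ c.H ∧ A ∪ W (k+1) ≠ c.H ∧
    ((A ∪ B = c.H) ∨
      (A ∪ W 0 ∪ W (k+1) = c.H ∧ ¬ B ⊆ c.H ∧ W 0 ∪ W (k+1) = c.H)) := by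
  obtain ⟨P, C, hPC, hP, hC⟩ := c.slack A B W k hnf
  obtain ⟨s, hs, hs0⟩ := bracket_lemma (c.sp A) (c.sp B) (c.sp (W 0)) (c.sp (W (k+1)))
  have hs' : (c.rho (A ∪ W 0) : ℤ) - c.eps (A ∪ W 0) + (c.rho (A ∪ W (k+1)) - c.eps (A ∪ W (k+1)))
      + finrank K (c.sp B) = (c.rho (A ∪ W 0 ∪ W (k+1)) - c.eps (A ∪ W 0 ∪ W (k+1)))
        + (c.rho (A ∪ B) - c.eps (A ∪ B)) + finrank K (c.TT B W (k+1)) + s := by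
    unfold rho
    rw [sp_union, sp_union, sp_union, sp_union, sp_union]
    unfold TT
    push_cast
    have : ((finrank K ↥(c.sp A ⊔ c.sp (W 0)) + finrank K ↥(c.sp A ⊔ c.sp (W (k+1)))
      + finrank K (c.sp B) : ℕ) : ℤ) = ((finrank K ↥(c.sp A ⊔ c.sp (W 0) ⊔ c.sp (W (k+1))) + finrank K ↥(c.sp A ⊔ c.sp B) + finrank K ↥((c.sp B ⊓ c.sp (W 0)) ⊓ (c.sp B ⊓ c.sp (W (k+1)))) + s : ℕ) : ℤ) := by
      rw [hs]
    push_cast at this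
    linarith
  have e1 : c.eps (A ∪ B) ≤ 1 := by unfold eps; split_ifs <;> simp
  have e2 : c.eps (A ∪ W 0 ∪ W (k+1)) ≤ 1 := by unfold eps; split_ifs <;> simp
  have n0 := hnf 0 (by omega)
  have nk := hnf (k+1) (by omega)
  have nB := n0.mono (Set.subset_union_left : B ⊆ B ∪ W 0)
  have n0' := n0.mono (Set.subset_union_right : W 0 ⊆ B ∪ W 0)
  have nk' := nk.mono (Set.subset_union_right : W (k+1) ⊆ B ∪ W (k+1))
  have hnot : A ∪ W 0 ∪ W (k+1) = c.H → ¬ B ⊆ c.H := by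
    intro h hB
    have hA : A ⊆ c.H := fun x hx => h ▸ Or.inl (Or.inl hx)
    have h0 : W 0 ⊆ c.H := fun x hx => h ▸ Or.inl (Or.inr hx)
    have hk : W (k+1) ⊆ c.H := fun x hx => h ▸ Or.inr hx
    have hT : c.TT B W (k+1) = c.sp (B ∩ (W 0 ∩ W (k+1))) := by
      unfold TT
      rw [c.sp_inf (n0.ssub (Set.union_subset hB h0)), c.sp_inf (nk.ssub (Set.union_subset hB hk)),
        c.sp_inf, ← Set.inter_inter_distrib_left]
      exact (Set.union_subset Set.inter_subset_left Set.inter_subset_left).trans_ssubset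
        (nB.ssub hB)
    have hTf : finrank K (c.TT B W (k+1)) = (B ∩ (W 0 ∩ W (k+1))).ncard := by
      rw [hT, c.fr_sp (Set.inter_subset_left.trans_ssubset (nB.ssub hB))]
    rw [← c.rho_eq nB, c.rho_sub hB, h, c.rho_sub le_rfl, c.rho_sub (Set.union_subset hA hB),
      c.rho_sub (Set.union_subset hA h0), c.rho_sub (Set.union_subset hA hk), hTf] at hPC
    have i1 := Set.ncard_union_add_ncard_inter (A ∪ W 0) (A ∪ W (k+1))
    have i2 := Set.ncard_union_add_ncard_inter (A ∪ (W 0 ∩ W (k+1))) B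
    rw [← Set.union_inter_distrib_left] at i1
    have u1 : (A ∪ W 0) ∪ (A ∪ W (k+1)) = c.H := by
      rw [← h]; ext; simp; tauto
    rw [u1] at i1
    have i3 : (A ∪ B).ncard ≤ (A ∪ (W 0 ∩ W (k+1)) ∪ B).ncard :=
      Set.ncard_le_ncard (by intro x; simp; tauto)
    have i4 : (B ∩ (W 0 ∩ W (k+1))).ncard ≤ ((A ∪ (W 0 ∩ W (k+1))) ∩ B).ncard :=
      Set.ncard_le_ncard (by intro x; simp; tauto)
    omega
  have hsum : c.eps (A ∪ B) + c.eps (A ∪ W 0 ∪ W (k+1)) ≤ 1 := by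
    by_cases h : A ∪ W 0 ∪ W (k+1) = c.H
    · have : ¬ A ∪ B ⊆ c.H := fun h' => hnot h (Set.subset_union_right.trans h')
      rw [c.eps_not_sub this]; omega
    · rw [c.eps_ne h]; omega
  have z : s = 0 ∧ C = 0 ∧ ∑ j ∈ range (k+1), P j = 0 ∧ c.eps (A ∪ W 0) = 0 ∧
      c.eps (A ∪ W (k+1)) = 0 ∧ c.eps (A ∪ B) + c.eps (A ∪ W 0 ∪ W (k+1)) = 1 := by omega
  obtain ⟨z1, z2, z3, z4, z5, z6⟩ := z
  have br := hs0 z1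
  have zP : ∀ j ≤ k, P j = 0 := by
    intro j hj
    exact (sum_eq_zero_iff.mp z3) j (by simp; omega)
  have ne1 : A ∪ W 0 ≠ c.H := by
    intro h; rw [h, c.eps_H] at z4; omega
  have ne2 : A ∪ W (k+1) ≠ c.H := by
    intro h; rw [h, c.eps_H] at z5; omega
  refine ⟨br, fun j hj => hP j hj (zP j hj), hC z2, ne1, ne2, ?_⟩
  by_cases h : A ∪ W 0 ∪ W (k+1) = c.H
  · right
    refine ⟨h, hnot h, ?_⟩
    by_contra hne
    have hA : A ⊆ c.H := fun x hx => h ▸ Or.inl (Or.inl hx)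
    have h0 : W 0 ⊆ c.H := fun x hx => h ▸ Or.inl (Or.inr hx)
    have hk : W (k+1) ⊆ c.H := fun x hx => h ▸ Or.inr hx
    have s0 := (Set.union_subset hA h0).ssubset_of_ne ne1
    have sk := (Set.union_subset hA hk).ssubset_of_ne ne2
    have l1 : (c.sp A ⊔ c.sp (W 0)) ⊓ (c.sp A ⊔ c.sp (W (k+1))) ≤ c.sp (A ∪ (W 0 ∩ W (k+1))) := by
      refine br.1.trans ?_
      rw [sp_union, ← c.sp_inf ((Set.union_subset h0 hk).ssubset_of_ne hne)]
      exact sup_le_sup le_rfl (inf_le_inf inf_le_right inf_le_right)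
    have f1 := fr_mono l1
    have f2 := fr_add (c.sp A ⊔ c.sp (W 0)) (c.sp A ⊔ c.sp (W (k+1)))
    have u1 : (A ∪ W 0) ∪ (A ∪ W (k+1)) = c.H := by
      rw [← h]; ext; simp; tauto
    rw [← sp_union, ← sp_union, ← sp_union, c.fr_sp s0, c.fr_sp sk, u1] at f2
    have i1 := Set.ncard_union_add_ncard_inter (A ∪ W 0) (A ∪ W (k+1))
    rw [← Set.union_inter_distrib_left, u1] at i1
    rw [c.fr_sp, ← sp_union, ← sp_union] at f1
    · have := c.hyp
      have hh := c.card
      change finrank K (c.sp c.H) + 1 = _ at this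
      omega
    · refine Set.ssubset_of_subset_of_ssubset ?_ s0
      exact Set.union_subset_union_right _ Set.inter_subset_left
  · left
    rw [c.eps_ne h] at z6
    by_contra h'
    rw [c.eps_ne h'] at z6
    omega

end Cfg
end KinserAux

set_option linter.unusedSectionVars false
set_option linter.unusedVariables false

namespace KinserAux
open Module Submodule
namespace Cfg
variable {K V E : Type*} [Field K] [AddCommGroup V] [Module K V] [FiniteDimensional K V]
  [Fintype E] (c : Cfg K V E)

theorem fr_sp_of_indep {X : Set E} (h1 : LinearIndepOn K c.φ X) :
    finrank K (c.sp X) = X.ncard := by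
  have : Fintype X := Fintype.ofFinite _
  have h2 := finrank_span_eq_card h1
  have e : Set.range (fun x : X => c.φ x) = c.φ '' X := by
    ext; simp
  rw [e] at h2
  rw [sp, h2, ← Nat.card_eq_fintype_card, Nat.card_coe_set_eq]

/-- independence in the relaxation -/
def RInd (I : Set E) : Prop := LinearIndepOn K c.φ I ∨ I = c.H

theorem RInd_of_sub {I : Set E} (h : I ⊆ c.H) : c.RInd I := by
  by_cases h' : I = c.H
  · exact Or.inr h'
  · exact Or.inl (c.ind I (h.ssubset_of_ne h'))

theorem RInd_card {I : Set E} (h : c.RInd I) : I.ncard = c.rho I := by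
  by_cases h' : I = c.H
  · rw [h', c.rho_sub le_rfl]
  · rcases h with h | h
    · rw [rho, c.eps_ne h', c.fr_sp_of_indep h]; rfl
    · exact absurd h h'

theorem RInd_subset {I J : Set E} (hJ : c.RInd J) (h : I ⊆ J) : c.RInd I := by
  rcases hJ with hJ | rfl
  · exact Or.inl (hJ.mono h)
  · exact c.RInd_of_sub h

theorem RInd_aug {I J : Set E} (hI : c.RInd I) (hJ : c.RInd J) (h : I.ncard < J.ncard) :
    ∃ e ∈ J, e ∉ I ∧ c.RInd (insert e I) := by
  have hr : J.ncard ≤ finrank K V := by rw [c.RInd_card hJ]; exact c.rho_le J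
  have hI' : LinearIndepOn K c.φ I := by
    rcases hI with hI | rfl
    · exact hI
    · rw [c.card] at h; omega
  by_cases hJI : J = c.H ∧ I ⊆ c.H
  · obtain ⟨rfl, hIH⟩ := hJI
    have : ∃ e ∈ c.H, e ∉ I := by
      by_contra hc
      push Not at hc
      have := Set.ncard_le_ncard (show c.H ⊆ I from hc)
      omega
    obtain ⟨e, he, heI⟩ := this
    exact ⟨e, he, heI, c.RInd_of_sub (Set.insert_subset he hIH)⟩
  · by_contra hc
    push Not at hc
    have hle : c.sp J ≤ c.sp I := by
      apply c.sp_le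
      intro e he
      by_cases heI : e ∈ I
      · exact c.mem_sp heI
      · by_contra hn
        exact hc e he heI (Or.inl (hI'.insert hn))
    have f := c.fr_sp_of_indep hI'
    have := fr_mono hle
    by_cases hJH : J = c.H
    · subst hJH
      have hIH : ¬ I ⊆ c.H := fun h => hJI ⟨rfl, h⟩
      have := c.sp_top_of hle hIH
      rw [this, finrank_top] at f
      omega
    · have hJ' := hJ.resolve_right hJH
      have := c.fr_sp_of_indep hJ'
      omega

/-- the relaxation as a matroid -/
noncomputable def mat : Matroid E :=
  (IndepMatroid.ofFinite (E := Set.univ) Set.finite_univ c.RInd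
    (Or.inl (linearIndepOn_empty K c.φ)) (fun _ _ hJ h => c.RInd_subset hJ h)
    (fun _ _ hI hJ h => c.RInd_aug hI hJ h) (fun _ _ => Set.subset_univ _)).matroid

theorem mat_E : c.mat.E = Set.univ := rfl

theorem mat_indep (I : Set E) : c.mat.Indep I ↔ c.RInd I := by
  exact Iff.rfl

theorem mat_rnk (X : Set E) : c.mat.rnk X = c.rho X := by
  unfold Matroid.rnk
  apply le_antisymm
  · refine csSup_le ⟨0, ∅, by simp, by simp, by simp⟩ ?_
    rintro _ ⟨I, hI, hIX, rfl⟩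
    rw [mat_indep] at hI
    rw [c.RInd_card hI]
    exact c.rho_mono hIX
  · apply le_csSup
    · refine ⟨Nat.card E, ?_⟩
      rintro _ ⟨J, _, _, rfl⟩
      exact Set.ncard_le_card J
    · by_cases h : X = c.H
      · refine ⟨X, ?_, le_rfl, ?_⟩
        · rw [mat_indep]; exact Or.inr h
        · rw [h, c.rho_sub le_rfl]
      · obtain ⟨I, hIX, -, hsp, hI⟩ := exists_linearIndepOn_extension (linearIndepOn_empty K c.φ)
          (Set.empty_subset X)
        refine ⟨I, ?_, hIX, ?_⟩
        · rw [mat_indep]; exact Or.inl hI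
        · rw [← c.fr_sp_of_indep hI, rho, c.eps_ne h, add_zero]
          rw [le_antisymm (c.sp_mono hIX) (span_le.mpr hsp : c.sp X ≤ c.sp I)]

theorem rho_submod (X Y : Set E) : c.rho (X ∩ Y) + c.rho (X ∪ Y) ≤ c.rho X + c.rho Y := by
  have := rnk_submod c.mat X Y
  simpa only [mat_rnk] using this

theorem rho_submod' {X Y S T : Set E} (h1 : S ⊆ X ∩ Y) (h2 : T ⊆ X ∪ Y) :
    c.rho S + c.rho T ≤ c.rho X + c.rho Y := by
  have := c.rho_submod X Y
  have := c.rho_mono h1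
  have := c.rho_mono h2
  omega

/-- In type B we may replace `A` by `W 0 ∩ W (k+1)`. -/
theorem replaceJ (A B : Set E) (W : ℕ → Set E) (k : ℕ)
    (hv : KRhs c.rho A B W (k+1) < KLhs c.rho A B W (k+1))
    (h1 : A ∪ W 0 ∪ W (k+1) = c.H) (h2 : W 0 ∪ W (k+1) = c.H) :
    KRhs c.rho (W 0 ∩ W (k+1)) B W (k+1) < KLhs c.rho (W 0 ∩ W (k+1)) B W (k+1) := by
  have hA : A ⊆ c.H := fun x hx => h1 ▸ Or.inl (Or.inl hx)
  have h0 : W 0 ⊆ c.H := fun x hx => h2 ▸ Or.inl hx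
  have hk : W (k+1) ⊆ c.H := fun x hx => h2 ▸ Or.inr hx
  set J := W 0 ∩ W (k+1) with hJ
  have e1 : J ∪ W 0 = W 0 := by rw [hJ]; ext; simp; tauto
  have e2 : J ∪ W (k+1) = W (k+1) := by rw [hJ]; ext; simp
  have e3 : J ∪ W 0 ∪ W (k+1) = c.H := by rw [e1, h2]
  unfold KRhs KLhs at *
  rw [h1, c.rho_sub (Set.union_subset hA h0), c.rho_sub (Set.union_subset hA hk)] at hv
  rw [e3, e1, e2, c.rho_sub h0, c.rho_sub hk]
  have i1 := Set.ncard_union_add_ncard_inter (A ∪ W 0) (A ∪ W (k+1))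
  have i2 := Set.ncard_union_add_ncard_inter (W 0) (W (k+1))
  have u1 : (A ∪ W 0) ∪ (A ∪ W (k+1)) = c.H := by
    rw [← h1]; ext; simp; tauto
  rw [← Set.union_inter_distrib_left, u1, ← hJ] at i1
  rw [h2, ← hJ] at i2
  have hJH : J ⊆ c.H := Set.inter_subset_left.trans h0
  have i3 := c.rho_submod' (X := A ∪ J) (Y := J ∪ B) (S := J) (T := A ∪ B)
    (by intro x; simp; tauto) (by intro x; simp; tauto)
  rw [c.rho_sub (Set.union_subset hA hJH), c.rho_sub hJH] at i3
  omega

end Cfg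
end KinserAux

set_option linter.unusedSectionVars false
set_option linter.unusedVariables false

namespace KinserAux
open Module Submodule

namespace Cfg
variable {K V E : Type*} [Field K] [AddCommGroup V] [Module K V] [FiniteDimensional K V]
  [Fintype E] (c : Cfg K V E)

/-- sum of the vectors indexed by a set -/
noncomputable def sg (A : Set E) : V := ∑ e, Set.indicator A c.φ e

theorem sg_mem (A : Set E) : c.sg A ∈ c.sp A := by
  refine Submodule.sum_mem _ fun e _ => ?_
  by_cases h : e ∈ A
  · rw [Set.indicator_of_mem h]; exact c.mem_sp h
  · rw [Set.indicator_of_notMem h]; exact zero_mem _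

theorem sg_union {A B : Set E} (h : Disjoint A B) : c.sg (A ∪ B) = c.sg A + c.sg B := by
  unfold sg
  rw [← sum_add_distrib]
  refine sum_congr rfl fun e _ => ?_
  rw [Set.indicator_union_of_disjoint h]

theorem sg_singleton (e : E) : c.sg {e} = c.φ e := by
  classical
  unfold sg
  rw [sum_eq_single e]
  · simp
  · intro b _ hb; simp [hb]
  · simp

theorem mem_sp_of_ssub {S X : Set E} {e : E} (hS : S ⊂ c.H) (he : e ∈ S) (hX : X ⊆ S)
    (h : c.φ e ∈ c.sp X) : e ∈ X := by
  by_contra hn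
  have h1 := c.ind S hS
  have h3 : LinearIndepOn K c.φ (insert e X) := h1.mono (Set.insert_subset he hX)
  have := (linearIndepOn_insert hn).mp h3
  exact this.2 h

theorem sub_of_sg {S X : Set E} (hS : S ⊂ c.H) (hX : X ⊆ S) (h : c.sg S ∈ c.sp X) : S ⊆ X := by
  intro e he
  by_contra hn
  have h1 : S = {e} ∪ (S \ {e}) := by
    ext x; by_cases hx : x = e <;> simp [hx, he]
  have h2 : c.sg S = c.φ e + c.sg (S \ {e}) := by
    conv_lhs => rw [h1]
    rw [sg_union _ (by simp), sg_singleton]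
  have h3 : X ⊆ S \ {e} := fun x hx => ⟨hX hx, fun h => hn (h ▸ hx)⟩
  have h4 : c.φ e ∈ c.sp (S \ {e}) := by
    have : c.φ e = c.sg S - c.sg (S \ {e}) := by rw [h2]; simp
    rw [this]
    exact sub_mem (c.sp_mono h3 h) (c.sg_mem _)
  have := c.mem_sp_of_ssub hS he (X := S \ {e}) Set.sdiff_subset h4
  exact this.2 rfl

theorem hyper {x : V} (hx : x ∉ c.Om) (y : V) : ∃ t : K, y - t • x ∈ c.Om := by
  have h : c.Om ⊔ span K {x} = ⊤ :=
    c.top_of_out le_sup_left (mem_sup_right (mem_span_singleton_self x)) hx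
  have hy : y ∈ c.Om ⊔ span K {x} := h ▸ mem_top
  obtain ⟨o, ho, z, hz, rfl⟩ := mem_sup.mp hy
  obtain ⟨t, rfl⟩ := mem_span_singleton.mp hz
  exact ⟨t, by simpa using ho⟩

theorem cross {S T P Q : Submodule K V} {y z : V} (hy : y ∈ S) (hz : z ∈ T) (hy' : y ∉ c.Om)
    (hz' : z ∉ c.Om) (hP : P ≤ S) (hP' : P ≤ c.Om) (hQ : Q ≤ T) (h : c.Om ≤ P ⊔ Q) :
    ¬ S ⊓ T ≤ c.Om := by
  intro hle
  obtain ⟨t, ht⟩ := c.hyper hz' y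
  obtain ⟨p, hp, q, hq, e⟩ := mem_sup.mp (h ht)
  have e' : y - p = t • z + q := by
    have : y = p + q + t • z := by rw [e]; simp
    rw [this]; abel
  have h1 : y - p ∈ S := sub_mem hy (hP hp)
  have h2 : y - p ∈ T := e' ▸ add_mem (smul_mem _ _ hz) (hQ hq)
  have h3 : y - p ∈ c.Om := hle ⟨h1, h2⟩
  exact hy' (by simpa using add_mem h3 (hP' hp))

end Cfg

/-- The configuration with all the genericity facts. -/
structure Cfg2 (K V E : Type*) [Field K] [AddCommGroup V] [Module K V] [Fintype E] extends
    Cfg K V E where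
  H1 : Set E
  H2 : Set E
  Y0 : Set E
  YN : Set E
  p0 : V
  N : ℕ
  a : ℕ
  hH : H1 ∪ H2 = H
  hdisj : Disjoint H1 H2
  sgH : toCfg.sg H = 0
  sgH1 : toCfg.sg H1 = p0
  frH2 : finrank K (toCfg.sp H2) + a = finrank K V
  GG : ∀ X A : Set E, ¬ toCfg.Om ≤ toCfg.sp X → A ⊆ H → toCfg.sg A ∈ toCfg.sp X →
    (A ∩ H2 ⊆ X ∨ H2 \ A ⊆ X) ∧ (toCfg.sp H1 ≤ toCfg.sp X ∨
      ((A ∩ H1 ⊆ X ∨ H1 \ A ⊆ X) ∧ (A ⊆ X ∨ H \ A ⊆ X ∨ p0 ∈ toCfg.sp (X \ H))))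
  B1 : ∀ X S : Set E, Disjoint X H2 → p0 ∈ toCfg.sp X → ¬ toCfg.Om ≤ toCfg.sp X ⊔ toCfg.sp H2 →
    S ⊆ H2 → (toCfg.sp X ⊔ toCfg.sp S) ⊓ toCfg.sp H2 ≤ span K {p0} ⊔ toCfg.sp S
  B3 : ∃ x ∈ toCfg.sp Y0, ∃ x' ∈ toCfg.sp YN, x - x' ∈ toCfg.sp H2 ∧ x ∉ toCfg.Om
  B4 : ∀ e ∈ H2, ∀ v ∈ toCfg.sp H1, ∀ x ∈ toCfg.sp Y0, ∀ x' ∈ toCfg.sp YN, x ∈ toCfg.Om →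
    x' ∈ toCfg.Om → toCfg.φ e ≠ v + x + x'
  B5 : toCfg.sp H1 ⊔ toCfg.sp Y0 ⊔ toCfg.sp YN = ⊤
  B6 : ∀ Z S : Set E, Z ⊆ Hᶜ → p0 ∈ toCfg.sp Z → S ⊆ H2 →
    toCfg.sp Z ⊓ toCfg.Om ≤ toCfg.sp H1 ⊔ toCfg.sp S → toCfg.Om ≤ toCfg.sp H1 ⊔ toCfg.sp S
  B7 : ∀ e ∈ H1, toCfg.φ e ∉ toCfg.sp Hᶜ
  B9 : ∀ Z Z' : Set E, Z ⊆ Hᶜ → Z' ⊆ Hᶜ → Disjoint Z Z' → p0 ∈ toCfg.sp Z → p0 ∈ toCfg.sp Z' →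
    (Y0 ⊆ Z ∧ YN ⊆ Z') ∨ (YN ⊆ Z ∧ Y0 ⊆ Z')
  B10 : toCfg.sp H1 ⊓ toCfg.sp H2 ≤ span K {p0}
  LP : ∀ (k : ℕ) (Z : ℕ → Set E), (∀ j ≤ k, Z j ⊆ Hᶜ ∧ p0 ∈ toCfg.sp (Z j)) →
    Disjoint (Z 0) (Z k) →
    (∀ j < k, finrank K ↥(toCfg.sp (Z j) ⊔ toCfg.sp (Z (j+1))) ≤ a + 1) →
    N ≤ k ∧ (k = N → (∀ y, y ∉ H → ∃ j ≤ k, y ∈ Z j) ∧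
      ∃ j < k, a + 1 ≤ finrank K ↥(toCfg.sp (Z j) ⊔ toCfg.sp (Z (j+1))))

namespace Cfg2
variable {K V E : Type*} [Field K] [AddCommGroup V] [Module K V] [FiniteDimensional K V]
  [Fintype E] (c : Cfg2 K V E)

theorem H1_sub : c.H1 ⊆ c.H := c.hH ▸ Set.subset_union_left
theorem H2_sub : c.H2 ⊆ c.H := c.hH ▸ Set.subset_union_right
theorem mem_H {x : E} (h : x ∈ c.H) : x ∈ c.H1 ∨ x ∈ c.H2 := by
  rw [← c.hH] at h; exact h
theorem not_both {x : E} (h : x ∈ c.H1) (h' : x ∈ c.H2) : False :=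
  Set.disjoint_left.mp c.hdisj h h'

theorem sg_compl {A : Set E} (h : A ⊆ c.H) : c.sg (c.H \ A) = - c.sg A := by
  have h1 : c.sg (A ∪ (c.H \ A)) = c.sg A + c.sg (c.H \ A) := c.sg_union Set.disjoint_sdiff_right
  rw [Set.union_sdiff_cancel h, c.sgH] at h1
  exact (neg_eq_of_add_eq_zero_right h1.symm).symm

theorem p0_H1 : c.p0 ∈ c.sp c.H1 := c.sgH1 ▸ c.sg_mem _

theorem p0_H2 : c.p0 ∈ c.sp c.H2 := by
  have : c.H \ c.H1 = c.H2 := by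
    rw [← c.hH]; ext x
    have := c.not_both (x := x)
    simp; tauto
  have h := c.sg_compl c.H1_sub
  rw [this, c.sgH1] at h
  have h2 := c.sg_mem c.H2
  rw [h] at h2
  exact neg_mem_iff.mp h2

/-- contradiction from B4 and B5 -/
theorem b45 {S T : Submodule K V} (h : (c.sp c.H1 ⊔ S) ⊓ (c.sp c.H1 ⊔ T) ≤ c.Om)
    (hS : c.sp c.Y0 ≤ S) (hT : c.sp c.YN ≤ T) {e : E} (he : e ∈ c.H2) :
    c.φ e ∉ S ∧ c.φ e ∉ T := by
  have hO : c.φ e ∈ c.Om := c.mem_sp (c.H2_sub he)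
  have hH1 : c.sp c.H1 ≤ c.Om := c.sp_mono c.H1_sub
  have hmem : c.φ e ∈ c.sp c.H1 ⊔ c.sp c.Y0 ⊔ c.sp c.YN := c.B5 ▸ mem_top
  obtain ⟨w, hw, x', hx', e1⟩ := mem_sup.mp hmem
  obtain ⟨v, hv, x, hx, rfl⟩ := mem_sup.mp hw
  have key : x ∈ c.Om → False := by
    intro hxO
    refine c.B4 e he v hv x hx x' hx' hxO ?_ e1.symm
    have : x' = c.φ e - v - x := by rw [← e1]; abel
    rw [this]
    exact sub_mem (sub_mem hO (hH1 hv)) hxO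
  constructor
  · intro heS
    apply key
    have h1 : c.φ e - x ∈ c.Om := by
      apply h
      refine ⟨mem_sup_right (sub_mem heS (hS hx)), ?_⟩
      have : c.φ e - x = v + x' := by rw [← e1]; abel
      rw [this]
      exact mem_sup.mpr ⟨v, hv, x', hT hx', rfl⟩
    have := sub_mem hO h1
    simpa using this
  · intro heT
    apply key
    have h1 : v + x ∈ c.Om := by
      apply h
      refine ⟨mem_sup.mpr ⟨v, hv, x, hS hx, rfl⟩, ?_⟩
      have : v + x = c.φ e - x' := by rw [← e1]; abel
      rw [this]
      exact mem_sup_right (sub_mem heT (hT hx'))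
    have := sub_mem h1 (hH1 hv)
    simpa using this

theorem b3' {S T : Submodule K V} (h : (c.sp c.H2 ⊔ S) ⊓ (c.sp c.H2 ⊔ T) ≤ c.Om)
    (hS : c.sp c.Y0 ≤ S) (hT : c.sp c.YN ≤ T) : False := by
  obtain ⟨x, hx, x', hx', hd, hn⟩ := c.B3
  apply hn
  apply h
  refine ⟨mem_sup_right (hS hx), ?_⟩
  exact mem_sup.mpr ⟨x - x', hd, x', hT hx', by abel⟩

end Cfg2
end KinserAux

set_option linter.unusedSectionVars false
set_option linter.unusedVariables false

namespace KinserAux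
open Module Submodule
namespace Cfg2
variable {K V E : Type*} [Field K] [AddCommGroup V] [Module K V] [FiniteDimensional K V]
  [Fintype E] (c : Cfg2 K V E)

theorem typeA_aux (A B : Set E) (W : ℕ → Set E) (k : ℕ) (hnf : ∀ j ≤ k+1, c.NF (B ∪ W j))
    (hAB : A ∪ B = c.H)
    (T4 : (c.sp A ⊔ c.sp (W 0)) ⊓ (c.sp A ⊔ c.sp (W (k+1))) ≤ c.Om)
    (T3 : ∀ j ≤ k + 1,
        c.sp B ⊓ c.sp (W j) ≤ (c.sp B ⊓ c.sp (W 0)) ⊔ (c.sp B ⊓ c.sp (W (k+1))))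
    (hg : ∀ j ≤ k+1, c.sg (c.H \ B) ∈ c.sp (W j))
    (n0 : A ∪ W 0 ≠ c.H) (nk : A ∪ W (k+1) ≠ c.H) :
    (∀ j ≤ k+1, ¬ W j ⊆ c.H) ∧ (∀ j ≤ k+1, c.p0 ∈ c.sp (W j \ c.H)) ∧
    Disjoint (W 0 \ c.H) (W (k+1) \ c.H) ∧
    (∀ j ≤ k+1, B ∩ c.H1 ⊆ W j ∧ c.H2 \ B ⊆ W j) := by
  have hA : A ⊆ c.H := hAB ▸ Set.subset_union_left
  have hB : B ⊆ c.H := hAB ▸ Set.subset_union_right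
  have hAO : c.sp A ≤ c.Om := c.sp_mono hA
  have hBO : c.sp B ≤ c.Om := c.sp_mono hB
  have hOm : c.Om = c.sp A ⊔ c.sp B := by rw [← c.sp_union, hAB]; rfl
  have hg' : ∀ j ≤ k+1, c.sg B ∈ c.sp (W j) := by
    intro j hj
    have := hg j hj
    rw [c.sg_compl hB] at this
    exact neg_mem_iff.mp this
  have hin : ∀ j ≤ k+1, W j ⊆ c.H → B ⊆ W j := by
    intro j hj hW
    have hs := (hnf j hj).ssub (Set.union_subset hB hW)
    have h1 : c.sg B ∈ c.sp (B ∩ W j) := by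
      rw [← c.sp_inf hs]; exact ⟨c.sg_mem _, hg' j hj⟩
    have h2 := c.sub_of_sg (Set.subset_union_left.trans_ssubset hs) Set.inter_subset_left h1
    exact h2.trans Set.inter_subset_right
  have o0 : ¬ W 0 ⊆ c.H := fun h => n0 (subset_antisymm (Set.union_subset hA h)
    (hAB ▸ Set.union_subset_union_right _ (hin 0 (by omega) h)))
  have ok : ¬ W (k+1) ⊆ c.H := fun h => nk (subset_antisymm (Set.union_subset hA h)
    (hAB ▸ Set.union_subset_union_right _ (hin (k+1) (by omega) h)))
  obtain ⟨y, hy, hyH⟩ := Set.not_subset.mp o0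
  obtain ⟨z, hz, hzH⟩ := Set.not_subset.mp ok
  have star : ¬ c.sp B ≤ (c.sp B ⊓ c.sp (W 0)) ⊔ (c.sp B ⊓ c.sp (W (k+1))) := by
    intro h
    refine c.cross (S := c.sp A ⊔ c.sp (W 0)) (T := c.sp A ⊔ c.sp (W (k+1)))
      (P := c.sp A ⊔ (c.sp B ⊓ c.sp (W 0))) (Q := c.sp B ⊓ c.sp (W (k+1)))
      (mem_sup_right (c.mem_sp hy)) (mem_sup_right (c.mem_sp hz)) (c.not_mem_Om hyH)
      (c.not_mem_Om hzH) (sup_le_sup le_rfl inf_le_right) (sup_le hAO (inf_le_left.trans hBO))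
      (inf_le_right.trans le_sup_right) ?_ T4
    rw [sup_assoc]
    conv_lhs => rw [hOm]
    exact sup_le_sup le_rfl h
  have out : ∀ j ≤ k+1, ¬ W j ⊆ c.H := by
    intro j hj h
    apply star
    refine le_trans ?_ (T3 j hj)
    exact le_inf le_rfl (c.sp_mono (hin j hj h))
  have r1 : ∀ j ≤ k+1, ¬ c.sp (c.H \ B) ≤ c.sp (W j) := by
    intro j hj h
    refine (hnf j hj).not_Om (fun h' => out j hj (Set.subset_union_right.trans h')) ?_
    have : c.Om = c.sp (c.H \ B) ⊔ c.sp B := by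
      rw [← c.sp_union, Set.sdiff_union_of_subset hB]; rfl
    rw [this, c.sp_union]
    exact sup_le (h.trans le_sup_right) le_sup_left
  have r2 : ∀ j ≤ k+1, ¬ c.sp B ≤ c.sp (W j) := by
    intro j hj h
    exact star (le_trans (le_inf le_rfl h) (T3 j hj))
  have ori : ∀ j ≤ k+1, c.p0 ∈ c.sp (W j \ c.H) ∧
      ((B ∩ c.H1 ⊆ W j ∧ c.H2 \ B ⊆ W j) ∨ (B ∩ c.H2 ⊆ W j ∧ c.H1 \ B ⊆ W j)) := by
    intro j hj
    have R1 := r1 j hj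
    have R2 := r2 j hj
    have e1 : ∀ x, x ∈ c.H1 ∪ c.H2 ↔ x ∈ c.H := by rw [c.hH]; simp
    have hh1 := c.H1_sub
    have hh2 := c.H2_sub
    have dd := @c.not_both
    have f2 : (c.H \ B) ∩ c.H2 = c.H2 \ B := by
      ext x; have := @hh2 x; simp; tauto
    have f2' : c.H2 \ (c.H \ B) = B ∩ c.H2 := by
      ext x; have := @hh2 x; simp; tauto
    have f1 : (c.H \ B) ∩ c.H1 = c.H1 \ B := by
      ext x; have := @hh1 x; simp; tauto
    have f1' : c.H1 \ (c.H \ B) = B ∩ c.H1 := by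
      ext x; have := @hh1 x; simp; tauto
    have f3 : c.H \ (c.H \ B) = B := by
      ext x; have := @hB x; simp; tauto
    have G := c.GG (W j) (c.H \ B)
      (((hnf j hj).mono Set.subset_union_right).not_Om (out j hj)) Set.sdiff_subset (hg j hj)
    rw [f2, f2', f1, f1', f3] at G
    have s1 : ∀ U : Submodule K V, c.sp (c.H1 \ B) ≤ U → c.sp (c.H2 \ B) ≤ U →
        c.sp (c.H \ B) ≤ U := by
      intro U h h'
      have : c.H \ B = (c.H1 \ B) ∪ (c.H2 \ B) := by rw [← c.hH, Set.union_sdiff_distrib]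
      rw [this, c.sp_union]; exact sup_le h h'
    have s2 : ∀ U : Submodule K V, c.sp (B ∩ c.H1) ≤ U → c.sp (B ∩ c.H2) ≤ U →
        c.sp B ≤ U := by
      intro U h h'
      have : B = (B ∩ c.H1) ∪ (B ∩ c.H2) := by
        rw [← Set.inter_union_distrib_left, c.hH, Set.inter_eq_left.mpr hB]
      rw [this, c.sp_union]; exact sup_le h h'
    obtain ⟨g1, g2⟩ := G
    rcases g2 with g2 | ⟨g2, g3⟩
    · exfalso
      rcases g1 with g1 | g1
      · exact R1 (s1 _ ((c.sp_mono Set.sdiff_subset).trans g2) (c.sp_mono g1))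
      · exact R2 (s2 _ ((c.sp_mono Set.inter_subset_right).trans g2) (c.sp_mono g1))
    · have g3' : c.p0 ∈ c.sp (W j \ c.H) := by
        rcases g3 with g3 | g3 | g3
        · exact absurd (c.sp_mono g3) R1
        · exact absurd (c.sp_mono g3) R2
        · exact g3
      refine ⟨g3', ?_⟩
      rcases g1 with g1 | g1 <;> rcases g2 with g2 | g2
      · exact absurd (s1 _ (c.sp_mono g2) (c.sp_mono g1)) R1
      · exact Or.inl ⟨g2, g1⟩
      · exact Or.inr ⟨g1, g2⟩
      · exact absurd (s2 _ (c.sp_mono g2) (c.sp_mono g1)) R2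
  have disj : Disjoint (W 0 \ c.H) (W (k+1) \ c.H) := by
    rw [Set.disjoint_left]
    rintro x ⟨hx, hxH⟩ ⟨hx', -⟩
    exact c.not_mem_Om hxH (T4 ⟨mem_sup_right (c.mem_sp hx), mem_sup_right (c.mem_sp hx')⟩)
  have opp : ¬ c.H ⊆ W 0 ∪ W (k+1) := by
    intro h
    refine c.cross (S := c.sp A ⊔ c.sp (W 0)) (T := c.sp A ⊔ c.sp (W (k+1)))
      (P := c.sp (c.H ∩ W 0)) (Q := c.sp (c.H ∩ W (k+1)))
      (mem_sup_right (c.mem_sp hy)) (mem_sup_right (c.mem_sp hz)) (c.not_mem_Om hyH)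
      (c.not_mem_Om hzH) ((c.sp_mono Set.inter_subset_right).trans le_sup_right)
      (c.sp_mono Set.inter_subset_left)
      ((c.sp_mono Set.inter_subset_right).trans le_sup_right) ?_ T4
    rw [← c.sp_union, ← Set.inter_union_distrib_left]
    exact c.sp_mono (fun x hx => ⟨hx, h hx⟩)
  have opp' : ∀ i i', i ≤ k+1 → i' ≤ k+1 → (B ∩ c.H1 ⊆ W i) → (B ∩ c.H2 ⊆ W i') → False := by
    intro i i' hi hi' h h'
    apply star
    have : B = (B ∩ c.H1) ∪ (B ∩ c.H2) := by
      rw [← Set.inter_union_distrib_left, c.hH, Set.inter_eq_left.mpr hB]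
    calc c.sp B = c.sp (B ∩ c.H1) ⊔ c.sp (B ∩ c.H2) := by rw [← c.sp_union, ← this]
      _ ≤ _ := by
        refine sup_le ?_ ?_
        · exact (le_inf (c.sp_mono Set.inter_subset_left) (c.sp_mono h)).trans (T3 i hi)
        · exact (le_inf (c.sp_mono Set.inter_subset_left) (c.sp_mono h')).trans (T3 i' hi')
  refine ⟨out, fun j hj => (ori j hj).1, disj, ?_⟩
  rcases (ori 0 (by omega)).2 with h0 | h0
  · intro j hj
    rcases (ori j hj).2 with hj' | hj'
    · exact hj'
    · exact (opp' 0 j (by omega) hj h0.1 hj'.1).elim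
  · exfalso
    rcases (ori (k+1) le_rfl).2 with hk | hk
    · exact opp' (k+1) 0 le_rfl (by omega) hk.1 h0.1
    · have hle : ∀ i, B ∩ c.H2 ⊆ W i → c.sp c.H2 ⊔ c.sp (W i) ≤ c.sp A ⊔ c.sp (W i) := by
        intro i hi
        refine sup_le ?_ le_sup_right
        rw [← c.sp_union]
        refine c.sp_mono fun x hx => ?_
        by_cases hxB : x ∈ B
        · exact Or.inr (hi ⟨hxB, hx⟩)
        · have : x ∈ A ∪ B := hAB ▸ c.H2_sub hx
          exact Or.inl (this.resolve_right hxB)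
      have T4' : (c.sp c.H2 ⊔ c.sp (W 0)) ⊓ (c.sp c.H2 ⊔ c.sp (W (k+1))) ≤ c.Om :=
        (inf_le_inf (hle 0 h0.1) (hle _ hk.1)).trans T4
      rcases c.B9 (W 0 \ c.H) (W (k+1) \ c.H) (fun x hx => hx.2) (fun x hx => hx.2) disj
        (ori 0 (by omega)).1 (ori (k+1) le_rfl).1 with ⟨b1, b2⟩ | ⟨b1, b2⟩
      · exact c.b3' T4' (c.sp_mono (b1.trans Set.sdiff_subset)) (c.sp_mono (b2.trans Set.sdiff_subset))
      · exact c.b3' ((inf_comm _ _).le.trans T4') (c.sp_mono (b2.trans Set.sdiff_subset))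
          (c.sp_mono (b1.trans Set.sdiff_subset))

theorem typeA (A B : Set E) (W : ℕ → Set E) (k : ℕ) (hkN : k + 1 ≤ c.N)
    (hnf : ∀ j ≤ k+1, c.NF (B ∪ W j)) (hAB : A ∪ B = c.H)
    (hv : KRhs c.rho A B W (k+1) < KLhs c.rho A B W (k+1)) :
    k + 1 = c.N ∧ (∀ e, e ∈ A ∨ e ∈ B ∨ ∃ j ≤ k+1, e ∈ W j) ∧
      ¬ ∃ e, e ∈ A ∧ e ∈ B ∧ ∀ j ≤ k+1, e ∈ W j := by
  obtain ⟨⟨T4, T1⟩, T2, T3, n0, nk, -⟩ := c.slack2 A B W k hnf hv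
  have hA : A ⊆ c.H := hAB ▸ Set.subset_union_left
  have hB : B ⊆ c.H := hAB ▸ Set.subset_union_right
  have hAO : c.sp A ≤ c.Om := c.sp_mono hA
  have hBO : c.sp B ≤ c.Om := c.sp_mono hB
  have hTO : c.TT B W (k+1) ≤ c.Om := (inf_le_left.trans inf_le_left).trans hBO
  have T4O := T4.trans (sup_le hAO hTO)
  have hAB' : c.H \ B ⊆ A := by
    rintro x ⟨hx, hxB⟩
    rw [← hAB] at hx
    exact hx.resolve_right hxB
  have hg : ∀ j ≤ k+1, c.sg (c.H \ B) ∈ c.sp (W j) := by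
    intro j hj
    have h1 : c.sg (c.H \ B) ∈ c.sp A ⊓ c.sp B := by
      refine ⟨c.sp_mono hAB' (c.sg_mem _), ?_⟩
      rw [c.sg_compl hB]
      exact neg_mem (c.sg_mem _)
    exact ((T3 j hj).1 (T1 h1)).2
  obtain ⟨out, hp, disj, ori⟩ := c.typeA_aux A B W k hnf hAB T4O (fun j hj => (T3 j hj).2) hg n0 nk
  have hle : ∀ i ≤ k+1, c.sp c.H1 ⊔ c.sp (W i) ≤ c.sp A ⊔ c.sp (W i) := by
    intro i hi
    refine sup_le ?_ le_sup_right
    rw [← c.sp_union]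
    refine c.sp_mono fun x hx => ?_
    by_cases hxB : x ∈ B
    · exact Or.inr ((ori i hi).1 ⟨hxB, hx⟩)
    · exact Or.inl (hAB' ⟨c.H1_sub hx, hxB⟩)
  have T4' : (c.sp c.H1 ⊔ c.sp (W 0)) ⊓ (c.sp c.H1 ⊔ c.sp (W (k+1))) ≤ c.Om :=
    (inf_le_inf (hle 0 (by omega)) (hle _ le_rfl)).trans T4O
  have hends : ∀ e ∈ c.H2, c.φ e ∉ c.sp (W 0) ∧ c.φ e ∉ c.sp (W (k+1)) := by
    intro e he
    rcases c.B9 (W 0 \ c.H) (W (k+1) \ c.H) (fun x hx => hx.2) (fun x hx => hx.2) disj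
        (hp 0 (by omega)) (hp (k+1) le_rfl) with ⟨b1, b2⟩ | ⟨b1, b2⟩
    · exact c.b45 T4' (c.sp_mono (b1.trans Set.sdiff_subset)) (c.sp_mono (b2.trans Set.sdiff_subset)) he
    · exact (c.b45 ((inf_comm _ _).le.trans T4') (c.sp_mono (b2.trans Set.sdiff_subset))
          (c.sp_mono (b1.trans Set.sdiff_subset)) he).symm
  have e0 : Disjoint (W 0) c.H2 := Set.disjoint_left.mpr fun x hx hx2 =>
    (hends x hx2).1 (c.mem_sp hx)
  have ek : Disjoint (W (k+1)) c.H2 := Set.disjoint_left.mpr fun x hx hx2 =>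
    (hends x hx2).2 (c.mem_sp hx)
  have hH2B : c.H2 ⊆ B := by
    intro x hx
    by_contra hn
    exact Set.disjoint_left.mp e0 ((ori 0 (by omega)).2 ⟨hx, hn⟩) hx
  have hspB : c.sp B = c.sp (B ∩ c.H1) ⊔ c.sp c.H2 := by
    rw [← c.sp_union]
    congr 1
    ext x
    constructor
    · intro hx
      rcases c.mem_H (hB hx) with h | h
      · exact Or.inl ⟨hx, h⟩
      · exact Or.inr h
    · rintro (h | h)
      · exact h.1
      · exact hH2B h
  have hQ : ∀ i ≤ k+1, Disjoint (W i) c.H2 → c.sp B ⊓ c.sp (W i) ≤ c.sp c.H1 := by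
    intro i hi hd
    have b := c.B1 (W i) ∅ hd (c.sp_mono Set.sdiff_subset (hp i hi)) (by
      intro h
      refine (hnf i hi).not_Om (fun h' => out i hi (Set.subset_union_right.trans h')) ?_
      rw [c.sp_union]
      exact h.trans (sup_le le_sup_right ((c.sp_mono hH2B).trans le_sup_left))) (Set.empty_subset _)
    have z : c.sp ∅ = ⊥ := by simp [Cfg.sp]
    rw [z, sup_bot_eq, sup_bot_eq] at b
    rw [hspB]
    rintro x ⟨hx, hxW⟩
    obtain ⟨u, hu, v, hv, rfl⟩ := mem_sup.mp hx
    have hv' : v ∈ c.sp (W i) := by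
      have := sub_mem hxW (c.sp_mono (ori i hi).1 hu)
      simpa using this
    have hv2 : v ∈ span K {c.p0} := b ⟨hv', hv⟩
    refine add_mem (c.sp_mono Set.inter_subset_right hu) ?_
    exact (span_le.mpr (by simpa using c.p0_H1)) hv2
  have hQall : ∀ i ≤ k+1, c.sp B ⊓ c.sp (W i) ≤ c.sp c.H1 := fun i hi =>
    (T3 i hi).2.trans (sup_le (hQ 0 (by omega) e0) (hQ (k+1) le_rfl ek))
  have hfr : ∀ j < k+1, finrank K ↥(c.sp (W j) ⊔ c.sp (W (j+1))) ≤ c.a + 1 := by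
    intro j hj
    have t2 := T2 j (by omega) (c.eps_not_sub (fun h => out j (by omega)
      ((Set.subset_union_right.trans Set.subset_union_left).trans h)))
    have l1 : c.sp c.H2 ⊓ (c.sp (W j) ⊔ c.sp (W (j+1))) ≤ span K {c.p0} := by
      refine le_trans (le_inf ?_ inf_le_left) c.B10
      refine le_trans (inf_le_inf (c.sp_mono hH2B) le_rfl) (t2.trans ?_)
      exact sup_le (hQall j (by omega)) (hQall (j+1) (by omega))
    have l2 := (fr_mono l1).trans (finrank_span_le_card (R := K) {c.p0})
    simp at l2
    have l3 := fr_add (c.sp c.H2) (c.sp (W j) ⊔ c.sp (W (j+1)))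
    have l4 := Submodule.finrank_le (c.sp c.H2 ⊔ (c.sp (W j) ⊔ c.sp (W (j+1))))
    have := c.frH2
    omega
  have hsub : ∀ j, c.sp (W j \ c.H) ⊔ c.sp (W (j+1) \ c.H) ≤ c.sp (W j) ⊔ c.sp (W (j+1)) :=
    fun j => sup_le_sup (c.sp_mono Set.sdiff_subset) (c.sp_mono Set.sdiff_subset)
  obtain ⟨hN, hN'⟩ := c.LP (k+1) (fun j => W j \ c.H) (fun j hj => ⟨fun x hx => hx.2, hp j hj⟩) disj
    (fun j hj => (fr_mono (hsub j)).trans (hfr j hj))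
  have hEq : k + 1 = c.N := le_antisymm hkN hN
  obtain ⟨cov, j, hj, hge⟩ := hN' hEq
  refine ⟨hEq, ?_, ?_⟩
  · intro e
    by_cases he : e ∈ c.H
    · rw [← hAB] at he
      rcases he with h | h
      · exact Or.inl h
      · exact Or.inr (Or.inl h)
    · obtain ⟨i, hi, hie⟩ := cov e he
      exact Or.inr (Or.inr ⟨i, hi, hie.1⟩)
  · rintro ⟨e, heA, heB, heW⟩
    rcases c.mem_H (hB heB) with h | h
    · have hEq2 := eq_of_fr (hsub j) ((hfr j hj).trans hge)
      have : c.φ e ∈ c.sp (W j) ⊔ c.sp (W (j+1)) := mem_sup_left (c.mem_sp (heW j (by omega)))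
      rw [← hEq2] at this
      refine c.B7 e h ((sup_le (c.sp_mono ?_) (c.sp_mono ?_) : _ ≤ c.sp c.Hᶜ) this)
      · exact fun x hx => hx.2
      · exact fun x hx => hx.2
    · exact Set.disjoint_left.mp e0 (heW 0 (by omega)) h

end Cfg2
end KinserAux

set_option linter.unusedSectionVars false
set_option linter.unusedVariables false

namespace KinserAux
open Module Submodule
namespace Cfg2
variable {K V E : Type*} [Field K] [AddCommGroup V] [Module K V] [FiniteDimensional K V]
  [Fintype E] (c : Cfg2 K V E)

theorem remE (B : Set E) (W : ℕ → Set E) (k : ℕ) (hnf : ∀ j ≤ k+1, c.NF (B ∪ W j))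
    (hH : W 0 ∪ W (k+1) = c.H)
    (hv : KRhs c.rho (W 0 ∩ W (k+1)) B W (k+1) < KLhs c.rho (W 0 ∩ W (k+1)) B W (k+1))
    (e : E) (he : e ∈ W 0 ∩ W (k+1)) (hc : e ∈ B ∨ c.φ e ∉ c.sp (B ∪ (W 0 \ {e}))) :
    ∃ W' : ℕ → Set E, (∀ j ≤ k+1, c.NF (B ∪ W' j)) ∧ W' 0 ∪ W' (k+1) = c.H ∧
      KRhs c.rho (W' 0 ∩ W' (k+1)) B W' (k+1) < KLhs c.rho (W' 0 ∩ W' (k+1)) B W' (k+1) ∧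
      (W' 0 ∩ W' (k+1)).ncard < (W 0 ∩ W (k+1)).ncard := by
  have hs : W 0 \ {e} ⊆ W 0 := Set.sdiff_subset
  refine ⟨Function.update W 0 (W 0 \ {e}), ?_, ?_, ?_, ?_⟩
  · intro j hj
    by_cases h : j = 0
    · subst h
      rw [Function.update_self]
      exact (hnf 0 hj).mono (Set.union_subset_union_right _ hs)
    · rw [Function.update_of_ne h]; exact hnf j hj
  · rw [Function.update_self, Function.update_of_ne (by omega), ← hH]
    ext x
    by_cases hx : x = e
    · subst hx; simp [he.2]
    · simp [hx]
  · have u : ∀ j, Function.update W 0 (W 0 \ {e}) (j+1) = W (j+1) :=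
      fun j => Function.update_of_ne (by omega) _ _
    have e1 : W 0 ∩ W (k+1) ∪ W 0 = W 0 := by simp
    have e2 : W 0 ∩ W (k+1) ∪ W (k+1) = W (k+1) := by simp
    have e3 : W 0 \ {e} ∩ W (k+1) ∪ (W 0 \ {e}) = W 0 \ {e} := by simp
    have e4 : W 0 \ {e} ∩ W (k+1) ∪ W (k+1) = W (k+1) := by simp
    have e5 : W 0 \ {e} ∪ W (k+1) = c.H := by
      rw [← hH]
      ext x
      by_cases hx : x = e
      · subst hx; simp [he.2]
      · simp [hx]
    unfold KRhs KLhs at *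
    rw [sum_range_succ' (fun j => c.rho (W j)), sum_range_succ' (fun j => c.rho (B ∪ W j)),
      sum_range_succ' (fun j => c.rho (B ∪ W j ∪ W (j+1))),
      sum_range_succ' (fun j => c.rho (W j ∪ W (j+1))), e1, e2, hH] at hv
    rw [sum_range_succ' (fun j => c.rho (Function.update W 0 (W 0 \ {e}) j)),
      sum_range_succ' (fun j => c.rho (B ∪ (Function.update W 0 (W 0 \ {e}) j))),
      sum_range_succ' (fun j => c.rho (B ∪ (Function.update W 0 (W 0 \ {e}) j) ∪
        (Function.update W 0 (W 0 \ {e}) (j+1)))),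
      sum_range_succ' (fun j => c.rho ((Function.update W 0 (W 0 \ {e}) j) ∪
        (Function.update W 0 (W 0 \ {e}) (j+1))))]
    simp only [u, Function.update_self]
    rw [e3, e4, e5]
    have s1 := c.rho_submod' (X := W 0 ∪ W (0+1)) (Y := B ∪ (W 0 \ {e}) ∪ W (0+1))
      (S := (W 0 \ {e}) ∪ W (0+1)) (T := B ∪ W 0 ∪ W (0+1))
      (by intro x; simp; tauto) (by intro x; simp; tauto)
    have s2 : c.rho (W 0 ∩ W (k+1) ∪ B) + c.rho (B ∪ W 0 \ {e}) ≤
        c.rho (W 0 \ {e} ∩ W (k+1) ∪ B) + c.rho (B ∪ W 0) := by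
      rcases hc with hc | hc
      · have h1 : c.rho (W 0 ∩ W (k+1) ∪ B) ≤ c.rho (W 0 \ {e} ∩ W (k+1) ∪ B) := by
          apply c.rho_mono
          rintro x (hx | hx)
          · by_cases hxe : x = e
            · subst hxe; exact Or.inr hc
            · exact Or.inl ⟨⟨hx.1, hxe⟩, hx.2⟩
          · exact Or.inr hx
        have h2 := c.rho_mono (show B ∪ W 0 \ {e} ⊆ B ∪ W 0 from Set.union_subset_union_right _ hs)
        omega
      · have h1 : c.rho (B ∪ W 0 \ {e}) + 1 ≤ c.rho (B ∪ W 0) := by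
          have n0 := hnf 0 (by omega)
          have n0' := n0.mono (show B ∪ W 0 \ {e} ⊆ B ∪ W 0 from Set.union_subset_union_right _ hs)
          rw [c.rho_eq n0, c.rho_eq n0']
          apply finrank_lt_finrank_of_lt
          refine lt_of_le_of_ne (c.sp_mono (Set.union_subset_union_right _ hs)) ?_
          intro h
          apply hc
          rw [h]
          exact c.mem_sp (Or.inr he.1)
        have h2 : c.rho (W 0 ∩ W (k+1) ∪ B) ≤ c.rho (W 0 \ {e} ∩ W (k+1) ∪ B) + 1 := by
          have q := c.rho_submod' (X := W 0 \ {e} ∩ W (k+1) ∪ B) (Y := {e}) (S := ∅)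
            (T := W 0 ∩ W (k+1) ∪ B) (Set.empty_subset _) (by
              rintro x (hx | hx)
              · by_cases hxe : x = e
                · exact Or.inr hxe
                · exact Or.inl (Or.inl ⟨⟨hx.1, hxe⟩, hx.2⟩)
              · exact Or.inl (Or.inr hx))
          have heH : e ∈ c.H := by rw [← hH]; exact Or.inl he.1
          have q2 : c.rho {e} = 1 := by
            rw [c.rho_sub (by simpa using heH)]; simp
          omega
        omega
    have s0 : c.rho (∅ : Set E) = 0 := by rw [c.rho_sub (Set.empty_subset _)]; simp
    omega
  · rw [Function.update_self, Function.update_of_ne (by omega)]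
    refine Set.ncard_lt_ncard (Set.ssubset_iff_subset_ne.mpr
      ⟨fun x hx => ⟨hx.1.1, hx.2⟩, fun h => ?_⟩) (Set.toFinite _)
    replace h := h.ge
    exact (h he).1.2 rfl

theorem killE (B P Q : Set E) (nP : c.NF (B ∪ P)) (nQ : c.NF (B ∪ Q)) (hB : ¬ B ⊆ c.H)
    (hP : c.H1 ⊆ B ∪ P) (hQ : c.H2 ⊆ B ∪ Q) (e : E) (he : e ∈ P) (he' : e ∈ Q) (heH : e ∈ c.H)
    (heB : e ∉ B)
    (h1 : c.φ e ∈ c.sp (B ∪ P \ {e})) (h2 : c.φ e ∈ c.sp (B ∪ Q \ {e})) : False := by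
  have sP : B ∪ P \ {e} ⊆ B ∪ P := Set.union_subset_union_right _ Set.sdiff_subset
  have sQ : B ∪ Q \ {e} ⊆ B ∪ Q := Set.union_subset_union_right _ Set.sdiff_subset
  have oP : ¬ c.Om ≤ c.sp (B ∪ P \ {e}) :=
    (nP.mono sP).not_Om fun h => hB (Set.subset_union_left.trans h)
  have oQ : ¬ c.Om ≤ c.sp (B ∪ Q \ {e}) :=
    (nQ.mono sQ).not_Om fun h => hB (Set.subset_union_left.trans h)
  have eX : ∀ P : Set E, e ∉ B ∪ P \ {e} := by
    rintro P (h | h)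
    · exact heB h
    · exact h.2 rfl
  rcases c.mem_H heH with h | h
  · have G := (c.GG _ {e} oQ (by simpa using heH) (by rw [c.sg_singleton]; exact h2)).2
    have : c.sp c.H1 ≤ c.sp (B ∪ Q) := by
      rcases G with G | ⟨G | G, -⟩
      · exact G.trans (c.sp_mono sQ)
      · exact absurd (G ⟨rfl, h⟩) (eX Q)
      · apply c.sp_mono
        intro x hx
        by_cases hxe : x = e
        · subst hxe; exact Or.inr he'
        · exact sQ (G ⟨hx, hxe⟩)
    refine nQ.not_Om (fun h => hB (Set.subset_union_left.trans h)) ?_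
    unfold Cfg.Om
    rw [← c.hH, c.sp_union]
    exact sup_le this (c.sp_mono hQ)
  · have G := (c.GG _ {e} oP (by simpa using heH) (by rw [c.sg_singleton]; exact h1)).1
    rcases G with G | G
    · exact eX P (G ⟨rfl, h⟩)
    · apply nP.not_sub
      rw [← c.hH]
      refine Set.union_subset hP ?_
      intro x hx
      by_cases hxe : x = e
      · subst hxe; exact Or.inr he
      · exact sP (G ⟨hx, hxe⟩)

theorem typeB_ori (B P Q : Set E) (nP : c.NF (B ∪ P)) (nQ : c.NF (B ∪ Q)) (hB : ¬ B ⊆ c.H)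
    (hPQ : P ∪ Q = c.H) (hg : c.sg (P \ Q) ∈ c.sp (B ∪ P ∩ Q)) :
    c.p0 ∈ c.sp (B \ c.H) ∧ ((P \ Q ∩ c.H2 ⊆ B ∪ P ∩ Q ∧ c.H1 \ (P \ Q) ⊆ B ∪ P ∩ Q) ∨
      (c.H2 \ (P \ Q) ⊆ B ∪ P ∩ Q ∧ P \ Q ∩ c.H1 ⊆ B ∪ P ∩ Q)) := by
  have hP : P ⊆ c.H := hPQ ▸ Set.subset_union_left
  have hQ : Q ⊆ c.H := hPQ ▸ Set.subset_union_right
  have sP : B ∪ P ∩ Q ⊆ B ∪ P := Set.union_subset_union_right _ Set.inter_subset_left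
  have sQ : B ∪ P ∩ Q ⊆ B ∪ Q := Set.union_subset_union_right _ Set.inter_subset_right
  have hA : P \ Q ⊆ c.H := Set.sdiff_subset.trans hP
  have r1 : ¬ c.sp (P \ Q) ≤ c.sp (B ∪ P ∩ Q) := by
    intro h
    refine nQ.not_Om (fun h => hB (Set.subset_union_left.trans h)) ?_
    unfold Cfg.Om
    rw [← hPQ, show P ∪ Q = (P \ Q) ∪ Q by simp, c.sp_union]
    exact sup_le (h.trans (c.sp_mono sQ)) (c.sp_mono Set.subset_union_right)
  have e1 : c.H \ (P \ Q) = Q := by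
    rw [← hPQ]; ext x; simp; tauto
  have r2 : ¬ c.sp (c.H \ (P \ Q)) ≤ c.sp (B ∪ P ∩ Q) := by
    intro h
    rw [e1] at h
    refine nP.not_Om (fun h => hB (Set.subset_union_left.trans h)) ?_
    unfold Cfg.Om
    rw [← hPQ, c.sp_union]
    exact sup_le (c.sp_mono Set.subset_union_right) (h.trans (c.sp_mono sP))
  have s1 : ∀ U : Submodule K V, c.sp (P \ Q ∩ c.H1) ≤ U → c.sp (P \ Q ∩ c.H2) ≤ U →
      c.sp (P \ Q) ≤ U := by
    intro U h h'
    have : P \ Q = (P \ Q ∩ c.H1) ∪ (P \ Q ∩ c.H2) := by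
      rw [← Set.inter_union_distrib_left, c.hH, Set.inter_eq_left.mpr hA]
    rw [this, c.sp_union]; exact sup_le h h'
  have s2 : ∀ U : Submodule K V, c.sp (c.H1 \ (P \ Q)) ≤ U → c.sp (c.H2 \ (P \ Q)) ≤ U →
      c.sp (c.H \ (P \ Q)) ≤ U := by
    intro U h h'
    have : c.H \ (P \ Q) = (c.H1 \ (P \ Q)) ∪ (c.H2 \ (P \ Q)) := by
      rw [← c.hH, Set.union_sdiff_distrib]
    rw [this, c.sp_union]; exact sup_le h h'
  obtain ⟨g1, g2⟩ := c.GG (B ∪ P ∩ Q) (P \ Q)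
    ((nP.mono sP).not_Om fun h => hB (Set.subset_union_left.trans h)) hA hg
  have e2 : (B ∪ P ∩ Q) \ c.H = B \ c.H := by
    ext x; have := @hP x; simp; tauto
  rw [e2] at g2
  rcases g2 with g2 | ⟨g2, g3⟩
  · exfalso
    rcases g1 with g1 | g1
    · exact r1 (s1 _ ((c.sp_mono Set.inter_subset_right).trans g2) (c.sp_mono g1))
    · exact r2 (s2 _ ((c.sp_mono Set.sdiff_subset).trans g2) (c.sp_mono g1))
  · refine ⟨?_, ?_⟩
    · rcases g3 with g3 | g3 | g3
      · exact absurd (c.sp_mono g3) r1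
      · exact absurd (c.sp_mono g3) r2
      · exact g3
    · rcases g1 with g1 | g1 <;> rcases g2 with g2 | g2
      · exact absurd (s1 _ (c.sp_mono g2) (c.sp_mono g1)) r1
      · exact Or.inl ⟨g1, g2⟩
      · exact Or.inr ⟨g1, g2⟩
      · exact absurd (s2 _ (c.sp_mono g2) (c.sp_mono g1)) r2

theorem typeB_empty (B : Set E) (W : ℕ → Set E) (k : ℕ) (hnf : ∀ j ≤ k+1, c.NF (B ∪ W j))
    (hH : W 0 ∪ W (k+1) = c.H) (hI : W 0 ∩ W (k+1) = ∅) (hB : ¬ B ⊆ c.H)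
    (T2 : ∀ j ≤ k, c.sp B ⊓ (c.sp (W j) ⊔ c.sp (W (j+1)))
          ≤ (c.sp B ⊓ c.sp (W j)) ⊔ (c.sp B ⊓ c.sp (W (j+1))))
    (T3 : ∀ j ≤ k + 1, c.sg (W 0) ∈ c.sp (W j) ∧
        c.sp B ⊓ c.sp (W j) ≤ (c.sp B ⊓ c.sp (W 0)) ⊔ (c.sp B ⊓ c.sp (W (k+1))))
    (hp : c.p0 ∈ c.sp (B \ c.H)) (o2 : W 0 ∩ c.H2 ⊆ B) (o1 : c.H1 \ W 0 ⊆ B) : False := by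
  have h0 : W 0 ⊆ c.H := hH ▸ Set.subset_union_left
  have hm : W (k+1) ⊆ c.H := hH ▸ Set.subset_union_right
  set S := B ∩ c.H with hS
  have hSB : c.sp S ≤ c.sp B := c.sp_mono Set.inter_subset_left
  have hOmj : ∀ j ≤ k+1, ¬ c.Om ≤ c.sp B ⊔ c.sp (W j) := by
    intro j hj
    rw [← c.sp_union]
    exact (hnf j hj).not_Om fun h => hB (Set.subset_union_left.trans h)
  have hH1O : c.sp c.H1 ≤ c.Om := c.sp_mono c.H1_sub
  have hH2O : c.sp c.H2 ≤ c.Om := c.sp_mono c.H2_sub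
  have Om12 : c.Om = c.sp c.H1 ⊔ c.sp c.H2 := by rw [← c.sp_union, c.hH]; rfl
  have p0in : ∀ j ≤ k+1, c.p0 ∈ c.sp (W j) ⊔ c.sp S := by
    intro j hj
    have e1 : c.sg (W 0) = c.sg (W 0 ∩ c.H1) + c.sg (W 0 ∩ c.H2) := by
      rw [← c.sg_union, ← Set.inter_union_distrib_left, c.hH, Set.inter_eq_left.mpr h0]
      exact c.hdisj.mono Set.inter_subset_right Set.inter_subset_right
    have e2 : c.sg c.H1 = c.sg (W 0 ∩ c.H1) + c.sg (c.H1 \ W 0) := by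
      rw [← c.sg_union]
      · congr 1; ext x; simp; tauto
      · exact Set.disjoint_left.mpr fun x hx hx' => hx'.2 hx.1
    have e3 : c.p0 = c.sg (W 0) + (c.sg (c.H1 \ W 0) - c.sg (W 0 ∩ c.H2)) := by
      rw [← c.sgH1, e2, e1]; abel
    rw [e3]
    refine mem_sup.mpr ⟨_, (T3 j hj).1, _, sub_mem ?_ ?_, rfl⟩
    · exact c.sp_mono (show c.H1 \ W 0 ⊆ S from fun x hx => ⟨o1 hx, c.H1_sub hx.1⟩) (c.sg_mem _)
    · exact c.sp_mono (show W 0 ∩ c.H2 ⊆ S from fun x hx => ⟨o2 hx, c.H2_sub hx.2⟩) (c.sg_mem _)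
  have tri : ∀ j ≤ k+1, c.sp c.H1 ≤ c.sp (W j) ⊔ c.sp S ∨ c.sp c.H2 ≤ c.sp (W j) ⊔ c.sp S ∨
      c.p0 ∈ c.sp (W j \ c.H) := by
    intro j hj
    have G := (c.GG (W j ∪ S) c.H1 (by
      rw [c.sp_union]
      exact fun h => hOmj j hj (h.trans (sup_le le_sup_right (hSB.trans le_sup_left)))) c.H1_sub
      (by rw [c.sp_union, c.sgH1]; exact p0in j hj)).2
    have e2 : (W j ∪ S) \ c.H = W j \ c.H := by
      rw [hS]; ext x; simp; tauto
    have e3 : c.H \ c.H1 = c.H2 := by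
      rw [← c.hH]; ext x
      have := c.not_both (x := x)
      simp; tauto
    rw [e2, e3, c.sp_union] at G
    rcases G with G | ⟨-, G | G | G⟩
    · exact Or.inl G
    · exact Or.inl (by rw [← c.sp_union]; exact c.sp_mono G)
    · exact Or.inr (Or.inl (by rw [← c.sp_union]; exact c.sp_mono G))
    · exact Or.inr (Or.inr G)
  have hSj : ∀ j, c.sp (W j) ⊔ c.sp S ≤ c.sp B ⊔ c.sp (W j) := fun j =>
    sup_le le_sup_right (hSB.trans le_sup_left)
  have hA0 : c.H1 ⊆ B ∪ W 0 := by
    intro x hx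
    by_cases h : x ∈ W 0
    · exact Or.inr h
    · exact Or.inl (o1 ⟨hx, h⟩)
  have hBm : c.H2 ⊆ B ∪ W (k+1) := by
    intro x hx
    by_cases h : x ∈ W 0
    · exact Or.inl (o2 ⟨h, hx⟩)
    · have : x ∈ W 0 ∪ W (k+1) := hH ▸ c.H2_sub hx
      exact Or.inr (this.resolve_left h)
  have notB0 : ¬ c.sp c.H2 ≤ c.sp (W 0) ⊔ c.sp S := by
    intro h
    apply hOmj 0 (by omega)
    rw [Om12]
    refine sup_le ?_ (h.trans (hSj 0))
    rw [← c.sp_union]; exact c.sp_mono hA0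
  have isBm : c.sp c.H2 ≤ c.sp (W (k+1)) ⊔ c.sp S := by
    rw [← c.sp_union]
    apply c.sp_mono
    intro x hx
    rcases hBm hx with h | h
    · exact Or.inr ⟨h, c.H2_sub hx⟩
    · exact Or.inl h
  obtain ⟨w, hw, hwB, hwn⟩ : ∃ w ≤ k, c.sp c.H2 ≤ c.sp (W (w+1)) ⊔ c.sp S ∧
      ¬ c.sp c.H2 ≤ c.sp (W w) ⊔ c.sp S := by
    by_contra hcon
    push Not at hcon
    have : ∀ i ≤ k+1, ¬ c.sp c.H2 ≤ c.sp (W i) ⊔ c.sp S := by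
      intro i
      induction i with
      | zero => intro _; exact notB0
      | succ i ih =>
        intro hi h
        exact ih (by omega) (hcon i (by omega) h)
    exact this (k+1) le_rfl isBm
  set Q := (c.sp B ⊓ c.sp (W 0)) ⊔ (c.sp B ⊓ c.sp (W (k+1))) with hQ
  have hQO : Q ≤ c.Om :=
    sup_le (inf_le_right.trans (c.sp_mono h0)) (inf_le_right.trans (c.sp_mono hm))
  have hSQ : c.sp S ≤ Q := by
    have : S = (B ∩ W 0) ∪ (B ∩ W (k+1)) := by
      rw [hS, ← hH, Set.inter_union_distrib_left]
    rw [this, c.sp_union]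
    exact sup_le_sup (le_inf (c.sp_mono Set.inter_subset_left) (c.sp_mono Set.inter_subset_right))
      (le_inf (c.sp_mono Set.inter_subset_left) (c.sp_mono Set.inter_subset_right))
  have key : c.sp B ⊓ (c.sp (W w) ⊔ c.sp (W (w+1)) ⊔ c.sp S) ≤ Q := by
    rintro x ⟨hx, hx'⟩
    obtain ⟨y, hy, s, hs, rfl⟩ := mem_sup.mp hx'
    have hyB : y ∈ c.sp B := by
      have := sub_mem hx (hSB hs)
      simpa using this
    refine add_mem ?_ (hSQ hs)
    exact (sup_le (T3 w (by omega)).2 (T3 (w+1) (by omega)).2) (T2 w hw ⟨hyB, hy⟩)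
  rcases tri w (by omega) with hA | hB' | hP
  ·
    have hOm : c.Om ≤ c.sp (W w) ⊔ c.sp (W (w+1)) ⊔ c.sp S := by
      rw [Om12]
      refine sup_le (hA.trans ?_) (hwB.trans ?_)
      · exact sup_le_sup le_sup_left le_rfl
      · exact sup_le_sup le_sup_right le_rfl
    have hp' : c.p0 ∈ c.sp (B \ c.H2) :=
      c.sp_mono (show B \ c.H ⊆ B \ c.H2 from fun x hx => ⟨hx.1, fun h => hx.2 (c.H2_sub h)⟩) hp
    have hB12 : c.sp (B \ c.H2) ⊔ c.sp (B ∩ c.H2) = c.sp B := by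
      rw [← c.sp_union, Set.sdiff_union_inter]
    have b1 := c.B1 (B \ c.H2) (B ∩ c.H2) Set.disjoint_sdiff_left hp' (by
      intro h
      apply hOmj (k+1) le_rfl
      refine h.trans (sup_le ((c.sp_mono Set.sdiff_subset).trans le_sup_left) ?_)
      rw [← c.sp_union]; exact c.sp_mono hBm) Set.inter_subset_right
    rw [hB12] at b1
    have hspan : span K {c.p0} ≤ c.sp c.H1 := span_le.mpr (by simpa using c.p0_H1)
    have hQ' : Q ≤ c.sp c.H1 ⊔ c.sp (B ∩ c.H2) := by
      refine sup_le (inf_le_right.trans ?_) ?_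
      · rw [← c.sp_union]
        apply c.sp_mono
        intro x hx
        rcases c.mem_H (h0 hx) with h | h
        · exact Or.inl h
        · exact Or.inr ⟨o2 ⟨hx, h⟩, h⟩
      · have l1 : c.sp (W (k+1)) ≤ c.sp (B ∩ c.H1) ⊔ c.sp c.H2 := by
          rw [← c.sp_union]
          apply c.sp_mono
          intro x hx
          rcases c.mem_H (hm hx) with h | h
          · refine Or.inl ⟨o1 ⟨h, fun h' => ?_⟩, h⟩
            have : x ∈ W 0 ∩ W (k+1) := ⟨h', hx⟩
            rw [hI] at this
            exact this
          · exact Or.inr h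
        rintro x ⟨hx, hx'⟩
        obtain ⟨y, hy, s, hs, rfl⟩ := mem_sup.mp (l1 hx')
        have hsB : s ∈ c.sp B := by
          have := sub_mem hx (c.sp_mono Set.inter_subset_left hy)
          simpa using this
        refine add_mem (mem_sup_left (c.sp_mono Set.inter_subset_right hy)) ?_
        exact (b1.trans (sup_le_sup hspan le_rfl)) ⟨hsB, hs⟩
    have b6 := c.B6 (B \ c.H) (B ∩ c.H2) (fun x hx => hx.2) hp Set.inter_subset_right (by
      refine le_trans (inf_le_inf (c.sp_mono Set.sdiff_subset) hOm) (key.trans hQ'))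
    apply hOmj 0 (by omega)
    refine b6.trans (sup_le ?_ ((c.sp_mono Set.inter_subset_left).trans le_sup_left))
    rw [← c.sp_union]; exact c.sp_mono hA0
  · exact hwn hB'
  · have dis : Disjoint (B \ c.H) (W w \ c.H) := by
      rw [Set.disjoint_left]
      rintro x ⟨hx, hxH⟩ ⟨hx', -⟩
      exact c.not_mem_Om hxH (hQO ((T3 w (by omega)).2 ⟨c.mem_sp hx, c.mem_sp hx'⟩))
    have hle : (c.sp c.H2 ⊔ c.sp B) ⊓ (c.sp c.H2 ⊔ c.sp (W w)) ≤ c.Om := by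
      rintro x ⟨hx, hx'⟩
      obtain ⟨h, hh, b, hb, rfl⟩ := mem_sup.mp hx
      refine add_mem (hH2O hh) (hQO (key ⟨hb, ?_⟩))
      have : b ∈ c.sp c.H2 ⊔ c.sp (W w) := by
        have := sub_mem hx' (mem_sup_left hh)
        simpa using this
      refine (sup_le (hwB.trans ?_) (le_sup_left.trans le_sup_left) : _ ≤ _) this
      exact sup_le_sup le_sup_right le_rfl
    rcases c.B9 _ _ (fun x hx => hx.2) (fun x hx => hx.2) dis hp hP with ⟨b1, b2⟩ | ⟨b1, b2⟩
    · exact c.b3' hle (c.sp_mono (b1.trans Set.sdiff_subset)) (c.sp_mono (b2.trans Set.sdiff_subset))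
    · exact c.b3' ((inf_comm _ _).le.trans hle) (c.sp_mono (b2.trans Set.sdiff_subset))
          (c.sp_mono (b1.trans Set.sdiff_subset))

theorem typeB (n : ℕ) : ∀ (B : Set E) (W : ℕ → Set E) (k : ℕ) (hnf : ∀ j ≤ k+1, c.NF (B ∪ W j))
    (hH : W 0 ∪ W (k+1) = c.H) (hB : ¬ B ⊆ c.H)
    (hv : KRhs c.rho (W 0 ∩ W (k+1)) B W (k+1) < KLhs c.rho (W 0 ∩ W (k+1)) B W (k+1))
    (hn : (W 0 ∩ W (k+1)).ncard = n), False := by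
  induction n using Nat.strong_induction_on with
  | _ n ih =>
  intro B W k hnf hH hB hv hn
  obtain ⟨⟨T4, T1⟩, T2, T3, n0, nk, -⟩ := c.slack2 (W 0 ∩ W (k+1)) B W k hnf hv
  have T2' := fun j hj => T2 j hj (c.eps_not_sub
    fun h => hB ((Set.subset_union_left.trans Set.subset_union_left).trans h))
  have h0 : W 0 ⊆ c.H := hH ▸ Set.subset_union_left
  have hm : W (k+1) ⊆ c.H := hH ▸ Set.subset_union_right
  have eqs : c.H \ (W 0 \ W (k+1)) = W (k+1) := by
    rw [← hH]; ext x; simp; tauto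
  have hTT : c.TT B W (k+1) ≤ c.sp B := inf_le_left.trans inf_le_left
  have hsgm : c.sg (W 0 \ W (k+1)) = - c.sg (W (k+1)) := by
    have := c.sg_compl (A := W 0 \ W (k+1)) (Set.sdiff_subset.trans h0)
    rw [eqs] at this
    rw [this, neg_neg]
  have hsg : c.sg (W 0 \ W (k+1)) ∈ c.sp (W 0 ∩ W (k+1)) ⊔ c.TT B W (k+1) := by
    apply T4
    refine ⟨mem_sup_right (c.sp_mono Set.sdiff_subset (c.sg_mem _)), mem_sup_right ?_⟩
    rw [hsgm]; exact neg_mem (c.sg_mem _)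
  have N0 := hnf 0 (by omega)
  have Nm := hnf (k+1) le_rfl
  obtain ⟨hp, ori⟩ := c.typeB_ori B (W 0) (W (k+1)) N0 Nm hB hH (by
    rw [c.sp_union]
    exact (sup_le le_sup_right (hTT.trans le_sup_left) : _ ≤ _) hsg)
  by_cases hJ : W 0 ∩ W (k+1) = ∅
  · have d0 : W 0 \ W (k+1) = W 0 := by
      ext x
      have : x ∉ W 0 ∩ W (k+1) := by rw [hJ]; simp
      simp at this ⊢; tauto
    have z : c.sp ∅ = ⊥ := by simp [Cfg.sp]
    rw [hJ, z, bot_sup_eq, d0] at hsg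
    rw [d0] at hsgm
    rw [hJ, d0, Set.union_empty] at ori
    rcases ori with ⟨o2, o1⟩ | ⟨o2, o1⟩
    · exact c.typeB_empty B W k hnf hH hJ hB T2'
        (fun j hj => ⟨((T3 j hj).1 hsg).2, (T3 j hj).2⟩) hp o2 o1
    · refine c.typeB_empty B (fun j => W (k+1-j)) k (fun j hj => hnf _ (by omega)) ?_ ?_ hB ?_ ?_ hp
        ?_ ?_
      · simpa [Set.union_comm] using hH
      · simpa [Set.inter_comm] using hJ
      · intro j hj
        have t := T2' (k - j) (by omega)
        have e1 : k - j + 1 = k + 1 - j := by omega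
        have e2 : k + 1 - (j+1) = k - j := by omega
        rw [e1] at t
        simp only [e2]
        rw [sup_comm (c.sp (W (k+1-j))), sup_comm (c.sp B ⊓ c.sp (W (k+1-j)))]
        exact t
      · intro j hj
        have t := T3 (k+1-j) (by omega)
        simp only [Nat.sub_zero, Nat.sub_self]
        refine ⟨?_, ?_⟩
        · rw [hsgm] at hsg
          exact (t.1 (neg_mem_iff.mp hsg)).2
        · rw [sup_comm]; exact t.2
      · simp only [Nat.sub_zero]
        rintro x ⟨hx, hx2⟩
        refine o2 ⟨hx2, fun h => ?_⟩
        have : x ∈ W 0 ∩ W (k+1) := ⟨h, hx⟩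
        rw [hJ] at this
        exact this
      · simp only [Nat.sub_zero]
        rintro x ⟨hx, hx2⟩
        refine o1 ⟨?_, hx⟩
        have : x ∈ W 0 ∪ W (k+1) := hH ▸ c.H1_sub hx
        exact this.resolve_right hx2
  · obtain ⟨e, he⟩ := Set.nonempty_iff_ne_empty.mpr hJ
    have c1 : e ∉ B ∧ c.φ e ∈ c.sp (B ∪ W 0 \ {e}) := by
      by_contra hcon
      obtain ⟨W', a1, a2, a3, a4⟩ := c.remE B W k hnf hH hv e he (by tauto)
      exact ih _ (hn ▸ a4) B W' k a1 a2 hB a3 rfl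
    have c2 : c.φ e ∈ c.sp (B ∪ W (k+1) \ {e}) := by
      by_contra hcon
      have hv' : KRhs c.rho (W (k+1) ∩ W 0) B (fun j => W (k+1-j)) (k+1) <
          KLhs c.rho (W (k+1) ∩ W 0) B (fun j => W (k+1-j)) (k+1) := by
        rw [KRhs_rev, KLhs_rev, Set.inter_comm]; exact hv
      obtain ⟨W', a1, a2, a3, a4⟩ := c.remE B (fun j => W (k+1-j)) k (fun j hj => hnf _ (by omega))
        (by simpa [Set.union_comm] using hH) (by simpa using hv') e
        (by simpa using he.symm) (by right; simpa using hcon)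
      refine ih _ ?_ B W' k a1 a2 hB a3 rfl
      simp only [Nat.sub_zero, Nat.sub_self] at a4
      rw [Set.inter_comm (W (k+1)), hn] at a4
      exact a4
    have sP : B ∪ W 0 ∩ W (k+1) ⊆ B ∪ W 0 := Set.union_subset_union_right _ Set.inter_subset_left
    have sQ : B ∪ W 0 ∩ W (k+1) ⊆ B ∪ W (k+1) :=
      Set.union_subset_union_right _ Set.inter_subset_right
    have f0 : ∀ S : Set E, S \ (W 0 \ W (k+1)) ⊆ B ∪ W 0 ∩ W (k+1) → S ⊆ B ∪ W 0 := by
      intro S h x hx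
      by_cases hx' : x ∈ W 0
      · exact Or.inr hx'
      · exact sP (h ⟨hx, fun h => hx' h.1⟩)
    have fm : ∀ S : Set E, S ⊆ c.H → W 0 \ W (k+1) ∩ S ⊆ B ∪ W 0 ∩ W (k+1) → S ⊆ B ∪ W (k+1) := by
      intro S hS h x hx
      by_cases hx' : x ∈ W (k+1)
      · exact Or.inr hx'
      · have : x ∈ W 0 ∪ W (k+1) := hH ▸ hS hx
        exact sQ (h ⟨⟨this.resolve_right hx', hx'⟩, hx⟩)
    rcases ori with ⟨o2, o1⟩ | ⟨o2, o1⟩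
    · exact c.killE B (W 0) (W (k+1)) N0 Nm hB (f0 _ o1) (fm _ c.H2_sub o2) e he.1 he.2 (h0 he.1)
        c1.1 c1.2 c2
    · exact c.killE B (W (k+1)) (W 0) Nm N0 hB (fm _ c.H1_sub o1) (f0 _ o2) e he.2 he.1 (h0 he.1)
        c1.1 c2 c1.2

theorem main (k : ℕ) (hk : k ≤ c.N) (A B : Set E) (W : ℕ → Set E)
    (hv : KRhs c.rho A B W k < KLhs c.rho A B W k) :
    k = c.N ∧ (∀ e, e ∈ A ∨ e ∈ B ∨ ∃ j ≤ c.N, e ∈ W j) ∧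
      ¬ ∃ e, e ∈ A ∧ e ∈ B ∧ ∀ j ≤ c.N, e ∈ W j := by
  refine reduce_nonfull c.rho (fun _ _ h => c.rho_mono h) c.rho_submod (finrank K V) c.rho_le c.N
    (fun A B W => (∀ e, e ∈ A ∨ e ∈ B ∨ ∃ j ≤ c.N, e ∈ W j) ∧
      ¬ ∃ e, e ∈ A ∧ e ∈ B ∧ ∀ j ≤ c.N, e ∈ W j) ?_ k hk A B W hv
  clear hv hk
  intro k hk A B W hv hnf
  obtain ⟨-, -, -, -, -, h | ⟨h1, h2, h3⟩⟩ := c.slack2 A B W k hnf hv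
  · obtain ⟨q1, q2, q3⟩ := c.typeA A B W k hk hnf h hv
    rw [← q1]
    exact ⟨rfl, q2, q3⟩
  · exact (c.typeB _ B W k hnf h3 h2 (c.replaceJ A B W k hv h1 h3) rfl).elim

end Cfg2
end KinserAux

set_option linter.unusedSectionVars false
set_option linter.unusedVariables false

namespace KinserAux
open Module Submodule

section Generic
variable {K V : Type} [Field K] [AddCommGroup V] [Module K V] 

/-- functions supported on `S` -/
def supp (K : Type) [Field K] {ι : Type} [Fintype ι] [DecidableEq ι] (S : Set ι) :
    Submodule K (ι → K) := span K ((fun i => Pi.single i (1 : K)) '' S)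

section
variable {ι : Type} [Fintype ι] [DecidableEq ι]

theorem mem_supp {S : Set ι} {s : ι → K} : s ∈ supp K S ↔ ∀ i, i ∉ S → s i = 0 := by
  have := (Pi.basisFun K ι).mem_span_image (m := s) (s := S)
  have e : (fun i => Pi.single i (1 : K)) = (Pi.basisFun K ι : ι → ι → K) := by
    funext i; simp
  unfold supp
  rw [e, this]
  constructor
  · intro h i hi
    by_contra hn
    exact hi (h (by simpa using hn))
  · intro h i hi
    by_contra hn
    exact (by simpa using hi : s i ≠ 0) (h i hn)

theorem supp_mono {S T : Set ι} (h : S ⊆ T) : supp K S ≤ supp K T :=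
  span_mono (Set.image_mono h)

theorem fr_supp (S : Set ι) : finrank K (supp K S) = S.ncard := by
  classical
  have h1 : LinearIndepOn K (fun i => Pi.single i (1 : K) : ι → ι → K) S := by
    have := (Pi.basisFun K ι).linearIndependent.linearIndepOn (s := S)
    have e : (fun i => Pi.single i (1 : K)) = (Pi.basisFun K ι : ι → ι → K) := by
      funext i; simp
    rw [e]; exact this
  have h2 := finrank_span_eq_card h1.linearIndependent
  unfold supp
  rw [Set.image_eq_range, h2, Set.ncard_eq_toFinset_card', Set.toFinset_card]

theorem supp_univ_mem (s : ι → K) : s ∈ supp K (Set.univ : Set ι) :=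
  mem_supp.mpr (by simp)

variable [FiniteDimensional K V]

/-- the space of admissible maps -/
def Adm (Om : Submodule K V) (q : V) (h : (ι → K) →ₗ[K] V) : Prop :=
  (∀ s, h s ∈ Om) ∧ h (fun _ => 1) = q

theorem Adm.line {Om : Submodule K V} {q : V} {h0 h1 : (ι → K) →ₗ[K] V} (H0 : Adm Om q h0)
    (H1 : Adm Om q h1) (t : K) : Adm Om q (h0 + t • (h1 - h0)) := by
  refine ⟨fun s => ?_, ?_⟩
  · simp only [LinearMap.add_apply, LinearMap.smul_apply, LinearMap.sub_apply]
    exact add_mem (H0.1 s) (smul_mem _ _ (sub_mem (H1.1 s) (H0.1 s)))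
  · simp [H0.2, H1.2]

/-- generic property -/
def Gen (Om : Submodule K V) (q : V) (P : ((ι → K) →ₗ[K] V) → Prop) : Prop :=
  (∃ h, Adm Om q h ∧ P h) ∧ ∀ h0, Adm Om q h0 → P h0 → ∀ h1, Adm Om q h1 →
    {t : K | ¬ P (h0 + t • (h1 - h0))}.Finite

theorem Gen.and [Infinite K] {Om : Submodule K V} {q : V} {P Q : ((ι → K) →ₗ[K] V) → Prop}
    (hP : Gen Om q P) (hQ : Gen Om q Q) : Gen Om q (fun h => P h ∧ Q h) := by
  constructor
  · obtain ⟨h0, H0, p0⟩ := hP.1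
    obtain ⟨h1, H1, q1⟩ := hQ.1
    have f1 := hP.2 h0 H0 p0 h1 H1
    have f2 := hQ.2 h1 H1 q1 h0 H0
    have f3 : {t : K | ¬ Q (h0 + t • (h1 - h0))}.Finite := by
      refine (f2.preimage (f := fun t : K => 1 - t) ?_).subset ?_
      · intro a _ b _ hab; simpa using hab
      · intro t ht
        simp only [Set.mem_preimage, Set.mem_ofPred_eq] at ht ⊢
        convert ht using 2
        module
    obtain ⟨t, ht⟩ := (f1.union f3).exists_notMem
    simp only [Set.mem_union, Set.mem_ofPred_eq, not_or, not_not] at ht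
    exact ⟨_, H0.line H1 t, ht⟩
  · intro h0 H0 p0 h1 H1
    refine ((hP.2 h0 H0 p0.1 h1 H1).union (hQ.2 h0 H0 p0.2 h1 H1)).subset ?_
    intro t ht
    simp only [Set.mem_union, Set.mem_ofPred_eq] at ht ⊢
    tauto

theorem adm_nonempty [Nonempty ι] {Om : Submodule K V} {q : V} (hq : q ∈ Om) :
    ∃ h : (ι → K) →ₗ[K] V, Adm Om q h := by
  obtain ⟨i⟩ := ‹Nonempty ι›
  refine ⟨(LinearMap.toSpanSingleton K V q).comp (LinearMap.proj i), fun s => ?_, by simp⟩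
  simpa using smul_mem _ _ hq

theorem gen_true [Nonempty ι] {Om : Submodule K V} {q : V} (hq : q ∈ Om) :
    Gen (ι := ι) Om q (fun _ => True) := by
  obtain ⟨h, H⟩ := adm_nonempty (ι := ι) hq
  exact ⟨⟨h, H, trivial⟩, by intros; simp⟩

theorem gen_forall [Infinite K] [Nonempty ι] {Om : Submodule K V} {q : V} (hq : q ∈ Om)
    {J : Type} [Finite J] (P : J → ((ι → K) →ₗ[K] V) → Prop) (hP : ∀ j, Gen Om q (P j)) :
    Gen Om q (fun h => ∀ j, P j h) := by
  classical
  cases nonempty_fintype J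
  have : ∀ s : Finset J, Gen Om q (fun h => ∀ j ∈ s, P j h) := by
    intro s
    induction s using Finset.induction_on with
    | empty => simpa using gen_true hq
    | insert a s ha ih => simpa [Finset.forall_mem_insert] using (hP a).and ih
  simpa using this univ

theorem line_inj {R W : Type} [AddCommGroup R] [Module K R] [FiniteDimensional K R]
    [AddCommGroup W] [Module K W] (G0 G1 : R →ₗ[K] W) (h : ∀ r, G0 r = 0 → r = 0) :
    {t : K | ¬ ∀ r, G0 r + t • G1 r = 0 → r = 0}.Finite := by
  obtain ⟨s, hs⟩ := LinearMap.exists_leftInverse_of_injective G0 (LinearMap.ker_eq_bot'.mpr h)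
  have hs' : ∀ r, s (G0 r) = r := fun r => by
    have := LinearMap.congr_fun hs r; simpa using this
  have hf := Module.End.finite_hasEigenvalue (s.comp G1)
  refine (hf.preimage (f := fun t : K => - t⁻¹) ?_).subset ?_
  · intro a _ b _ hab; simpa using hab
  · intro t ht
    simp only [Set.mem_ofPred_eq] at ht
    push Not at ht
    obtain ⟨r, hr, hr0⟩ := ht
    have e1 : r + t • s (G1 r) = 0 := by
      have := congrArg s hr
      simpa [hs'] using this
    have ht0 : t ≠ 0 := by
      rintro rfl
      simp at e1; exact hr0 e1
    refine Module.End.hasEigenvalue_of_hasEigenvector (x := r) ⟨?_, hr0⟩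
    rw [Module.End.mem_eigenspace_iff]
    have e2 : t • s (G1 r) = - r := by
      rw [eq_neg_iff_add_eq_zero, add_comm]; exact e1
    have e3 : s (G1 r) = t⁻¹ • (t • s (G1 r)) := by rw [smul_smul, inv_mul_cancel₀ ht0, one_smul]
    rw [LinearMap.comp_apply, e3, e2]; simp

theorem witness [Nonempty ι] {Om : Submodule K V} {q : V} (hq : q ∈ Om) (U : Submodule K V)
    {R : Type} [AddCommGroup R] [Module K R] [FiniteDimensional K R] (f : R →ₗ[K] (ι → K))
    (hf : ∀ r (t : K), f r + t • (fun _ => (1 : K)) = 0 → r = 0) (g : R →ₗ[K] V) (hg : ∀ r, g r ∈ Om)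
    (hd : finrank K R + finrank K (Om ⊓ U : Submodule K V) ≤ finrank K Om) :
    ∃ h : (ι → K) →ₗ[K] V, Adm Om q h ∧ ∀ r, h (f r) + g r ∈ U → r = 0 := by
  obtain ⟨C, hC⟩ := Submodule.exists_isCompl (U.comap Om.subtype)
  have h1 : finrank K (U.comap Om.subtype) = finrank K (Om ⊓ U : Submodule K V) := by
    rw [← Submodule.map_comap_subtype]
    exact ((Submodule.equivSubtypeMap Om _).finrank_eq)
  have h2 := Submodule.finrank_add_eq_of_isCompl hC
  have h3 : finrank K R ≤ finrank K C := by omega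
  obtain ⟨L0, hL0⟩ : ∃ L0 : R →ₗ[K] C, Function.Injective L0 := by
    exact finrank_le_iff_exists_linearMap.mp h3
  let L : R →ₗ[K] V := Om.subtype ∘ₗ C.subtype ∘ₗ L0
  have hLO : ∀ r, L r ∈ Om := fun r => (C.subtype (L0 r)).2
  have hLU : ∀ r, L r ∈ U → r = 0 := by
    intro r hr
    have a1 : (L0 r : Om) ∈ U.comap Om.subtype := hr
    have a2 := Submodule.disjoint_def.mp hC.disjoint _ a1 (L0 r).2
    have a3 : L0 r = 0 := by exact_mod_cast a2
    exact hL0 (by simpa using a3)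
  let one : ι → K := fun _ => 1
  let F : R × K →ₗ[K] (ι → K) := f.coprod (LinearMap.toSpanSingleton K _ one)
  have hF : LinearMap.ker F = ⊥ := by
    rw [LinearMap.ker_eq_bot']
    rintro ⟨r, t⟩ hr
    have e : f r + t • one = 0 := by simpa [F] using hr
    have r0 := hf r t e
    subst r0
    obtain ⟨i⟩ := ‹Nonempty ι›
    have := congrFun e i
    have : t = 0 := by simpa [one] using this
    simp [this]
  obtain ⟨G, hG⟩ := LinearMap.exists_leftInverse_of_injective F hF
  have hG' : ∀ p, G (F p) = p := fun p => by
    have := LinearMap.congr_fun hG p; simpa using this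
  let h : (ι → K) →ₗ[K] V := ((L - g).coprod (LinearMap.toSpanSingleton K _ q)).comp G
  have hh : ∀ r, h (f r) = L r - g r := by
    intro r
    have : f r = F (r, 0) := by simp [F]
    simp only [h, LinearMap.comp_apply, this, hG']
    simp
  refine ⟨h, ⟨fun s => ?_, ?_⟩, ?_⟩
  · simp only [h, LinearMap.comp_apply, LinearMap.coprod_apply]
    refine add_mem ?_ (by simpa using smul_mem _ _ hq)
    simpa using sub_mem (hLO _) (hg _)
  · have : (fun _ => (1 : K)) = F (0, 1) := by simp [F, one]
    simp only [h, LinearMap.comp_apply, this, hG']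
    simp
  · intro r hr
    rw [hh] at hr
    exact hLU r (by simpa using hr)

theorem gen_basic [Infinite K] [Nonempty ι] {Om : Submodule K V} {q : V} (hq : q ∈ Om)
    (U : Submodule K V)
    {R : Type} [AddCommGroup R] [Module K R] [FiniteDimensional K R] (f : R →ₗ[K] (ι → K))
    (hf : ∀ r (t : K), f r + t • (fun _ => (1 : K)) = 0 → r = 0) (g : R →ₗ[K] V) (hg : ∀ r, g r ∈ Om)
    (hd : finrank K R + finrank K (Om ⊓ U : Submodule K V) ≤ finrank K Om) :
    Gen Om q (fun h => ∀ r, h (f r) + g r ∈ U → r = 0) := by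
  refine ⟨witness hq U f hf g hg hd, ?_⟩
  intro h0 H0 p0 h1 H1
  have := line_inj (K := K) (U.mkQ ∘ₗ (h0 ∘ₗ f + g)) (U.mkQ ∘ₗ ((h1 - h0) ∘ₗ f)) (by
    intro r hr
    apply p0
    rw [← Submodule.Quotient.mk_eq_zero]
    simpa using hr)
  refine this.subset ?_
  intro t ht hn
  apply ht
  intro r hr
  apply hn
  rw [← Submodule.Quotient.mk_eq_zero, ] at hr
  rw [← hr]
  simp only [LinearMap.comp_apply, LinearMap.add_apply, LinearMap.sub_apply, LinearMap.smul_apply,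
    Submodule.mkQ_apply, ← Submodule.Quotient.mk_smul, ← Submodule.Quotient.mk_add]
  congr 1
  module

theorem exists_generic [Infinite K] [Nonempty ι] {Om : Submodule K V} {q : V} (hq : q ∈ Om)
    (UU : Set (Submodule K V)) (hUU : UU.Finite) (XX : Set V) (hXX : XX.Finite)
    (hXO : ∀ x ∈ XX, x ∈ Om) :
    ∃ h : (ι → K) →ₗ[K] V, (∀ s, h s ∈ Om) ∧ h (fun _ => 1) = q ∧
      (∀ U ∈ UU, ∀ S : Set ι, S ≠ Set.univ → Om ≤ U ⊔ (supp K S).map h ∨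
        ∀ s ∈ supp K S, h s ∈ U → s = 0) ∧
      (∀ U ∈ UU, ∀ x ∈ XX, ∀ S A : Set ι, ∀ i i', i ∈ A → i ∉ S → i' ∉ A → i' ∉ S →
        x + h (A.indicator 1) ∈ U ⊔ (supp K S).map h → Om ≤ U ⊔ (supp K S).map h) ∧
      (∀ U ∈ UU, ∀ S : Set ι, S ≠ Set.univ →
        S.ncard + finrank K (Om ⊓ U : Submodule K V) ≤ finrank K Om →
        ∀ s ∈ supp K S, h s ∈ U → s = 0) ∧
      (∀ U ∈ UU, ∀ S : Set ι, S ≠ Set.univ →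
        finrank K Om ≤ S.ncard + finrank K (Om ⊓ U : Submodule K V) →
        Om ≤ U ⊔ (supp K S).map h) := by
  classical
  have := hUU.to_subtype
  have := hXX.to_subtype
  have g1 : Gen Om q (fun h => ∀ p : {p : UU × Set ι // p.2 ≠ Set.univ ∧
      p.2.ncard + finrank K (Om ⊓ p.1.1 : Submodule K V) ≤ finrank K Om},
      ∀ r : supp K p.1.2, h ((supp K p.1.2).subtype r) + (0 : supp K p.1.2 →ₗ[K] V) r ∈ p.1.1.1 →
        r = 0) := by
    apply gen_forall hq
    rintro ⟨⟨U, S⟩, hS, hd⟩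
    refine gen_basic hq U.1 _ ?_ _ (by simp) (by rw [fr_supp]; exact hd)
    rintro ⟨r, hr⟩ t e
    obtain ⟨i, hi⟩ := (Set.ne_univ_iff_exists_notMem _).mp hS
    have e1 := congrFun e i
    have t0 : t = 0 := by simpa [mem_supp.mp hr i hi] using e1
    subst t0
    have : r = 0 := by simpa using e
    simpa using this
  have g2 : Gen Om q (fun h => ∀ p : {p : (UU × XX) × Set ι × Set ι //
      (∃ i i', i ∈ p.2.2 ∧ i ∉ p.2.1 ∧ i' ∉ p.2.2 ∧ i' ∉ p.2.1) ∧
      p.2.1.ncard + 1 + finrank K (Om ⊓ p.1.1.1 : Submodule K V) ≤ finrank K Om},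
      ∀ r : supp K p.1.2.1 × K, h (((supp K p.1.2.1).subtype.coprod
        (LinearMap.toSpanSingleton K _ (p.1.2.2.indicator 1))) r) + 
        (((LinearMap.toSpanSingleton K _ p.1.1.2.1).comp (LinearMap.snd K (supp K p.1.2.1) K)) :
         supp K p.1.2.1 × K →ₗ[K] V) r ∈ p.1.1.1.1 →
        r = 0) := by
    apply gen_forall hq
    rintro ⟨⟨⟨U, x⟩, S, A⟩, ⟨i, i', hA, hS, hA', hS'⟩, hd⟩
    refine gen_basic hq U.1 _ ?_ _ ?_ ?_
    · rintro ⟨⟨r, hr⟩, u⟩ t e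
      have e1 := congrFun e i
      have e2 := congrFun e i'
      simp only at hA hA' hS hS'
      have t0 : t = 0 := by
        simpa [mem_supp.mp hr i' hS', hA'] using e2
      subst t0
      have u0 : u = 0 := by
        simpa [mem_supp.mp hr i hS, hA] using e1
      subst u0
      have : r = 0 := by simpa using e
      simpa using this
    · rintro ⟨r, t⟩
      simpa using smul_mem _ _ (hXO _ x.2)
    · rw [finrank_prod, fr_supp]
      simpa using hd
  obtain ⟨h, H, P1, P2⟩ := (g1.and g2).1
  have key : ∀ U ∈ UU, ∀ S : Set ι, S ≠ Set.univ →
      finrank K Om ≤ S.ncard + finrank K (Om ⊓ U : Submodule K V) → Om ≤ U ⊔ (supp K S).map h := by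
    intro U hU S hS hd
    have hle : finrank K (Om ⊓ U : Submodule K V) ≤ finrank K Om := finrank_mono inf_le_left
    obtain ⟨S', hS', hc⟩ := Set.exists_subset_card_eq (s := S)
      (n := finrank K Om - finrank K (Om ⊓ U : Submodule K V)) (by omega)
    have hne : S' ≠ Set.univ := by
      rintro rfl; exact hS (Set.univ_subset_iff.mp hS')
    have p := P1 ⟨(⟨U, hU⟩, S'), hne, by simp only; omega⟩
    have inj : ∀ s ∈ supp K S', h s ∈ U → s = 0 := by
      intro s hs hsU
      have := p ⟨s, hs⟩ (by simpa using hsU)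
      simpa using this
    have hfr : finrank K ((supp K S').map h) = S'.ncard := by
      rw [← fr_supp (K := K) S']
      have e0 : (supp K S').map h = LinearMap.range (h.comp (supp K S').subtype) := by
        rw [LinearMap.range_comp, Submodule.range_subtype]
      rw [e0]
      refine (LinearEquiv.finrank_eq (LinearEquiv.ofInjective (h.comp (supp K S').subtype) ?_)).symm
      · rw [← LinearMap.ker_eq_bot, LinearMap.ker_eq_bot']
        rintro ⟨s, hs⟩ e
        have := inj s hs (by have : h s = 0 := by simpa using e
                             rw [this]; exact zero_mem _)
        simpa using this
    have hdis : (Om ⊓ U) ⊓ (supp K S').map h = ⊥ := by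
      rw [eq_bot_iff]
      rintro _ ⟨⟨_, h2⟩, s, hs, rfl⟩
      rw [inj s hs h2]; simp
    have h3 := Submodule.finrank_sup_add_finrank_inf_eq (Om ⊓ U) ((supp K S').map h)
    rw [hdis, finrank_bot] at h3
    have hmO : (supp K S').map h ≤ Om := by rintro _ ⟨s, hs, rfl⟩; exact H.1 s
    have h4 : (Om ⊓ U) ⊔ (supp K S').map h = Om :=
      eq_of_fr (sup_le inf_le_left hmO) (by omega)
    calc Om = (Om ⊓ U) ⊔ (supp K S').map h := h4.symm
      _ ≤ _ := sup_le_sup inf_le_right (Submodule.map_mono (supp_mono hS'))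
  refine ⟨h, H.1, H.2, ?_, ?_, ?_, key⟩
  · intro U hU S hS
    by_cases hd : S.ncard + finrank K (Om ⊓ U : Submodule K V) ≤ finrank K Om
    · right
      intro s hs hsU
      have := P1 ⟨(⟨U, hU⟩, S), hS, hd⟩ ⟨s, hs⟩ (by simpa using hsU)
      simpa using this
    · left; exact key U hU S hS (by omega)
  · intro U hU x hx S A i i' hA hS hA' hS' hm
    have hne : S ≠ Set.univ := by rintro rfl; exact hS trivial
    by_cases hd : S.ncard + 1 + finrank K (Om ⊓ U : Submodule K V) ≤ finrank K Om
    · exfalso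
      obtain ⟨u, hu, _, ⟨s, hs, rfl⟩, e⟩ := mem_sup.mp hm
      have := P2 ⟨((⟨U, hU⟩, ⟨x, hx⟩), S, A), ⟨i, i', hA, hS, hA', hS'⟩, hd⟩ (⟨-s, neg_mem hs⟩, 1) (by
        have e' : h (-s + A.indicator 1) + x = u := by
          rw [map_add, map_neg, add_assoc, add_comm (h _) x, ← e]; abel
        simp only [LinearMap.coprod_apply, Submodule.subtype_apply, LinearMap.toSpanSingleton_apply,
          one_smul, LinearMap.comp_apply, LinearMap.snd_apply]
        rw [e']; exact hu)
      simp at this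
    · exact key U hU S hne (by omega)
  · intro U hU S hS hd s hs hsU
    have := P1 ⟨(⟨U, hU⟩, S), hS, hd⟩ ⟨s, hs⟩ (by simpa using hsU)
    simpa using this

end
end Generic
end KinserAux

set_option linter.unusedSectionVars false
set_option linter.unusedVariables false

namespace KinserAux
open Module Submodule

/-- The rigid part of the construction. -/
structure Base (K V Y : Type) [Field K] [AddCommGroup V] [Module K V] where
  ψ : Y → V
  L : V →ₗ[K] K
  L0 : V →ₗ[K] K
  p0 : V
  O1 : Submodule K V
  N : ℕ
  a : ℕ
  b : ℕ
  Ys : ℕ → Set Y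
  ZZ : Set V
  ZZfin : ZZ.Finite
  a2 : 2 ≤ a
  b2 : 2 ≤ b
  Yne : Nonempty Y
  frV : finrank K V = a + b
  frO1 : finrank K O1 = a
  O1L : O1 ≤ LinearMap.ker L
  p0O1 : p0 ∈ O1
  p0ne : p0 ≠ 0
  Ly : ∀ y, L (ψ y) ≠ 0
  L0O1 : O1 ≤ LinearMap.ker L0
  L00 : ∀ x ∈ span K (ψ '' Ys 0), L0 x = L x
  L0N : ∀ x ∈ span K (ψ '' Ys N), L0 x = 0
  zz : ∃ z ∈ span K (ψ '' Set.univ), L z = 0 ∧ L0 z ≠ 0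
  spYY : span K (ψ '' Set.univ) ≤ span K (ψ '' Ys 0) ⊔ span K (ψ '' Ys N)
  top : O1 ⊔ span K (ψ '' Ys 0) ⊔ span K (ψ '' Ys N) = ⊤
  fr3 : a ≤ finrank K ↥(span K (ψ '' Set.univ) ⊓ LinearMap.ker L ⊓ LinearMap.ker L0)
  c6 : ∀ Z, p0 ∈ span K (ψ '' Z) → ∃ z ∈ ZZ, z ∈ span K (ψ '' Z) ∧ L z = 0 ∧ z ∉ O1
  c7 : ¬ O1 ≤ span K (ψ '' Set.univ)
  c9 : ∀ Z Z', Disjoint Z Z' → p0 ∈ span K (ψ '' Z) → p0 ∈ span K (ψ '' Z') →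
    (Ys 0 ⊆ Z ∧ Ys N ⊆ Z') ∨ (Ys N ⊆ Z ∧ Ys 0 ⊆ Z')
  cLP : ∀ (k : ℕ) (Z : ℕ → Set Y), (∀ j ≤ k, p0 ∈ span K (ψ '' Z j)) →
    Disjoint (Z 0) (Z k) →
    (∀ j < k, finrank K ↥(span K (ψ '' Z j) ⊔ span K (ψ '' Z (j+1))) ≤ a + 1) →
    N ≤ k ∧ (k = N → (∀ y, ∃ j ≤ k, y ∈ Z j) ∧
      ∃ j < k, a + 1 ≤ finrank K ↥(span K (ψ '' Z j) ⊔ span K (ψ '' Z (j+1))))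
  cc : ℕ
  lam : ℕ
  pY : ∀ j ≤ N, p0 ∈ span K (ψ '' Ys j)
  frY : ∀ j ≤ N, finrank K (span K (ψ '' Ys j)) = cc
  frYY : ∀ j < N, finrank K ↥(span K (ψ '' Ys j) ⊔ span K (ψ '' Ys (j+1))) = a + 1
  frO1Y : finrank K ↥(O1 ⊔ span K (ψ '' Ys 0)) + 1 + lam ≤ a + cc
  num : 2 * cc = b + lam + 2

section
variable {K V Y : Type} [Field K] [AddCommGroup V] [Module K V]

/-- the span of a set of elements of `Y` -/
def Base.spY (c : Base K V Y) (Z : Set Y) : Submodule K V := span K (c.ψ '' Z)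

/-- family of subspaces used for the first generic choice -/
def Base.UU1 (c : Base K V Y) : Set (Submodule K V) :=
  Set.range c.spY ∪ Set.range (fun Z => c.spY Z ⊔ span K {c.p0})

/-- The first generic choice -/
structure Gen1 (c : Base K V Y) where
  h1 : (Fin c.a → K) →ₗ[K] V
  h1O : ∀ s, h1 s ∈ c.O1
  h1one : h1 (fun _ => 1) = c.p0
  h1inj : ∀ s, h1 s = 0 → s = 0
  h1surj : ∀ x ∈ c.O1, ∃ s, h1 s = x
  h1I : ∀ U ∈ c.UU1, ∀ S : Set (Fin c.a), S ≠ Set.univ → c.O1 ≤ U ⊔ (supp K S).map h1 ∨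
        ∀ s ∈ supp K S, h1 s ∈ U → s = 0
  h1II : ∀ U ∈ c.UU1, ∀ x, (x = 0 ∨ x = - c.p0) → ∀ S A : Set (Fin c.a), ∀ i i',
    i ∈ A → i ∉ S → i' ∉ A → i' ∉ S →
    x + h1 (A.indicator 1) ∈ U ⊔ (supp K S).map h1 → c.O1 ≤ U ⊔ (supp K S).map h1

/-- special vectors -/
def Gen1.Q {c : Base K V Y} (g : Gen1 c) : Set V :=
  {c.p0} ∪ Set.range (fun A : Set (Fin c.a) => g.h1 (A.indicator 1)) ∪
    Set.range (fun A : Set (Fin c.a) => g.h1 (A.indicator 1) - c.p0)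

/-- family of subspaces used for the second generic choice -/
def Gen1.UU2 {c : Base K V Y} (g : Gen1 c) : Set (Submodule K V) :=
  (fun p : (Set Y × Set (Fin c.a)) × Set V => c.spY p.1.1 ⊔ (supp K p.1.2).map g.h1 ⊔ span K p.2) ''
    (Set.univ ×ˢ g.Q.powerset)
  ∪ (fun z => c.O1 ⊔ span K {z}) '' c.ZZ
  ∪ {c.O1, LinearMap.ker c.L0, span K (c.ψ '' Set.univ) ⊓ LinearMap.ker c.L ⊓ LinearMap.ker c.L0}

/-- The second generic choice -/
structure Gen2 {c : Base K V Y} (g : Gen1 c) where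
  h2 : (Fin c.b → K) →ₗ[K] V
  h2O : ∀ s, h2 s ∈ LinearMap.ker c.L
  h2one : h2 (fun _ => 1) = - c.p0
  h2I : ∀ U ∈ g.UU2, ∀ S : Set (Fin c.b), S ≠ Set.univ → LinearMap.ker c.L ≤ U ⊔ (supp K S).map h2 ∨
        ∀ s ∈ supp K S, h2 s ∈ U → s = 0
  h2II : ∀ U ∈ g.UU2, ∀ A1 : Set (Fin c.a), ∀ S A : Set (Fin c.b), ∀ i i',
    i ∈ A → i ∉ S → i' ∉ A → i' ∉ S →
    g.h1 (A1.indicator 1) + h2 (A.indicator 1) ∈ U ⊔ (supp K S).map h2 →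
    LinearMap.ker c.L ≤ U ⊔ (supp K S).map h2
  h2a : ∀ U ∈ g.UU2, ∀ S : Set (Fin c.b), S ≠ Set.univ →
        S.ncard + finrank K (LinearMap.ker c.L ⊓ U : Submodule K V) + 1 ≤ c.a + c.b →
        ∀ s ∈ supp K S, h2 s ∈ U → s = 0
  h2b : ∀ U ∈ g.UU2, ∀ S : Set (Fin c.b), S ≠ Set.univ →
        c.a + c.b ≤ S.ncard + finrank K (LinearMap.ker c.L ⊓ U : Submodule K V) + 1 →
        LinearMap.ker c.L ≤ U ⊔ (supp K S).map h2

theorem shift_mem {n : ℕ} (i : Fin n) (s : Fin n → K) :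
    (s - s i • (fun _ => (1 : K))) ∈ supp K ({i}ᶜ : Set (Fin n)) := by
  rw [mem_supp]
  intro j hj
  simp at hj
  simp [hj]

theorem compl_ne {n : ℕ} (i : Fin n) : ({i}ᶜ : Set (Fin n)) ≠ Set.univ := by
  intro h
  have : i ∈ ({i}ᶜ : Set (Fin n)) := h ▸ trivial
  exact this rfl

theorem ncard_compl {n : ℕ} (i : Fin n) : ({i}ᶜ : Set (Fin n)).ncard + 1 = n := by
  have h := Set.ncard_add_ncard_compl ({i} : Set (Fin n))
  rw [Set.ncard_singleton, Nat.card_fin] at h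
  omega

variable [FiniteDimensional K V] [Fintype Y] [Infinite K]

theorem Base.frL (c : Base K V Y) : finrank K (LinearMap.ker c.L) + 1 = c.a + c.b := by
  obtain ⟨y⟩ := c.Yne
  have h := LinearMap.finrank_range_add_finrank_ker c.L
  have : LinearMap.range c.L = ⊤ := by
    rw [LinearMap.range_eq_top]
    apply LinearMap.surjective
    intro e
    exact c.Ly y (by rw [e]; simp)
  rw [this, c.frV] at h
  simp at h
  omega

theorem Base.gen1 (c : Base K V Y) : Nonempty (Gen1 c) := by
  have : Nonempty (Fin c.a) := ⟨⟨0, by have := c.a2; omega⟩⟩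
  obtain ⟨h, hO, h1, hI, hII, ha, hb⟩ := exists_generic (ι := Fin c.a) (Om := c.O1) (q := c.p0)
    c.p0O1 c.UU1 (by
      unfold Base.UU1; exact (Set.finite_range _).union (Set.finite_range _)) {0, - c.p0}
      (by simp) (by
        intro x hx
        rcases hx with rfl | rfl
        · exact zero_mem _
        · exact neg_mem c.p0O1)
  have hinj : ∀ s, h s = 0 → s = 0 := by
    intro s hs
    obtain ⟨i⟩ := this
    have hU : c.spY ∅ ⊔ span K {c.p0} ∈ c.UU1 := Or.inr ⟨∅, rfl⟩
    have e : c.spY ∅ ⊔ span K {c.p0} = span K {c.p0} := by simp [Base.spY]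
    rw [e] at hU
    have hfr : finrank K (c.O1 ⊓ span K {c.p0} : Submodule K V) ≤ 1 := by
      refine (fr_mono inf_le_right).trans ?_
      rw [finrank_span_singleton c.p0ne]
    have k1 := ha _ hU _ (compl_ne i) (by rw [c.frO1]; have := ncard_compl i; omega) _ (shift_mem i s)
      (by rw [map_sub, map_smul, hs, h1, zero_sub]
          exact neg_mem (smul_mem _ _ (mem_span_singleton_self _)))
    have k2 : s = s i • (fun _ => (1 : K)) := sub_eq_zero.mp k1
    rw [k2, map_smul, h1] at hs
    have : s i = 0 := (smul_eq_zero.mp hs).resolve_right c.p0ne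
    rw [k2, this]; simp
  refine ⟨⟨h, hO, h1, hinj, ?_, hI, ?_⟩⟩
  · have e1 : LinearMap.range h ≤ c.O1 := by rintro _ ⟨s, rfl⟩; exact hO s
    have e2 := LinearMap.finrank_range_of_inj (f := h)
      (LinearMap.ker_eq_bot.mp (LinearMap.ker_eq_bot'.mpr hinj))
    have e3 : LinearMap.range h = c.O1 := eq_of_fr e1 (by rw [e2, c.frO1]; simp)
    intro x hx
    rw [← e3] at hx
    exact hx
  · intro U hU x hx
    exact hII U hU x (by simpa using hx)

theorem Gen1.finQ {c : Base K V Y} (g : Gen1 c) : g.Q.Finite := by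
  unfold Gen1.Q
  exact ((Set.finite_singleton _).union (Set.finite_range _)).union (Set.finite_range _)

theorem Gen1.gen2 {c : Base K V Y} (g : Gen1 c) : Nonempty (Gen2 g) := by
  have : Nonempty (Fin c.b) := ⟨⟨0, by have := c.b2; omega⟩⟩
  obtain ⟨h, hO, h1, hI, hII, ha, hb⟩ := exists_generic (ι := Fin c.b) (Om := LinearMap.ker c.L)
    (q := - c.p0) (neg_mem (c.O1L c.p0O1)) g.UU2 (by
      unfold Gen1.UU2
      refine ((Set.Finite.image _ (Set.finite_univ.prod g.finQ.powerset)).union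
        (c.ZZfin.image _)).union ?_
      simp) (Set.range (fun A : Set (Fin c.a) => g.h1 (A.indicator 1)))
      (Set.finite_range _) (by
        rintro _ ⟨A, rfl⟩
        exact c.O1L (g.h1O _))
  have hL := c.frL
  exact ⟨⟨h, hO, h1, hI, fun U hU A1 => hII U hU _ ⟨A1, rfl⟩,
    fun U hU S hS hd => ha U hU S hS (by omega), fun U hU S hS hd => hb U hU S hS (by omega)⟩⟩

end
end KinserAux

set_option linter.unusedSectionVars false
set_option linter.unusedVariables false

namespace KinserAux
open Module Submodule

namespace Gen2
variable {K V Y : Type} [Field K] [AddCommGroup V] [Module K V]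
  [FiniteDimensional K V] [Fintype Y] [Infinite K]
  {c : Base K V Y} {g : Gen1 c} (k : Gen2 g)

/-- the ground set -/
abbrev Gr (c : Base K V Y) : Type := (Fin c.a ⊕ Fin c.b) ⊕ Y

/-- the vectors -/
noncomputable def ph : Gr c → V :=
  Sum.elim (Sum.elim (fun i => g.h1 (Pi.single i 1)) (fun i => k.h2 (Pi.single i 1))) c.ψ

/-- first part -/
def S1 (X : Set (Gr c)) : Set (Fin c.a) := {i | Sum.inl (Sum.inl i) ∈ X}
/-- second part -/
def S2 (X : Set (Gr c)) : Set (Fin c.b) := {i | Sum.inl (Sum.inr i) ∈ X}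
/-- third part -/
def SY (X : Set (Gr c)) : Set Y := {i | Sum.inr i ∈ X}

/-- first block -/
def H1s (c : Base K V Y) : Set (Gr c) := Set.range (fun i => Sum.inl (Sum.inl i))
/-- second block -/
def H2s (c : Base K V Y) : Set (Gr c) := Set.range (fun i => Sum.inl (Sum.inr i))
/-- the relaxed circuit hyperplane -/
def Hs (c : Base K V Y) : Set (Gr c) := Set.range Sum.inl

theorem span_split (X : Set (Gr c)) : span K (k.ph '' X) =
    c.spY (SY X) ⊔ (supp K (S1 X)).map g.h1 ⊔ (supp K (S2 X)).map k.h2 := by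
  apply le_antisymm
  · rw [span_le]
    rintro _ ⟨(i | i) | y, hx, rfl⟩
    · refine mem_sup_left (mem_sup_right ⟨Pi.single i 1, subset_span ⟨i, hx, rfl⟩, rfl⟩)
    · refine mem_sup_right ⟨Pi.single i 1, subset_span ⟨i, hx, rfl⟩, rfl⟩
    · exact mem_sup_left (mem_sup_left (subset_span ⟨y, hx, rfl⟩))
  · unfold supp
    rw [Submodule.map_span, Submodule.map_span]
    refine sup_le (sup_le ?_ ?_) ?_
    · refine span_mono ?_
      rintro _ ⟨y, hy, rfl⟩
      exact ⟨Sum.inr y, hy, rfl⟩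
    · refine span_mono ?_
      rintro _ ⟨_, ⟨y, hy, rfl⟩, rfl⟩
      exact ⟨Sum.inl (Sum.inl y), hy, rfl⟩
    · refine span_mono ?_
      rintro _ ⟨_, ⟨y, hy, rfl⟩, rfl⟩
      exact ⟨Sum.inl (Sum.inr y), hy, rfl⟩

theorem map1_univ : (supp K (Set.univ : Set (Fin c.a))).map g.h1 = c.O1 := by
  apply le_antisymm
  · rintro _ ⟨s, _, rfl⟩; exact g.h1O s
  · intro x hx
    obtain ⟨s, rfl⟩ := g.h1surj x hx
    exact ⟨s, supp_univ_mem s, rfl⟩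

theorem supp_empty {n : ℕ} : supp K (∅ : Set (Fin n)) = ⊥ := by simp [supp]

theorem i0 (c : Base K V Y) : Nonempty (Fin c.b) := ⟨⟨0, by have := c.b2; omega⟩⟩

theorem O1_mem : c.O1 ∈ g.UU2 := Or.inr (by simp)

theorem inf_O1 : LinearMap.ker c.L ⊓ c.O1 = c.O1 := inf_eq_right.mpr c.O1L

theorem inj_mod (i : Fin c.b) : ∀ s ∈ supp K ({i}ᶜ : Set (Fin c.b)), k.h2 s ∈ c.O1 → s = 0 := by
  refine k.h2a _ O1_mem _ (compl_ne i) ?_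
  rw [inf_O1, c.frO1]
  have := ncard_compl i
  omega

theorem span_mod (i : Fin c.b) :
    LinearMap.ker c.L ≤ c.O1 ⊔ (supp K ({i}ᶜ : Set (Fin c.b))).map k.h2 := by
  refine k.h2b _ O1_mem _ (compl_ne i) ?_
  rw [inf_O1, c.frO1]
  have := ncard_compl i
  omega

theorem h2_shift (i : Fin c.b) (s : Fin c.b → K) :
    k.h2 (s - s i • (fun _ => (1 : K))) = k.h2 s + s i • c.p0 := by
  rw [map_sub, map_smul, k.h2one]; simp

theorem h2_const {s : Fin c.b → K} (h : k.h2 s ∈ c.O1) : ∃ t : K, s = t • (fun _ => (1 : K)) := by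
  obtain ⟨i⟩ := i0 c
  have := k.inj_mod i _ (shift_mem i s) (by
    rw [h2_shift]; exact add_mem h (smul_mem _ _ c.p0O1))
  exact ⟨s i, sub_eq_zero.mp this⟩

theorem comb {s1 : Fin c.a → K} {s2 : Fin c.b → K} (h : g.h1 s1 + k.h2 s2 = 0) :
    ∃ t : K, s1 = t • (fun _ => (1 : K)) ∧ s2 = t • (fun _ => (1 : K)) := by
  have h' : k.h2 s2 = - g.h1 s1 := by rw [eq_neg_iff_add_eq_zero, add_comm]; exact h
  obtain ⟨t, rfl⟩ := k.h2_const (s := s2) (by rw [h']; exact neg_mem (g.h1O _))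
  refine ⟨t, ?_, rfl⟩
  rw [← sub_eq_zero]
  apply g.h1inj
  rw [map_sub, map_smul, g.h1one]
  rw [map_smul, k.h2one] at h
  rw [← h]; simp [sub_eq_add_neg]

theorem h2_inj {s : Fin c.b → K} (h : k.h2 s = 0) : s = 0 := by
  obtain ⟨t, e1, e2⟩ := k.comb (s1 := 0) (s2 := s) (by simp [h])
  have : t = 0 := by
    have := congrFun e1 ⟨0, by have := c.a2; omega⟩
    simpa using this.symm
  rw [e2, this]; simp

theorem span_H : span K (k.ph '' Hs c) = LinearMap.ker c.L := by
  rw [span_split]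
  have e1 : S1 (Hs c) = Set.univ := by ext; simp [S1, Hs]
  have e2 : S2 (Hs c) = Set.univ := by ext; simp [S2, Hs]
  have e3 : SY (Hs c) = ∅ := by ext; simp [SY, Hs]
  rw [e1, e2, e3, map1_univ]
  obtain ⟨i⟩ := i0 c
  apply le_antisymm
  · refine sup_le (sup_le (by simp [Base.spY]) c.O1L) ?_
    rintro _ ⟨s, _, rfl⟩; exact k.h2O s
  · refine (k.span_mod i).trans (sup_le_sup le_sup_right (Submodule.map_mono (supp_mono (Set.subset_univ _))))

theorem sum_h1 (s : Fin c.a → K) : ∑ i, s i • g.h1 (Pi.single i 1) = g.h1 s := by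
  conv_rhs => rw [LinearMap.pi_apply_eq_sum_univ g.h1 s]
  refine sum_congr rfl fun i _ => ?_
  congr 2
  funext j
  simp [Pi.single_apply, eq_comm]

theorem sum_h2 (s : Fin c.b → K) : ∑ i, s i • k.h2 (Pi.single i 1) = k.h2 s := by
  conv_rhs => rw [LinearMap.pi_apply_eq_sum_univ k.h2 s]
  refine sum_congr rfl fun i _ => ?_
  congr 2
  funext j
  simp [Pi.single_apply, eq_comm]

theorem ind_H (X : Set (Gr c)) (hX : X ⊂ Hs c) : LinearIndepOn K k.ph X := by
  rw [linearIndepOn_iff]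
  intro l hl h0
  rw [Finsupp.mem_supported] at hl
  have hz : ∀ e, e ∉ X → l e = 0 := by
    intro e he
    by_contra hn
    exact he (hl (by simpa using hn))
  rw [Finsupp.linearCombination_apply, Finsupp.sum_fintype _ _ (by simp), Fintype.sum_sum_type,
    Fintype.sum_sum_type] at h0
  have hy : ∀ y : Y, l (Sum.inr y) = 0 := fun y => hz _ fun h => by
    have := hX.1 h; simp [Hs] at this
  simp only [hy, zero_smul, sum_const_zero, add_zero] at h0
  have h1 := sum_h1 (g := g) (fun i => l (Sum.inl (Sum.inl i)))
  have h2 := k.sum_h2 (fun i => l (Sum.inl (Sum.inr i)))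
  simp only [ph, Sum.elim_inl, Sum.elim_inr] at h0
  rw [h1, h2] at h0
  obtain ⟨t, e1, e2⟩ := k.comb h0
  have hall : ∀ i : Fin c.a ⊕ Fin c.b, l (Sum.inl i) = t := by
    rintro (i | i)
    · simpa using congrFun e1 i
    · simpa using congrFun e2 i
  obtain ⟨e, ⟨i, rfl⟩, he⟩ := Set.exists_of_ssubset hX
  have t0 : t = 0 := by rw [← hall i]; exact hz _ he
  ext e
  rcases e with i | y
  · simp [hall, t0]
  · simp [hy]

/-- The configuration -/
noncomputable def cfg : Cfg K V (Gr c) where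
  φ := k.ph
  H := Hs c
  hyp := by rw [span_H, c.frL, c.frV]
  card := by
    rw [c.frV, Hs, ← Set.image_univ, Set.ncard_image_of_injective _ Sum.inl_injective,
      Set.ncard_univ]
    simp
  out := by
    intro y hy
    rw [span_H]
    rcases y with i | y
    · exact absurd ⟨i, rfl⟩ hy
    · exact c.Ly y
  ind := k.ind_H

theorem cfg_Om : k.cfg.Om = LinearMap.ker c.L := k.span_H

theorem cfg_sp (X : Set (Gr c)) : k.cfg.sp X =
    c.spY (SY X) ⊔ (supp K (S1 X)).map g.h1 ⊔ (supp K (S2 X)).map k.h2 := k.span_split X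

theorem cfg_sg (A : Set (Gr c)) (hA : A ⊆ Hs c) : k.cfg.sg A =
    g.h1 ((S1 A).indicator 1) + k.h2 ((S2 A).indicator 1) := by
  classical
  unfold Cfg.sg
  rw [Fintype.sum_sum_type, Fintype.sum_sum_type, ← sum_h1 (g := g), ← k.sum_h2]
  have hy : ∀ y : Y, A.indicator k.cfg.φ (Sum.inr y) = 0 := fun y =>
    Set.indicator_of_notMem (fun h => by have := hA h; simp [Hs] at this) _
  simp only [hy, sum_const_zero, add_zero]
  congr 1
  · refine sum_congr rfl fun i _ => ?_
    by_cases h : Sum.inl (Sum.inl i) ∈ A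
    · rw [Set.indicator_of_mem h, Set.indicator_of_mem (show i ∈ S1 A from h)]; simp [cfg, ph]
    · rw [Set.indicator_of_notMem h, Set.indicator_of_notMem (show i ∉ S1 A from h)]; simp
  · refine sum_congr rfl fun i _ => ?_
    by_cases h : Sum.inl (Sum.inr i) ∈ A
    · rw [Set.indicator_of_mem h, Set.indicator_of_mem (show i ∈ S2 A from h)]; simp [cfg, ph]
    · rw [Set.indicator_of_notMem h, Set.indicator_of_notMem (show i ∉ S2 A from h)]; simp

theorem cfg_H1 : k.cfg.sp (H1s c) = c.O1 := by
  rw [cfg_sp]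
  have e1 : S1 (H1s c) = Set.univ := by ext; simp [S1, H1s]
  have e2 : S2 (H1s c) = ∅ := by ext; simp [S2, H1s]
  have e3 : SY (H1s c) = ∅ := by ext; simp [SY, H1s]
  rw [e1, e2, e3, map1_univ, supp_empty]
  simp [Base.spY]

theorem cfg_H2 : k.cfg.sp (H2s c) = (supp K (Set.univ : Set (Fin c.b))).map k.h2 := by
  rw [cfg_sp]
  have e1 : S1 (H2s c) = ∅ := by ext; simp [S1, H2s]
  have e2 : S2 (H2s c) = Set.univ := by ext; simp [S2, H2s]
  have e3 : SY (H2s c) = ∅ := by ext; simp [SY, H2s]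
  rw [e1, e2, e3, supp_empty]
  simp [Base.spY]

theorem cfg_S2 {S : Set (Gr c)} (h : S ⊆ H2s c) : k.cfg.sp S = (supp K (S2 S)).map k.h2 := by
  rw [cfg_sp]
  have e1 : S1 S = ∅ := by
    ext i; simp only [S1, Set.mem_ofPred_eq, Set.mem_empty_iff_false, iff_false]
    intro hi; have := h hi; simp [H2s] at this
  have e3 : SY S = ∅ := by
    ext i; simp only [SY, Set.mem_ofPred_eq, Set.mem_empty_iff_false, iff_false]
    intro hi; have := h hi; simp [H2s] at this
  rw [e1, e3, supp_empty]
  simp [Base.spY]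

theorem cfg_Z {Z : Set (Gr c)} (h : Z ⊆ (Hs c)ᶜ) : k.cfg.sp Z = c.spY (SY Z) := by
  rw [cfg_sp]
  have e1 : S1 Z = ∅ := by
    ext i; simp only [S1, Set.mem_ofPred_eq, Set.mem_empty_iff_false, iff_false]
    intro hi; have := h hi; simp [Hs] at this
  have e3 : S2 Z = ∅ := by
    ext i; simp only [S2, Set.mem_ofPred_eq, Set.mem_empty_iff_false, iff_false]
    intro hi; have := h hi; simp [Hs] at this
  rw [e1, e3, supp_empty, supp_empty]
  simp

end Gen2
end KinserAux

set_option linter.unusedSectionVars false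
set_option linter.unusedVariables false

namespace KinserAux
open Module Submodule

namespace Gen2
variable {K V Y : Type} [Field K] [AddCommGroup V] [Module K V]
  [FiniteDimensional K V] [Fintype Y] [Infinite K]
  {c : Base K V Y} {g : Gen1 c} (k : Gen2 g)

theorem ind_mem {n : ℕ} {A S : Set (Fin n)} (h : A ⊆ S) :
    (A.indicator 1 : Fin n → K) ∈ supp K S := by
  rw [mem_supp]
  intro i hi
  exact Set.indicator_of_notMem (fun hA => hi (h hA)) _

theorem ind_compl {n : ℕ} (A : Set (Fin n)) :
    (A.indicator 1 : Fin n → K) = (fun _ => 1) - Aᶜ.indicator 1 := by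
  funext i
  by_cases h : i ∈ A <;> simp [h]

theorem h1_compl (A : Set (Fin c.a)) :
    g.h1 (A.indicator 1) = c.p0 - g.h1 (Aᶜ.indicator 1) := by
  rw [ind_compl A, map_sub, g.h1one]

theorem h2_compl (A : Set (Fin c.b)) :
    k.h2 (A.indicator 1) = - c.p0 - k.h2 (Aᶜ.indicator 1) := by
  rw [ind_compl A, map_sub, k.h2one]

theorem UU2_mem (Z : Set Y) (S : Set (Fin c.a)) (T : Set V) (hT : T ⊆ g.Q) :
    c.spY Z ⊔ (supp K S).map g.h1 ⊔ span K T ∈ g.UU2 :=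
  Or.inl (Or.inl ⟨((Z, S), T), ⟨trivial, hT⟩, rfl⟩)

theorem UU2_mem0 (Z : Set Y) (S : Set (Fin c.a)) :
    c.spY Z ⊔ (supp K S).map g.h1 ∈ g.UU2 := by
  have := UU2_mem (g := g) Z S ∅ (by simp)
  simpa using this

theorem dichot {α : Type*} (A S : Set α) :
    (A ⊆ S ∨ Aᶜ ⊆ S) ∨ ∃ i i', i ∈ A ∧ i ∉ S ∧ i' ∉ A ∧ i' ∉ S := by
  by_cases h : A ⊆ S
  · exact Or.inl (Or.inl h)
  by_cases h' : Aᶜ ⊆ S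
  · exact Or.inl (Or.inr h')
  obtain ⟨i, hi, hi'⟩ := Set.not_subset.mp h
  obtain ⟨j, hj, hj'⟩ := Set.not_subset.mp h'
  exact Or.inr ⟨i, j, hi, hi', hj, hj'⟩

theorem p0_mem_univ : c.p0 ∈ (supp K (Set.univ : Set (Fin c.b))).map k.h2 :=
  ⟨fun _ => -1, supp_univ_mem _, by
    have : (fun _ => -1 : Fin c.b → K) = - (fun _ => 1) := by funext; simp
    rw [this, map_neg, k.h2one, neg_neg]⟩

/-- `GG` in coordinates. -/
theorem gg_coord (Z : Set Y) (S1 A1 : Set (Fin c.a)) (S2 A2 : Set (Fin c.b))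
    (hO : ¬ LinearMap.ker c.L ≤ c.spY Z ⊔ (supp K S1).map g.h1 ⊔ (supp K S2).map k.h2)
    (hm : g.h1 (A1.indicator 1) + k.h2 (A2.indicator 1) ∈
      c.spY Z ⊔ (supp K S1).map g.h1 ⊔ (supp K S2).map k.h2) :
    (A2 ⊆ S2 ∨ A2ᶜ ⊆ S2) ∧
      (c.O1 ≤ c.spY Z ⊔ (supp K S1).map g.h1 ⊔ (supp K S2).map k.h2 ∨
        ((A1 ⊆ S1 ∨ A1ᶜ ⊆ S1) ∧ ((A1 ⊆ S1 ∧ A2 ⊆ S2) ∨ (A1ᶜ ⊆ S1 ∧ A2ᶜ ⊆ S2) ∨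
          c.p0 ∈ c.spY Z))) := by
  have first : A2 ⊆ S2 ∨ A2ᶜ ⊆ S2 := by
    rcases dichot A2 S2 with h | ⟨i, i', h1, h2, h3, h4⟩
    · exact h
    · exact absurd (k.h2II _ (UU2_mem0 Z S1) A1 S2 A2 i i' h1 h2 h3 h4 hm) hO
  refine ⟨first, ?_⟩
  by_cases hS2 : S2 = Set.univ
  · subst hS2
    obtain ⟨i⟩ := i0 c
    have hx1 : g.h1 (A1.indicator 1) ∈
        c.spY Z ⊔ (supp K S1).map g.h1 ⊔ (supp K Set.univ).map k.h2 := by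
      have := sub_mem hm (mem_sup_right (S := c.spY Z ⊔ (supp K S1).map g.h1)
        (⟨A2.indicator 1, supp_univ_mem _, rfl⟩ :
        k.h2 (A2.indicator 1) ∈ (supp K Set.univ).map k.h2))
      simpa using this
    have hU := UU2_mem (g := g) Z S1 {c.p0, g.h1 (A1.indicator 1)} (by
      rintro x (rfl | rfl)
      · exact Or.inl (Or.inl rfl)
      · exact Or.inl (Or.inr ⟨A1, rfl⟩))
    have hx2 : g.h1 (A1.indicator 1) ∈ (c.spY Z ⊔ span K {c.p0}) ⊔ (supp K S1).map g.h1 := by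
      rcases k.h2I _ hU _ (compl_ne i) with h | h
      · exfalso
        refine hO (h.trans (sup_le (sup_le le_sup_left ?_) ?_))
        · rw [span_le]
          rintro x (rfl | rfl)
          · exact mem_sup_right k.p0_mem_univ
          · exact hx1
        · exact le_sup_of_le_right (Submodule.map_mono (supp_mono (Set.subset_univ _)))
      · obtain ⟨u, hu, _, ⟨s, hs, rfl⟩, e⟩ := mem_sup.mp hx1
        have e1 : k.h2 (s - s i • (fun _ => (1 : K))) = g.h1 (A1.indicator 1) - u + s i • c.p0 := by
          rw [h2_shift, ← e]; abel
        have s0 := h _ (shift_mem i s) (by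
          rw [e1]
          refine add_mem (sub_mem (mem_sup_right (subset_span (by simp))) (mem_sup_left hu))
            (smul_mem _ _ (mem_sup_right (subset_span (by simp)))))
        rw [s0, map_zero] at e1
        have e2 : g.h1 (A1.indicator 1) = u + (- s i) • c.p0 := by
          have e3 : g.h1 (A1.indicator 1) = (g.h1 (A1.indicator 1) - u + s i • c.p0) + u - s i • c.p0 := by
            abel
          rw [e3, ← e1]; module
        rw [e2]
        have hle : c.spY Z ⊔ (supp K S1).map g.h1 ≤ (c.spY Z ⊔ span K {c.p0}) ⊔ (supp K S1).map g.h1 :=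
          sup_le_sup le_sup_left le_rfl
        exact add_mem (hle hu) (smul_mem _ _ (mem_sup_left (mem_sup_right (mem_span_singleton_self _))))
    have hle2 : (c.spY Z ⊔ span K {c.p0}) ⊔ (supp K S1).map g.h1 ≤
        c.spY Z ⊔ (supp K S1).map g.h1 ⊔ (supp K Set.univ).map k.h2 := by
      refine sup_le (sup_le (le_sup_of_le_left le_sup_left) ?_) (le_sup_of_le_left le_sup_right)
      rw [span_le]
      rintro x rfl
      exact mem_sup_right k.p0_mem_univ
    rcases dichot A1 S1 with h | ⟨i, i', h1, h2, h3, h4⟩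
    · right
      refine ⟨h, ?_⟩
      rcases h with h | h
      · exact Or.inl ⟨h, Set.subset_univ _⟩
      · exact Or.inr (Or.inl ⟨h, Set.subset_univ _⟩)
    · left
      exact (g.h1II _ (Or.inr ⟨Z, rfl⟩) 0 (Or.inl rfl) S1 A1 i i' h1 h2 h3 h4
        (by rw [zero_add]; exact hx2)).trans hle2
  ·
    have step : ∀ x1 ∈ g.Q, x1 ∈ c.spY Z ⊔ (supp K S1).map g.h1 ⊔ (supp K S2).map k.h2 →
        x1 ∈ c.spY Z ⊔ (supp K S1).map g.h1 := by
      intro x1 hQ hx1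
      have hU := UU2_mem (g := g) Z S1 {x1} (by simpa using hQ)
      rcases k.h2I _ hU _ hS2 with h | h
      · exfalso
        refine hO (h.trans (sup_le (sup_le le_sup_left ?_) le_sup_right))
        rw [span_le]
        rintro x rfl
        exact hx1
      · obtain ⟨u, hu, _, ⟨s, hs, rfl⟩, e⟩ := mem_sup.mp hx1
        have s0 := h s hs (by
          have : k.h2 s = x1 - u := by rw [← e]; abel
          rw [this]
          exact sub_mem (mem_sup_right (mem_span_singleton_self _)) (mem_sup_left hu))
        rw [s0, map_zero, add_zero] at e
        rw [← e]; exact hu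
    have last : c.p0 ∈ c.spY Z ⊔ (supp K S1).map g.h1 →
        c.O1 ≤ c.spY Z ⊔ (supp K S1).map g.h1 ⊔ (supp K S2).map k.h2 ∨ c.p0 ∈ c.spY Z := by
      intro hp
      by_cases hS1 : S1 = Set.univ
      · left
        rw [hS1, map1_univ]
        exact le_sup_of_le_left le_sup_right
      · rcases g.h1I _ (Or.inr ⟨Z, rfl⟩) S1 hS1 with h | h
        · left
          refine h.trans (sup_le (sup_le (le_sup_of_le_left le_sup_left) ?_)
            (le_sup_of_le_left le_sup_right))
          rw [span_le]
          rintro x rfl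
          exact mem_sup_left hp
        · right
          obtain ⟨u, hu, _, ⟨s, hs, rfl⟩, e⟩ := mem_sup.mp hp
          have s0 := h s hs (by
            have : g.h1 s = c.p0 - u := by rw [← e]; abel
            rw [this]
            exact sub_mem (mem_sup_right (mem_span_singleton_self _)) (mem_sup_left hu))
          rw [s0, map_zero, add_zero] at e
          rw [← e]; exact hu
    rcases first with hA2 | hA2
    ·
      have hx1 : g.h1 (A1.indicator 1) ∈ c.spY Z ⊔ (supp K S1).map g.h1 := by
        apply step _ (Or.inl (Or.inr ⟨A1, rfl⟩))
        have := sub_mem hm (mem_sup_right (S := c.spY Z ⊔ (supp K S1).map g.h1)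
          (⟨A2.indicator 1, ind_mem hA2, rfl⟩ :
          k.h2 (A2.indicator 1) ∈ (supp K S2).map k.h2))
        simpa using this
      rcases dichot A1 S1 with h | ⟨i, i', h1, h2, h3, h4⟩
      · rcases h with h | h
        · exact Or.inr ⟨Or.inl h, Or.inl ⟨h, hA2⟩⟩
        · have hp : c.p0 ∈ c.spY Z ⊔ (supp K S1).map g.h1 := by
            have e : c.p0 = g.h1 (A1.indicator 1) + g.h1 (A1ᶜ.indicator 1) := by
              rw [h1_compl A1]; abel
            rw [e]
            exact add_mem hx1 (mem_sup_right ⟨_, ind_mem h, rfl⟩)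
          rcases last hp with h' | h'
          · exact Or.inl h'
          · exact Or.inr ⟨Or.inr h, Or.inr (Or.inr h')⟩
      · left
        exact (g.h1II _ (Or.inl ⟨Z, rfl⟩) 0 (Or.inl rfl) S1 A1 i i' h1 h2 h3 h4
          (by rw [zero_add]; exact hx1)).trans le_sup_left
    · have hx1 : g.h1 (A1.indicator 1) - c.p0 ∈ c.spY Z ⊔ (supp K S1).map g.h1 := by
        apply step _ (Or.inr ⟨A1, rfl⟩)
        have := add_mem hm (mem_sup_right (S := c.spY Z ⊔ (supp K S1).map g.h1)
          (⟨A2ᶜ.indicator 1, ind_mem hA2, rfl⟩ :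
          k.h2 (A2ᶜ.indicator 1) ∈ (supp K S2).map k.h2))
        rw [h2_compl] at this
        convert this using 1
        abel
      rcases dichot A1 S1 with h | ⟨i, i', h1, h2, h3, h4⟩
      · rcases h with h | h
        · have hp : c.p0 ∈ c.spY Z ⊔ (supp K S1).map g.h1 := by
            have e : c.p0 = g.h1 (A1.indicator 1) - (g.h1 (A1.indicator 1) - c.p0) := by abel
            rw [e]
            exact sub_mem (mem_sup_right ⟨_, ind_mem h, rfl⟩) hx1
          rcases last hp with h' | h'
          · exact Or.inl h'
          · exact Or.inr ⟨Or.inl h, Or.inr (Or.inr h')⟩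
        · exact Or.inr ⟨Or.inr h, Or.inr (Or.inl ⟨h, hA2⟩)⟩
      · left
        exact (g.h1II _ (Or.inl ⟨Z, rfl⟩) (-c.p0) (Or.inr rfl) S1 A1 i i' h1 h2 h3 h4
          (by rw [neg_add_eq_sub]; exact hx1)).trans le_sup_left

theorem GG' (X A : Set (Gr c)) (hO : ¬ k.cfg.Om ≤ k.cfg.sp X) (hA : A ⊆ Hs c)
    (hm : k.cfg.sg A ∈ k.cfg.sp X) :
    (A ∩ H2s c ⊆ X ∨ H2s c \ A ⊆ X) ∧ (k.cfg.sp (H1s c) ≤ k.cfg.sp X ∨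
      ((A ∩ H1s c ⊆ X ∨ H1s c \ A ⊆ X) ∧ (A ⊆ X ∨ Hs c \ A ⊆ X ∨ c.p0 ∈ k.cfg.sp (X \ Hs c)))) := by
  rw [cfg_Om, cfg_sp] at hO
  rw [cfg_sg _ _ hA, cfg_sp] at hm
  have h := k.gg_coord _ _ _ _ _ hO hm
  rw [cfg_H1, cfg_sp _ X]
  have t1 : S1 A ⊆ S1 X → A ∩ H1s c ⊆ X := by
    rintro h _ ⟨hx, i, rfl⟩; exact h hx
  have t1' : (S1 A)ᶜ ⊆ S1 X → H1s c \ A ⊆ X := by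
    rintro h _ ⟨⟨i, rfl⟩, hx⟩; exact h hx
  have t2 : S2 A ⊆ S2 X → A ∩ H2s c ⊆ X := by
    rintro h _ ⟨hx, i, rfl⟩; exact h hx
  have t2' : (S2 A)ᶜ ⊆ S2 X → H2s c \ A ⊆ X := by
    rintro h _ ⟨⟨i, rfl⟩, hx⟩; exact h hx
  refine ⟨h.1.imp t2 t2', h.2.imp id ?_⟩
  rintro ⟨h1, h2⟩
  refine ⟨h1.imp t1 t1', ?_⟩
  rcases h2 with ⟨ha, hb⟩ | ⟨ha, hb⟩ | h2
  · left
    intro x hx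
    obtain ⟨i | i, rfl⟩ := hA hx
    · exact t1 ha ⟨hx, i, rfl⟩
    · exact t2 hb ⟨hx, i, rfl⟩
  · right; left
    rintro x ⟨⟨i | i, rfl⟩, hx⟩
    · exact t1' ha ⟨⟨i, rfl⟩, hx⟩
    · exact t2' hb ⟨⟨i, rfl⟩, hx⟩
  · right; right
    rw [cfg_Z _ (fun x hx => hx.2)]
    have : SY (X \ Hs c) = SY X := by ext y; simp [SY, Hs]
    rw [this]; exact h2

end Gen2
end KinserAux

set_option linter.unusedSectionVars false
set_option linter.unusedVariables false

namespace KinserAux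
open Module Submodule

namespace Gen2
variable {K V Y : Type} [Field K] [AddCommGroup V] [Module K V]
  [FiniteDimensional K V] [Fintype Y] [Infinite K]
  {c : Base K V Y} {g : Gen1 c} (k : Gen2 g)

theorem frH2' : finrank K (k.cfg.sp (H2s c)) = c.b := by
  rw [cfg_H2]
  have e : (supp K (Set.univ : Set (Fin c.b))).map k.h2 = LinearMap.range k.h2 := by
    apply le_antisymm
    · rintro _ ⟨s, _, rfl⟩; exact ⟨s, rfl⟩
    · rintro _ ⟨s, rfl⟩; exact ⟨s, supp_univ_mem s, rfl⟩
  rw [e, LinearMap.finrank_range_of_inj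
      (LinearMap.ker_eq_bot.mp (LinearMap.ker_eq_bot'.mpr fun s => k.h2_inj))]
  simp

theorem B1' (X S : Set (Gr c)) (hX : Disjoint X (H2s c)) (hp : c.p0 ∈ k.cfg.sp X)
    (hO : ¬ k.cfg.Om ≤ k.cfg.sp X ⊔ k.cfg.sp (H2s c)) (hS : S ⊆ H2s c) :
    (k.cfg.sp X ⊔ k.cfg.sp S) ⊓ k.cfg.sp (H2s c) ≤ span K {c.p0} ⊔ k.cfg.sp S := by
  have e2 : S2 X = ∅ := by
    ext i; simp only [S2, Set.mem_ofPred_eq, Set.mem_empty_iff_false, iff_false]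
    intro hi; exact Set.disjoint_left.mp hX hi ⟨i, rfl⟩
  have eX : k.cfg.sp X = c.spY (SY X) ⊔ (supp K (S1 X)).map g.h1 := by
    rw [cfg_sp, e2, supp_empty]; simp
  rw [cfg_S2 _ hS, cfg_H2]
  rw [cfg_H2, cfg_Om] at hO
  rintro v ⟨hv1, t, _, rfl⟩
  by_cases hu : S2 S = Set.univ
  · rw [hu]; exact mem_sup_right ⟨t, supp_univ_mem t, rfl⟩
  obtain ⟨i, hi⟩ := (Set.ne_univ_iff_exists_notMem _).mp hu
  obtain ⟨x, hx, _, ⟨s, hs, rfl⟩, e⟩ := mem_sup.mp hv1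
  have hU : k.cfg.sp X ∈ g.UU2 := by rw [eX]; exact UU2_mem0 _ _
  rcases k.h2I _ hU _ (compl_ne i) with h | h
  · exact absurd (h.trans (sup_le_sup le_rfl (Submodule.map_mono (supp_mono (Set.subset_univ _))))) hO
  · have h0 := h _ (shift_mem i (t - s)) (by
      rw [h2_shift, map_sub, ← e]
      simpa using add_mem hx (smul_mem _ _ hp))
    have h1 := k.h2_shift i (t - s)
    rw [h0, map_zero, map_sub] at h1
    have h2 : k.h2 t = (- (t - s) i) • c.p0 + k.h2 s := by
      rw [neg_smul, eq_neg_add_iff_add_eq, ← sub_eq_zero, h1]; abel_nf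
    rw [h2]
    exact add_mem (mem_sup_left (smul_mem _ _ (mem_span_singleton_self _)))
      (mem_sup_right ⟨s, hs, rfl⟩)

theorem SY_inr (Z : Set Y) : SY (c := c) (Sum.inr '' Z) = Z := by ext y; simp [SY]

theorem inr_sub (Z : Set Y) : (Sum.inr '' Z : Set (Gr c)) ⊆ (Hs c)ᶜ := by
  rintro _ ⟨y, _, rfl⟩; simp [Hs]

theorem cfg_Y (Z : Set Y) : k.cfg.sp (Sum.inr '' Z) = c.spY Z := by
  rw [cfg_Z _ (inr_sub Z), SY_inr]

theorem B3' : ∃ x ∈ k.cfg.sp (Sum.inr '' c.Ys 0), ∃ x' ∈ k.cfg.sp (Sum.inr '' c.Ys c.N),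
    x - x' ∈ k.cfg.sp (H2s c) ∧ x ∉ k.cfg.Om := by
  rw [cfg_Y, cfg_Y, cfg_H2, cfg_Om]
  obtain ⟨z, hz, hzL, hz0⟩ := c.zz
  obtain ⟨i⟩ := i0 c
  have hU : span K (c.ψ '' Set.univ) ⊓ LinearMap.ker c.L ⊓ LinearMap.ker c.L0 ∈ g.UU2 :=
    Or.inr (by simp)
  have h := k.h2b _ hU _ (compl_ne i) (by
    have e : LinearMap.ker c.L ⊓ (span K (c.ψ '' Set.univ) ⊓ LinearMap.ker c.L ⊓ LinearMap.ker c.L0)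
        = span K (c.ψ '' Set.univ) ⊓ LinearMap.ker c.L ⊓ LinearMap.ker c.L0 :=
      inf_eq_right.mpr (inf_le_left.trans inf_le_right)
    rw [e]
    have := ncard_compl i
    have := c.fr3
    omega)
  obtain ⟨u, ⟨⟨hu1, hu2⟩, hu3⟩, _, ⟨s, hs, rfl⟩, e⟩ := mem_sup.mp (h hzL)
  have hzu : z - u ∈ span K (c.ψ '' Set.univ) := sub_mem hz hu1
  obtain ⟨x, hx, x', hx', e'⟩ := mem_sup.mp (c.spYY hzu)
  refine ⟨x, hx, -x', neg_mem hx', ?_, ?_⟩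
  · rw [sub_neg_eq_add, e', ← e]
    exact ⟨s, supp_univ_mem s, by simp⟩
  · intro hxL
    apply hz0
    have h1 : c.L0 x = 0 := by rw [c.L00 x hx]; exact hxL
    have h2 : c.L0 x' = 0 := c.L0N x' hx'
    have h3 : c.L0 u = 0 := hu3
    have h4 := congrArg c.L0 e'
    rw [map_add, map_sub, h1, h2, h3] at h4
    simpa using h4.symm

theorem B4' (e) (he : e ∈ H2s c) (v) (hv : v ∈ k.cfg.sp (H1s c))
    (x) (hx : x ∈ k.cfg.sp (Sum.inr '' c.Ys 0)) (x') (hx' : x' ∈ k.cfg.sp (Sum.inr '' c.Ys c.N))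
    (hxO : x ∈ k.cfg.Om) (hxO' : x' ∈ k.cfg.Om) : k.cfg.φ e ≠ v + x + x' := by
  rw [cfg_Y] at hx hx'
  rw [cfg_H1] at hv
  rw [cfg_Om] at hxO hxO'
  obtain ⟨i, rfl⟩ := he
  intro e
  have h0 : c.L0 (k.h2 (Pi.single i 1)) = 0 := by
    have : k.cfg.φ (Sum.inl (Sum.inr i)) = k.h2 (Pi.single i 1) := rfl
    rw [← this, e, map_add, map_add, c.L00 x hx, c.L0N x' hx']
    have e1 : c.L0 v = 0 := c.L0O1 hv
    have e2 : c.L x = 0 := hxO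
    simp [e1, e2]
  have hU : LinearMap.ker c.L0 ∈ g.UU2 := Or.inr (by simp)
  have hb := c.b2
  have hne : ({i} : Set (Fin c.b)) ≠ Set.univ := by
    intro h
    have := congrArg Set.ncard h
    rw [Set.ncard_singleton, Set.ncard_univ, Nat.card_fin] at this
    omega
  have hsup : Pi.single i (1 : K) ∈ supp K ({i} : Set (Fin c.b)) := subset_span ⟨i, rfl, rfl⟩
  rcases k.h2I _ hU _ hne with h | h
  · obtain ⟨z, hz, hzL, hz0⟩ := c.zz
    have hle : LinearMap.ker c.L0 ⊔ (supp K ({i} : Set (Fin c.b))).map k.h2 ≤ LinearMap.ker c.L0 := by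
      refine sup_le le_rfl ?_
      unfold supp
      rw [Submodule.map_span, span_le]
      rintro _ ⟨_, ⟨_, rfl, rfl⟩, rfl⟩
      exact h0
    exact hz0 (hle (h hzL))
  · have := h _ hsup h0
    have := congrFun this i
    simp at this

theorem B6' (Z S : Set (Gr c)) (hZ : Z ⊆ (Hs c)ᶜ) (hp : c.p0 ∈ k.cfg.sp Z) (hS : S ⊆ H2s c)
    (hle : k.cfg.sp Z ⊓ k.cfg.Om ≤ k.cfg.sp (H1s c) ⊔ k.cfg.sp S) :
    k.cfg.Om ≤ k.cfg.sp (H1s c) ⊔ k.cfg.sp S := by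
  rw [cfg_Z _ hZ] at hp hle
  rw [cfg_Om, cfg_H1, cfg_S2 _ hS] at *
  obtain ⟨z, hzZ, hz, hzL, hzO⟩ := c.c6 _ hp
  have hz' : z ∈ c.O1 ⊔ (supp K (S2 S)).map k.h2 := hle ⟨hz, hzL⟩
  by_cases hu : S2 S = Set.univ
  · rw [hu]
    obtain ⟨i⟩ := i0 c
    exact (k.span_mod i).trans (sup_le_sup le_rfl (Submodule.map_mono (supp_mono (Set.subset_univ _))))
  have hU : c.O1 ⊔ span K {z} ∈ g.UU2 := Or.inl (Or.inr ⟨z, hzZ, rfl⟩)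
  rcases k.h2I _ hU _ hu with h | h
  · refine h.trans (sup_le (sup_le le_sup_left ?_) le_sup_right)
    rw [span_le]
    rintro x rfl
    exact hz'
  · exfalso
    obtain ⟨u, hu, _, ⟨s, hs, rfl⟩, e⟩ := mem_sup.mp hz'
    have s0 := h s hs (by
      have : k.h2 s = z - u := by rw [← e]; abel
      rw [this]
      exact sub_mem (mem_sup_right (mem_span_singleton_self _)) (mem_sup_left hu))
    rw [s0, map_zero, add_zero] at e
    exact hzO (e ▸ hu)

theorem B7' (e) (he : e ∈ H1s c) : k.cfg.φ e ∉ k.cfg.sp (Hs c)ᶜ := by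
  rw [cfg_Z _ le_rfl]
  obtain ⟨i, rfl⟩ := he
  have e1 : SY (Hs c)ᶜ = Set.univ := by ext y; simp [SY, Hs]
  rw [e1]
  intro (h0 : g.h1 (Pi.single i 1) ∈ _)
  have ha := c.a2
  have hne : ({i} : Set (Fin c.a)) ≠ Set.univ := by
    intro h
    have := congrArg Set.ncard h
    rw [Set.ncard_singleton, Set.ncard_univ, Nat.card_fin] at this
    omega
  rcases g.h1I _ (Or.inl ⟨Set.univ, rfl⟩) _ hne with h | h
  · apply c.c7
    refine h.trans (sup_le le_rfl ?_)
    unfold supp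
    rw [Submodule.map_span, span_le]
    rintro _ ⟨_, ⟨_, rfl, rfl⟩, rfl⟩
    exact h0
  · have := h _ (subset_span ⟨i, rfl, rfl⟩) h0
    have := congrFun this i
    simp at this

theorem inr_SY {Z : Set (Gr c)} {Z' : Set Y} (h : Z' ⊆ SY Z) : Sum.inr '' Z' ⊆ Z := by
  rintro _ ⟨y, hy, rfl⟩; exact h hy

theorem SY_disj {Z Z' : Set (Gr c)} (h : Disjoint Z Z') : Disjoint (SY Z) (SY Z') := by
  rw [Set.disjoint_left] at h ⊢
  intro y hy hy'
  exact h hy hy'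

/-- The full configuration -/
noncomputable def cfg2 : Cfg2 K V (Gr c) where
  toCfg := k.cfg
  H1 := H1s c
  H2 := H2s c
  Y0 := Sum.inr '' c.Ys 0
  YN := Sum.inr '' c.Ys c.N
  p0 := c.p0
  N := c.N
  a := c.a
  hH := by
    ext x
    rcases x with (i | i) | y <;> simp [H1s, H2s, Hs, cfg]
  hdisj := by
    rw [Set.disjoint_left]
    rintro _ ⟨i, rfl⟩ ⟨j, hj⟩
    simp at hj
  sgH := by
    have e1 : S1 (Hs c) = Set.univ := by ext; simp [S1, Hs]
    have e2 : S2 (Hs c) = Set.univ := by ext; simp [S2, Hs]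
    have := k.cfg_sg (Hs c) le_rfl
    rw [e1, e2] at this
    refine this.trans ?_
    simp only [Set.indicator_univ]
    have h1 := g.h1one
    have h2 := k.h2one
    change g.h1 (fun _ => 1) + k.h2 (fun _ => 1) = 0
    rw [h1, h2]; simp
  sgH1 := by
    have e1 : S1 (H1s c) = Set.univ := by ext; simp [S1, H1s]
    have e2 : S2 (H1s c) = ∅ := by ext; simp [S2, H1s]
    have := k.cfg_sg (H1s c) (by rintro _ ⟨i, rfl⟩; exact ⟨_, rfl⟩)
    rw [e1, e2] at this
    refine this.trans ?_
    simp only [Set.indicator_univ, Set.indicator_empty]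
    have h1 := g.h1one
    change g.h1 (fun _ => 1) + k.h2 0 = c.p0
    rw [h1]; simp
  frH2 := by rw [frH2', c.frV]; omega
  GG := k.GG'
  B1 := k.B1'
  B3 := k.B3'
  B4 := k.B4'
  B5 := by rw [cfg_H1, cfg_Y, cfg_Y]; exact c.top
  B6 := k.B6'
  B7 := k.B7'
  B9 := by
    intro Z Z' hZ hZ' hd hp hp'
    rw [cfg_Z _ hZ] at hp
    rw [cfg_Z _ hZ'] at hp'
    exact (c.c9 _ _ (SY_disj hd) hp hp').imp (fun h => ⟨inr_SY h.1, inr_SY h.2⟩)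
      (fun h => ⟨inr_SY h.1, inr_SY h.2⟩)
  B10 := by
    rw [cfg_H1, cfg_H2]
    rintro _ ⟨h1, s, _, rfl⟩
    obtain ⟨t, rfl⟩ := k.h2_const h1
    rw [map_smul, k.h2one]
    exact smul_mem _ _ (neg_mem (mem_span_singleton_self _))
  LP := by
    intro m Z hZ hd hf
    have h := c.cLP m (fun j => SY (Z j)) (fun j hj => by
      have := hZ j hj
      rw [cfg_Z _ this.1] at this; exact this.2) (SY_disj hd) (fun j hj => by
      have h1 := hf j hj
      rw [cfg_Z _ (hZ j (by omega)).1, cfg_Z _ (hZ (j+1) (by omega)).1] at h1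
      exact h1)
    refine ⟨h.1, fun hm => ?_⟩
    obtain ⟨ha, j, hj, hb⟩ := h.2 hm
    refine ⟨?_, j, hj, ?_⟩
    · intro y hy
      rcases y with i | y
      · exact absurd ⟨i, rfl⟩ hy
      · exact ha y
    · rw [cfg_Z _ (hZ j (by omega)).1, cfg_Z _ (hZ (j+1) (by omega)).1]
      exact hb

end Gen2
end KinserAux

set_option linter.unusedSectionVars false
set_option linter.unusedVariables false

namespace KinserAux
open Module Submodule

namespace Gen2
variable {K V Y : Type} [Field K] [AddCommGroup V] [Module K V]
  [FiniteDimensional K V] [Fintype Y] [Infinite K]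
  {c : Base K V Y} {g : Gen1 c} (k : Gen2 g)

theorem fr_glue {S T : Submodule K V} {p : V} (hp : p ≠ 0) (h1 : p ∈ S) (h2 : p ∈ T) :
    finrank K ↥(S ⊔ T) + 1 ≤ finrank K S + finrank K T := by
  have h := fr_add S T
  have h3 : finrank K (span K {p}) ≤ finrank K ↥(S ⊓ T) :=
    fr_mono (by rw [span_le]; rintro x rfl; exact ⟨h1, h2⟩)
  rw [finrank_span_singleton hp] at h3
  omega

theorem rho_out {X : Set (Gr c)} {j : ℕ} (hj : j ≤ c.N) (h : Sum.inr '' c.Ys j ⊆ X) :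
    k.cfg.rho X = finrank K (k.cfg.sp X) := by
  have hne : (c.Ys j).Nonempty := by
    by_contra hn
    rw [Set.not_nonempty_iff_eq_empty] at hn
    have := c.pY j hj
    rw [hn] at this
    exact c.p0ne (by simpa using this)
  obtain ⟨y, hy⟩ := hne
  unfold Cfg.rho
  rw [k.cfg.eps_not_sub, add_zero]
  intro hX
  have := hX (h ⟨y, hy, rfl⟩)
  simp [cfg, Hs] at this

theorem violate : KRhs k.cfg.rho (H1s c) (H2s c) (fun j => Sum.inr '' c.Ys j) c.N <
    KLhs k.cfg.rho (H1s c) (H2s c) (fun j => Sum.inr '' c.Ys j) c.N := by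
  have hHH : H1s c ∪ H2s c = Hs c := k.cfg2.hH
  have r1 : k.cfg.rho (H1s c ∪ H2s c) = c.a + c.b := by
    rw [hHH, ← c.frV]; exact k.cfg.rho_H
  have r2 : k.cfg.rho (H1s c ∪ Sum.inr '' c.Ys 0 ∪ Sum.inr '' c.Ys c.N) = c.a + c.b := by
    rw [k.rho_out (j := 0) (Nat.zero_le _)
      (Set.subset_union_right.trans Set.subset_union_left), Cfg.sp_union, Cfg.sp_union,
      cfg_H1, cfg_Y, cfg_Y]
    have := c.top
    unfold Base.spY
    rw [this, finrank_top, c.frV]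
  have r3 : ∀ j < c.N, k.cfg.rho (H2s c ∪ Sum.inr '' c.Ys j ∪ Sum.inr '' c.Ys (j+1)) = c.a + c.b := by
    intro j hj
    rw [k.rho_out (j := j) (by omega)
      (Set.subset_union_right.trans Set.subset_union_left), Cfg.sp_union, Cfg.sp_union,
      cfg_H2, cfg_Y, cfg_Y]
    obtain ⟨i⟩ := i0 c
    have hsp : c.spY (c.Ys j ∪ c.Ys (j+1)) = c.spY (c.Ys j) ⊔ c.spY (c.Ys (j+1)) := by
      unfold Base.spY; rw [Set.image_union, span_union]
    have hU := UU2_mem0 (g := g) (c.Ys j ∪ c.Ys (j+1)) ∅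
    rw [supp_empty, Submodule.map_bot, sup_bot_eq, hsp] at hU
    have h1 := k.h2b _ hU _ (compl_ne i) (by
      have hc := ncard_compl i
      have h2 := fr_add (LinearMap.ker c.L) (c.spY (c.Ys j) ⊔ c.spY (c.Ys (j+1)))
      have h3 := c.frYY j hj
      have h4 := c.frL
      have h5 := Submodule.finrank_le (LinearMap.ker c.L ⊔ (c.spY (c.Ys j) ⊔ c.spY (c.Ys (j+1))))
      rw [c.frV] at h5
      unfold Base.spY at h2 h5 ⊢
      omega)
    have hne : (c.Ys j).Nonempty := by
      by_contra hn
      rw [Set.not_nonempty_iff_eq_empty] at hn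
      have := c.pY j (by omega)
      rw [hn] at this
      exact c.p0ne (by simpa using this)
    obtain ⟨y, hy⟩ := hne
    have hy' : c.ψ y ∈ (supp K Set.univ).map k.h2 ⊔ c.spY (c.Ys j) ⊔ c.spY (c.Ys (j+1)) :=
      mem_sup_left (mem_sup_right (subset_span ⟨y, hy, rfl⟩))
    have htop : (supp K Set.univ).map k.h2 ⊔ c.spY (c.Ys j) ⊔ c.spY (c.Ys (j+1)) = ⊤ := by
      refine k.cfg.top_of_out ?_ hy' ?_
      · rw [cfg_Om]
        refine h1.trans (sup_le (sup_le (le_sup_of_le_left le_sup_right) le_sup_right) ?_)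
        exact le_sup_of_le_left (le_sup_of_le_left
          (Submodule.map_mono (supp_mono (Set.subset_univ _))))
      · rw [cfg_Om]; exact c.Ly y
    rw [htop, finrank_top, c.frV]
  have r4 : ∀ j ≤ c.N, k.cfg.rho (Sum.inr '' c.Ys j) = c.cc := by
    intro j hj
    rw [k.rho_out hj le_rfl, cfg_Y]; exact c.frY j hj
  have r5 : k.cfg.rho (H1s c ∪ Sum.inr '' c.Ys 0) + 1 + c.lam ≤ c.a + c.cc := by
    rw [k.rho_out (j := 0) (Nat.zero_le _) Set.subset_union_right, Cfg.sp_union, cfg_H1, cfg_Y]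
    exact c.frO1Y
  have r6 : k.cfg.rho (H1s c ∪ Sum.inr '' c.Ys c.N) + 1 ≤ c.a + c.cc := by
    rw [k.rho_out (j := c.N) le_rfl Set.subset_union_right, Cfg.sp_union, cfg_H1, cfg_Y]
    have := fr_glue c.p0ne c.p0O1 (c.pY c.N le_rfl)
    rw [c.frO1, c.frY _ le_rfl] at this
    exact this
  have r7 : ∀ j ≤ c.N, k.cfg.rho (H2s c ∪ Sum.inr '' c.Ys j) + 1 ≤ c.b + c.cc := by
    intro j hj
    rw [k.rho_out hj Set.subset_union_right, Cfg.sp_union, cfg_Y]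
    have h1 : c.p0 ∈ k.cfg.sp (H2s c) := by rw [cfg_H2]; exact k.p0_mem_univ
    have := fr_glue c.p0ne h1 (c.pY j hj)
    rw [k.frH2', c.frY _ hj] at this
    exact this
  have r8 : ∀ j < c.N, k.cfg.rho (Sum.inr '' c.Ys j ∪ Sum.inr '' c.Ys (j+1)) = c.a + 1 := by
    intro j hj
    rw [k.rho_out (j := j) (by omega) Set.subset_union_left, Cfg.sp_union, cfg_Y, cfg_Y]
    exact c.frYY j hj
  have t1 : ∑ j ∈ range (c.N+1), k.cfg.rho (Sum.inr '' c.Ys j) = (c.N+1) * c.cc := by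
    rw [sum_congr rfl (fun j hj => r4 j (by simpa [Nat.lt_succ_iff] using hj))]; simp
  have t2 : ∑ j ∈ range c.N, k.cfg.rho (H2s c ∪ Sum.inr '' c.Ys j ∪ Sum.inr '' c.Ys (j+1)) =
      c.N * (c.a + c.b) := by
    rw [sum_congr rfl (fun j hj => r3 j (by simpa using hj))]; simp
  have t3 : ∑ j ∈ range c.N, k.cfg.rho (Sum.inr '' c.Ys j ∪ Sum.inr '' c.Ys (j+1)) =
      c.N * (c.a + 1) := by
    rw [sum_congr rfl (fun j hj => r8 j (by simpa using hj))]; simp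
  have t4 : ∑ j ∈ range (c.N+1), k.cfg.rho (H2s c ∪ Sum.inr '' c.Ys j) + (c.N + 1) ≤
      (c.N+1) * (c.b + c.cc) := by
    have := sum_le_sum (s := range (c.N+1)) (fun j hj => r7 j (by simpa [Nat.lt_succ_iff] using hj))
    rw [sum_add_distrib] at this
    simpa using this
  unfold KLhs KRhs
  simp only [t1, t2, t3, r1, r2]
  have := c.num
  nlinarith

theorem final {n : ℕ} (hn : 5 ≤ n) (hN : c.N = n - 2) :
    k.cfg.mat.MemKinserClass n ∧ ¬ k.cfg.mat.MemKinserClass (n+1) ∧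
      ∀ P : Matroid (Gr c), P.IsProperMinorOf k.cfg.mat → P.MemKinserClass (n+1) := by
  have hr : k.cfg.mat.rnk = k.cfg.rho := funext k.cfg.mat_rnk
  refine excluded_of k.cfg.mat k.cfg.mat_E n hn ⟨H1s c, H2s c, fun j => Sum.inr '' c.Ys j, ?_⟩ ?_
  · rw [hr, ← hN]; exact k.violate
  · intro m hm A B W hv
    rw [hr] at hv
    have h := k.cfg2.main m (by rw [← hN] at hm; exact hm) A B W hv
    have hm' : m = c.N := h.1
    subst hm'
    exact ⟨hN, h.2⟩

end Gen2
end KinserAux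

set_option linter.unusedSectionVars false
set_option linter.unusedVariables false

namespace KinserAux
open Module Submodule

/-- value forced by a missing side -/
def tau (K : Type) [Field K] (b : Bool) : K := if b then 1 else 0

theorem tau_ne {K : Type} [Field K] (b : Bool) : tau K b ≠ tau K (!b) := by
  cases b <;> simp [tau]

/-- both sides of gap `i` appear in the step `j` -/
def Dbl {N : ℕ} (full : ℕ → Fin N → Bool → Prop) (j : ℕ) (i : Fin N) : Prop :=
  ∀ b, full j i b ∨ full (j+1) i b

theorem comb_LP {K : Type} [Field K] (N k : ℕ) (full : ℕ → Fin N → Bool → Prop) (T : ℕ → ℕ → K)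
    (h0 : ∀ j ≤ k, T j 0 = 0) (h1 : ∀ j ≤ k, T j (N+1) = 1)
    (h : ∀ j ≤ k, ∀ i b, ¬ full j i b → T j (i.1+1) = tau K b)
    (dis : ∀ i b, full 0 i b → full k i b → False)
    (one : ∀ j < k, ∀ i i', Dbl full j i → Dbl full j i' → i = i') :
    N ≤ k ∧ (k = N → (∀ i b, ∃ j ≤ k, full j i b) ∧ (∀ j < k, ∃ i, Dbl full j i) ∧
      ∀ s ≤ N, ∃ j ≤ k, T j (s+1) ≠ T j s) := by
  have side : ∀ j ≤ k, ∀ i b, ¬ full j i b → full j i (!b) := by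
    intro j hj i b hb
    by_contra hn
    exact tau_ne (K := K) b ((h j hj i b hb).symm.trans (h j hj i _ hn))
  have flip : ∀ i, ∃ j < k, ∃ b, full j i b ∧ ¬ full (j+1) i b := by
    intro i
    obtain ⟨b, hb⟩ : ∃ b, full 0 i b := by
      by_cases hb : full 0 i true
      · exact ⟨_, hb⟩
      · exact ⟨_, side 0 (Nat.zero_le _) i _ hb⟩
    by_contra hn
    push Not at hn
    have : ∀ j ≤ k, full j i b := by
      intro j
      induction j with
      | zero => intro _; exact hb
      | succ j ih => intro hj; exact hn j (by omega) b (ih (by omega))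
    exact dis i b hb (this k le_rfl)
  choose f hf b hb hb' using flip
  have hD : ∀ i, Dbl full (f i) i := by
    intro i b'
    by_cases e : b' = b i
    · left; rw [e]; exact hb i
    · right
      have : b' = !(b i) := by cases b' <;> cases h : b i <;> simp_all
      rw [this]
      exact side _ (hf i) i _ (hb' i)
  have inj : ∀ i i', f i = f i' → i = i' := by
    intro i i' e
    exact one (f i) (hf i) i i' (hD i) (e ▸ hD i')
  let F : Fin N → Fin k := fun i => ⟨f i, hf i⟩
  have hF : Function.Injective F := fun i i' e => inj i i' (by simpa [F] using e)
  have hNk : N ≤ k := by simpa using Fintype.card_le_of_injective F hF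
  refine ⟨hNk, ?_⟩
  rintro rfl
  have hS : Function.Surjective F := Finite.surjective_of_injective hF
  have hS' : ∀ j < k, ∃ i, f i = j := by
    intro j hj
    obtain ⟨i, hi⟩ := hS ⟨j, hj⟩
    exact ⟨i, by simpa [F] using congrArg Fin.val hi⟩
  refine ⟨?_, ?_, ?_⟩
  · intro i b'
    rcases hD i b' with h' | h'
    · exact ⟨f i, (hf i).le, h'⟩
    · exact ⟨f i + 1, hf i, h'⟩
  · intro j hj
    obtain ⟨i, rfl⟩ := hS' j hj
    exact ⟨i, hD i⟩
  · intro s hs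
    by_contra hn
    push Not at hn
    rcases Nat.eq_zero_or_pos s with rfl | hs0
    ·
      rcases Nat.eq_zero_or_pos k with rfl | hk
      · have := hn 0 le_rfl
        have e0 := h0 0 le_rfl
        have e1 := h1 0 le_rfl
        rw [e0] at this
        rw [this] at e1
        exact zero_ne_one e1
      have : ∀ j ≤ k, full j ⟨0, hk⟩ true := by
        intro j hj
        by_contra hc
        have e := h j hj _ _ hc
        have e2 := hn j hj
        rw [h0 j hj] at e2
        simp only [tau] at e
        rw [e2] at e
        simp at e
      exact dis _ _ (this 0 (Nat.zero_le _)) (this k le_rfl)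
    rcases Nat.lt_or_ge s k with hsk | hsk
    ·
      let i : Fin k := ⟨s-1, by omega⟩
      let i' : Fin k := ⟨s, hsk⟩
      have hT : ∀ j ≤ k, T j (i.1+1) = T j (i'.1+1) := by
        intro j hj
        have e : i.1 + 1 = s := by simp only [i]; omega
        rw [e]
        exact (hn j hj).symm
      have hnf : ¬ full (f i) i (!(b i)) := by
        intro hc
        have both : ∀ b', full (f i) i b' := by
          intro b'
          by_cases e : b' = b i
          · rw [e]; exact hb i
          · have : b' = !(b i) := by cases b' <;> cases h : b i <;> simp_all
            rw [this]; exact hc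
        rcases Nat.eq_zero_or_pos (f i) with e0 | e0
        · have : ∃ b', full k i b' := by
            by_cases hbk : full k i true
            · exact ⟨_, hbk⟩
            · exact ⟨_, side k le_rfl i _ hbk⟩
          obtain ⟨b', hb'⟩ := this
          exact dis i b' (e0 ▸ both b') hb'
        · have hlt := hf i
          obtain ⟨i2, hi2⟩ := hS' (f i - 1) (by omega)
          have d1 : Dbl full (f i - 1) i := by
            intro b'
            right
            rw [show f i - 1 + 1 = f i by omega]
            exact both b'
          have := one (f i - 1) (by omega) i i2 d1 (hi2 ▸ hD i2)
          rw [← this] at hi2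
          omega
      have d' : Dbl full (f i) i' := by
        intro b'
        by_cases e : b' = b i
        · left
          by_contra hc
          have e1 := h _ (hf i).le _ _ hnf
          have e2 := h _ (hf i).le _ _ hc
          rw [hT _ (hf i).le, e2, e] at e1
          exact tau_ne _ e1
        · right
          have e' : b' = !(b i) := by cases b' <;> cases h : b i <;> simp_all
          by_contra hc
          have e1 := h _ (hf i) _ _ (hb' i)
          have e2 := h _ (hf i) _ _ hc
          rw [hT _ (hf i), e2, e'] at e1
          exact tau_ne _ e1.symm
      have := one (f i) (hf i) i i' (hD i) d'
      have := congrArg Fin.val this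
      simp only [i, i'] at this
      omega
    ·
      have hsk' : s = k := le_antisymm hs hsk
      subst hsk'
      have : ∀ j ≤ s, full j ⟨s-1, by omega⟩ false := by
        intro j hj
        by_contra hc
        have e := h j hj _ _ hc
        have e2 := hn j hj
        rw [h1 j hj] at e2
        simp only [tau] at e
        rw [show s - 1 + 1 = s by omega, ← e2] at e
        simp at e
      exact dis _ _ (this 0 (Nat.zero_le _)) (this s le_rfl)

theorem comb_c9 {K : Type} [Field K] (N : ℕ) (hN : 1 ≤ N) (full full' : Fin N → Bool → Prop)
    (T T' : ℕ → K)
    (h0 : T 0 = 0) (h1 : T (N+1) = 1) (h0' : T' 0 = 0) (h1' : T' (N+1) = 1)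
    (h : ∀ i b, ¬ full i b → T (i.1+1) = tau K b)
    (h' : ∀ i b, ¬ full' i b → T' (i.1+1) = tau K b)
    (dis : ∀ i b, full i b → full' i b → False)
    (st : ∀ s ≤ N, T (s+1) = T s ∨ T' (s+1) = T' s) :
    ((∀ i, full i false) ∧ (∀ i, full' i true) ∧ T 1 ≠ T 0 ∧ T' (N+1) ≠ T' N) ∨
    ((∀ i, full i true) ∧ (∀ i, full' i false) ∧ T (N+1) ≠ T N ∧ T' 1 ≠ T' 0) := by
  have side : ∀ i b, ¬ full i b → full i (!b) := by
    intro i b hb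
    by_contra hn
    exact tau_ne (K := K) b ((h i b hb).symm.trans (h i _ hn))
  have side' : ∀ i b, ¬ full' i b → full' i (!b) := by
    intro i b hb
    by_contra hn
    exact tau_ne (K := K) b ((h' i b hb).symm.trans (h' i _ hn))
  have opp : ∀ i b, full i b → full' i (!b) := fun i b hb => side' i b (fun hc => dis i b hb hc)
  have valT : ∀ i b, full i b → T (i.1+1) = tau K (!b) := fun i b hb =>
    h i _ fun hc => dis i _ hc (opp i b hb)
  have valT' : ∀ i b, full i b → T' (i.1+1) = tau K b := fun i b hb =>
    h' i _ fun hc => dis i _ hb hc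
  obtain ⟨b, hb⟩ : ∃ b, full ⟨0, hN⟩ b := by
    by_cases hb : full ⟨0, hN⟩ true
    · exact ⟨_, hb⟩
    · exact ⟨_, side _ _ hb⟩
  have all : ∀ m, ∀ hm : m < N, full ⟨m, hm⟩ b := by
    intro m
    induction m with
    | zero => intro _; exact hb
    | succ m ih =>
      intro hm
      by_contra hc
      have f1 := ih (by omega)
      have f2 := side _ _ hc
      have a1 := valT _ _ f1
      have a2 := valT' _ _ f1
      have a3 := valT _ _ f2
      have a4 := valT' _ _ f2
      simp only [Bool.not_not] at a1 a2 a3 a4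
      rcases st (m+1) (by omega) with e | e
      · rw [a1, a3] at e; exact tau_ne _ e
      · rw [a2, a4] at e; exact tau_ne _ e.symm
  have all' : ∀ i, full i b := fun i => all i.1 i.2
  have c1 := valT _ _ (all 0 (by omega))
  have c2 := valT' _ _ (all 0 (by omega))
  have c3 := valT _ _ (all (N-1) (by omega))
  have c4 := valT' _ _ (all (N-1) (by omega))
  simp only [show N - 1 + 1 = N by omega, zero_add] at c1 c2 c3 c4
  cases b
  · left
    refine ⟨all', fun i => opp i _ (all' i), ?_, ?_⟩
    · rw [c1, h0]; simp [tau]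
    · rw [c4, h1']; simp [tau]
  · right
    refine ⟨all', fun i => opp i _ (all' i), ?_, ?_⟩
    · rw [c3, h1]; simp [tau]
    · rw [c2, h0']; simp [tau]

end KinserAux

set_option linter.unusedSectionVars false
set_option linter.unusedVariables false
set_option linter.unusedSimpArgs false

namespace KinserAux
open Module Submodule

/-- indicator of the elements lying in the `s`-th transversal -/
def mt (K : Type) [Field K] (N : ℕ) (D : Type) (s : ℕ) : Fin N × Bool × D → K :=
  fun β => if β.2.1 = decide (β.1.1 < s) then 1 else 0

/-- The parameters of the concrete construction -/
structure Par (K D : Type) [Field K] [Fintype D] [DecidableEq D] where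
  N : ℕ
  hN : 3 ≤ N
  hD : Nonempty D
  i0 : Fin N
  f : (Fin N × Bool × D → K) →ₗ[K] K
  f1 : ∀ β, f (Pi.single β 1) ≠ 0
  f2 : ∀ s : Fin (N+1), f (mt K N D s.1) ≠ 0
  emb : (D → K) →ₗ[K] (Fin N × Bool × D → K)
  emb_ap : ∀ c i b d, emb c (i, b, d) = if i = i0 ∧ b = false then c d else 0
  Lam : Submodule K (D → K)
  hLam : ∀ c ∈ Lam, f (emb c) = 0
  e : ℕ
  he : e + 1 + finrank K Lam = (N+1) * Fintype.card D

namespace Par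
variable {K D : Type} [Field K] [Fintype D] [DecidableEq D] (p : Par K D)

/-- index set of the coordinates -/
abbrev B : Type := Fin p.N × Bool × D
/-- the ambient space -/
abbrev V : Type := (p.B → K) × K × (Fin p.e → K)
/-- the labels -/
abbrev Y : Type := p.B ⊕ Fin (p.N+1)

/-- the vectors -/
def ps : p.Y → p.V
  | Sum.inl β => (Pi.single β 1, 0, 0)
  | Sum.inr s => (mt K p.N D s.1, 1, 0)

@[simp] theorem ps_inl (β : p.B) : p.ps (Sum.inl β) = (Pi.single β 1, 0, 0) := rfl
@[simp] theorem ps_inr (s : Fin (p.N+1)) : p.ps (Sum.inr s) = (mt K p.N D s.1, 1, 0) := rfl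

/-- the special point -/
def pt : p.V := (0, 1, 0)

/-- sets of labels given by full blocks and a star -/
def ZF (F : Finset (Fin p.N × Bool)) (s : Fin (p.N+1)) : Set p.Y :=
  {y | (∃ β : p.B, y = Sum.inl β ∧ (β.1, β.2.1) ∈ F) ∨ y = Sum.inr s}

/-- the transversals -/
def Yt (j : ℕ) : Set p.Y :=
  {y | (∃ β : p.B, y = Sum.inl β ∧ β.2.1 = decide (β.1.1 < j)) ∨ ∃ s, y = Sum.inr s ∧ s.1 = j}

/-- blocks of a transversal -/
def Ft (j : ℕ) : Finset (Fin p.N × Bool) := univ.image (fun i => (i, decide (i.1 < j)))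

theorem mem_Ft {j : ℕ} {i : Fin p.N} {b : Bool} : (i, b) ∈ p.Ft j ↔ b = decide (i.1 < j) := by
  simp only [Ft, mem_image, mem_univ, true_and, Prod.mk.injEq]
  constructor
  · rintro ⟨_, rfl, rfl⟩; rfl
  · rintro rfl; exact ⟨_, rfl, rfl⟩

theorem card_Ft (j : ℕ) : (p.Ft j).card = p.N := by
  rw [Ft, card_image_of_injective _ (fun i i' h => (Prod.mk.inj h).1)]
  simp

theorem Yt_eq {j : ℕ} (hj : j ≤ p.N) : p.Yt j = p.ZF (p.Ft j) ⟨j, by omega⟩ := by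
  ext y
  simp only [Yt, ZF, Set.mem_ofPred_eq, mem_Ft]
  refine or_congr Iff.rfl ⟨?_, ?_⟩
  · rintro ⟨s, rfl, rfl⟩; rfl
  · rintro rfl; exact ⟨_, rfl, rfl⟩

theorem mem_of_single {U : Submodule K p.V} (v : p.B → K)
    (h : ∀ β, v β ≠ 0 → ((Pi.single β 1, 0, 0) : p.V) ∈ U) : ((v, 0, 0) : p.V) ∈ U := by
  have e : ((v, 0, 0) : p.V) = ∑ β, v β • ((Pi.single β 1, 0, 0) : p.V) := by
    ext x
    · simp [Prod.fst_sum, Finset.sum_apply, Pi.single_apply]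
    · simp [Prod.snd_sum, Prod.fst_sum]
    · simp [Prod.snd_sum, Prod.fst_sum]
  rw [e]
  refine sum_mem fun β _ => ?_
  by_cases hb : v β = 0
  · simp [hb]
  · exact smul_mem _ _ (h β hb)

theorem mt_mem {U : Submodule K p.V} (s : ℕ)
    (h : ∀ β : p.B, β.2.1 = decide (β.1.1 < s) → ((Pi.single β 1, 0, 0) : p.V) ∈ U) :
    ((mt K p.N D s, 0, 0) : p.V) ∈ U := by
  refine p.mem_of_single _ fun β hb => h β ?_
  by_contra hn
  exact hb (by simp [mt, hn])

theorem pt_mem {j : ℕ} (hj : j ≤ p.N) : p.pt ∈ span K (p.ps '' p.Yt j) := by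
  have h1 : ((mt K p.N D j, 0, 0) : p.V) ∈ span K (p.ps '' p.Yt j) :=
    p.mt_mem j fun β hb => subset_span ⟨Sum.inl β, Or.inl ⟨β, rfl, hb⟩, rfl⟩
  have h2 : ((mt K p.N D j, 1, 0) : p.V) ∈ span K (p.ps '' p.Yt j) :=
    subset_span ⟨Sum.inr ⟨j, by omega⟩, Or.inr ⟨_, rfl, rfl⟩, rfl⟩
  have := sub_mem h2 h1
  simpa [pt] using this

theorem star_mem {U : Submodule K p.V} (s : Fin (p.N+1)) (hp : p.pt ∈ U)
    (h : ∀ β : p.B, β.2.1 = decide (β.1.1 < s.1) → ((Pi.single β 1, 0, 0) : p.V) ∈ U) :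
    p.ps (Sum.inr s) ∈ U := by
  have := add_mem hp (p.mt_mem s.1 h)
  simpa [pt] using this

theorem li (s : Fin (p.N+1)) :
    LinearIndependent K (fun o : Option p.B => p.ps (o.elim (Sum.inr s) Sum.inl)) := by
  rw [Fintype.linearIndependent_iff]
  intro g hg
  rw [Fintype.sum_option] at hg
  have h1 := congrArg (fun x : p.V => x.2.1) hg
  simp [Prod.snd_sum, Prod.fst_sum] at h1
  have h2 := congrArg (fun x : p.V => x.1) hg
  simp [h1, Prod.fst_sum] at h2
  intro o
  cases o with
  | none => exact h1
  | some β =>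
    have := congrFun h2 β
    simpa [Finset.sum_apply, Pi.single_apply] using this

theorem frT (F : Finset (Fin p.N × Bool)) (s : Fin (p.N+1)) :
    finrank K (span K (p.ps '' p.ZF F s)) = F.card * Fintype.card D + 1 := by
  classical
  let S : Finset (Option p.B) :=
    insertNone ((F ×ˢ (univ : Finset D)).map (Equiv.prodAssoc _ _ _).toEmbedding)
  have hS : S.card = F.card * Fintype.card D + 1 := by
    rw [card_insertNone, card_map, card_product, card_univ]
  have h1 := (p.li s).linearIndepOn (s := (S : Set (Option p.B)))
  have h2 := finrank_span_eq_card h1.linearIndependent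
  have h3 : p.ps '' p.ZF F s =
      Set.range (fun x : (S : Set (Option p.B)) => p.ps (x.1.elim (Sum.inr s) Sum.inl)) := by
    ext v
    constructor
    · rintro ⟨y, (⟨β, rfl, hb⟩ | rfl), rfl⟩
      · refine ⟨⟨some β, ?_⟩, rfl⟩
        obtain ⟨i, b, d⟩ := β
        simpa [S] using hb
      · exact ⟨⟨none, by simp [S]⟩, rfl⟩
    · rintro ⟨⟨o, ho⟩, rfl⟩
      cases o with
      | none => exact ⟨Sum.inr s, Or.inr rfl, rfl⟩
      | some β =>
        refine ⟨Sum.inl β, Or.inl ⟨β, rfl, ?_⟩, rfl⟩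
        obtain ⟨i, b, d⟩ := β
        simpa [S] using ho
  rw [h3, h2, ← hS]
  simp

theorem data {Z : Set p.Y} {x : p.V} (hx : x ∈ span K (p.ps '' Z)) :
    x.2.2 = 0 ∧ ∃ T : ℕ → K, T 0 = 0 ∧ T (p.N+1) = x.2.1 ∧
      (∀ s, Sum.inr s ∉ Z → T (s.1+1) = T s.1) ∧
      (∀ i d, Sum.inl (i, false, d) ∉ Z → x.1 (i, false, d) = T (i.1+1)) ∧
      (∀ i d, Sum.inl (i, true, d) ∉ Z → x.1 (i, true, d) = T (p.N+1) - T (i.1+1)) := by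
  induction hx using span_induction with
  | mem x h =>
    obtain ⟨y, hy, rfl⟩ := h
    cases y with
    | inl β =>
      refine ⟨rfl, fun _ => 0, rfl, rfl, fun _ _ => rfl, fun i d h => ?_, fun i d h => ?_⟩
      · have : (i, false, d) ≠ β := fun e => h (e ▸ hy)
        simp [Pi.single_apply, this]
      · have : (i, true, d) ≠ β := fun e => h (e ▸ hy)
        simp [Pi.single_apply, this]
    | inr s =>
      refine ⟨rfl, fun j => if s.1 < j then 1 else 0, by simp, ?_, fun s' h => ?_,
        fun i d h => ?_, fun i d h => ?_⟩
      · simp [Nat.lt_succ_iff.mp s.2]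
      · have : s' ≠ s := fun e => h (e ▸ hy)
        have : s'.1 ≠ s.1 := fun e => this (Fin.ext e)
        have e : (s.1 < s'.1 + 1) = (s.1 < s'.1) := by
          apply propext; omega
        simp only [e]
      · simp [mt, Nat.lt_succ_iff]
      · have hs := Nat.lt_succ_iff.mp s.2
        simp only [ps_inr, mt]
        by_cases h : i.1 < s.1
        · simp [h, hs, Nat.not_le.mpr h]
        · simp [h, hs, Nat.not_lt.mp h]
  | zero => exact ⟨rfl, fun _ => 0, rfl, rfl, fun _ _ => rfl, by simp, by simp⟩
  | add x y _ _ hx hy =>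
    obtain ⟨x0, T, a1, a2, a3, a4, a5⟩ := hx
    obtain ⟨y0, T', b1, b2, b3, b4, b5⟩ := hy
    refine ⟨by simp [x0, y0], T + T', by simp [a1, b1], by simp [a2, b2], fun s h => ?_,
      fun i d h => ?_, fun i d h => ?_⟩
    · simp [a3 s h, b3 s h]
    · simp [a4 i d h, b4 i d h]
    · simp [a5 i d h, b5 i d h]; ring
  | smul t x _ hx =>
    obtain ⟨x0, T, a1, a2, a3, a4, a5⟩ := hx
    refine ⟨by simp [x0], t • T, by simp [a1], by simp [a2], fun s h => ?_,
      fun i d h => ?_, fun i d h => ?_⟩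
    · simp [a3 s h]
    · simp [a4 i d h]
    · simp [a5 i d h]; ring

/-- a block is contained in `Z` -/
def full (Z : Set p.Y) (i : Fin p.N) (b : Bool) : Prop := ∀ d, Sum.inl (i, b, d) ∈ Z

theorem ptdata {Z : Set p.Y} (hx : p.pt ∈ span K (p.ps '' Z)) :
    ∃ T : ℕ → K, T 0 = 0 ∧ T (p.N+1) = 1 ∧
      (∀ s, Sum.inr s ∉ Z → T (s.1+1) = T s.1) ∧
      (∀ i b, ¬ p.full Z i b → T (i.1+1) = tau K b) := by
  obtain ⟨_, T, a1, a2, a3, a4, a5⟩ := p.data hx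
  refine ⟨T, a1, a2, a3, fun i b h => ?_⟩
  unfold full at h
  push Not at h
  obtain ⟨d, hd⟩ := h
  cases b with
  | false => 
    have := a4 i d hd
    simpa [pt, tau] using this.symm
  | true =>
    have := a5 i d hd
    rw [a2] at this
    simp only [pt, Pi.zero_apply] at this
    simp only [tau, if_true]
    linear_combination this

theorem star_ex {Z : Set p.Y} (hx : p.pt ∈ span K (p.ps '' Z)) : ∃ s, Sum.inr s ∈ Z := by
  obtain ⟨T, h0, h1, hs, _⟩ := p.ptdata hx
  by_contra hn
  push Not at hn
  have : ∀ j ≤ p.N + 1, T j = 0 := by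
    intro j
    induction j with
    | zero => intro _; exact h0
    | succ j ih =>
      intro hj
      have := hs ⟨j, by omega⟩ (hn _)
      rw [this]; exact ih (by omega)
  have := this _ le_rfl
  rw [h1] at this
  exact one_ne_zero this

theorem side {Z : Set p.Y} (hx : p.pt ∈ span K (p.ps '' Z)) (i : Fin p.N) :
    ∃ b, p.full Z i b := by
  obtain ⟨T, h0, h1, hs, h⟩ := p.ptdata hx
  by_contra hn
  push Not at hn
  exact tau_ne (K := K) false ((h i _ (hn _)).symm.trans (h i _ (hn _)))

theorem fr_ge {Z : Set p.Y} {F : Finset (Fin p.N × Bool)} (hF : ∀ i b, (i, b) ∈ F → p.full Z i b)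
    {s : Fin (p.N+1)} (hs : Sum.inr s ∈ Z) {U : Submodule K p.V} (hU : span K (p.ps '' Z) ≤ U) :
    F.card * Fintype.card D + 1 ≤ finrank K U := by
  rw [← p.frT F s]
  refine finrank_mono ((span_mono (Set.image_mono ?_)).trans hU)
  rintro y (⟨⟨i, b, d⟩, rfl, hb⟩ | rfl)
  · exact hF i b hb d
  · exact hs

end Par
end KinserAux

set_option linter.unusedSectionVars false
set_option linter.unusedVariables false
set_option linter.unusedSimpArgs false

namespace KinserAux
open Module Submodule

namespace Par
variable {K D : Type} [Field K] [Fintype D] [DecidableEq D] (p : Par K D)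

/-- restriction to the lower blocks -/
def mask : (p.B → K) →ₗ[K] (p.B → K) :=
  LinearMap.pi fun β => if β.2.1 then 0 else LinearMap.proj β

theorem mask_ap (v : p.B → K) (β : p.B) : p.mask v β = if β.2.1 then 0 else v β := by
  simp only [mask, LinearMap.pi_apply]
  split_ifs <;> simp

theorem mask_self {v : p.B → K} (h : ∀ β, β.2.1 = true → v β = 0) : p.mask v = v := by
  ext β
  rw [mask_ap]
  split_ifs with hb
  · exact (h β hb).symm
  · rfl

theorem mask_zero {v : p.B → K} (h : ∀ β, β.2.1 = false → v β = 0) : p.mask v = 0 := by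
  ext β
  rw [mask_ap]
  split_ifs with hb
  · rfl
  · exact h β (by simpa using hb)

/-- the first functional -/
def L : p.V →ₗ[K] K := p.f ∘ₗ LinearMap.fst K _ _
/-- the second functional -/
def L0 : p.V →ₗ[K] K := p.f ∘ₗ p.mask ∘ₗ LinearMap.fst K _ _

theorem L_ap (x : p.V) : p.L x = p.f x.1 := rfl
theorem L0_ap (x : p.V) : p.L0 x = p.f (p.mask x.1) := rfl

/-- parametrisation of the first special subspace -/
def o1 : (p.Lam × K × (Fin p.e → K)) →ₗ[K] p.V :=
  (p.emb ∘ₗ p.Lam.subtype).prodMap LinearMap.id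

theorem o1_ap (c : p.Lam) (z : K × (Fin p.e → K)) : p.o1 (c, z) = (p.emb c.1, z) := rfl

theorem emb_inj {c : D → K} (h : p.emb c = 0) : c = 0 := by
  ext d
  have := congrFun h (p.i0, false, d)
  rw [p.emb_ap] at this
  simpa using this

theorem o1_inj : Function.Injective p.o1 := by
  rw [← LinearMap.ker_eq_bot, LinearMap.ker_eq_bot']
  rintro ⟨c, z⟩ h
  rw [o1_ap] at h
  have h1 := p.emb_inj (Prod.mk.inj h).1
  have h2 := (Prod.mk.inj h).2
  ext1
  · exact Subtype.ext h1
  · exact h2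

/-- the first special subspace -/
def O1 : Submodule K p.V := LinearMap.range p.o1

theorem mem_O1 {x : p.V} : x ∈ p.O1 ↔ ∃ c ∈ p.Lam, x.1 = p.emb c := by
  constructor
  · rintro ⟨⟨c, z⟩, rfl⟩
    exact ⟨c.1, c.2, rfl⟩
  · rintro ⟨c, hc, h⟩
    exact ⟨(⟨c, hc⟩, x.2), by rw [o1_ap, ← h]⟩

theorem frO1 : finrank K p.O1 = (p.N+1) * Fintype.card D := by
  rw [O1, LinearMap.finrank_range_of_inj p.o1_inj, finrank_prod, finrank_prod, finrank_self,
    finrank_fintype_fun_eq_card, Fintype.card_fin, ← p.he]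
  ring

theorem frV : finrank K p.V + finrank K p.Lam = (p.N+1) * Fintype.card D + 2 * (p.N * Fintype.card D) := by
  rw [finrank_prod, finrank_prod, finrank_self, finrank_fintype_fun_eq_card,
    finrank_fintype_fun_eq_card, Fintype.card_fin, Fintype.card_prod, Fintype.card_prod,
    Fintype.card_fin, Fintype.card_bool, ← p.he]
  ring

theorem lam_le : finrank K p.Lam ≤ Fintype.card D := by
  have := finrank_le p.Lam
  rwa [finrank_fintype_fun_eq_card] at this

theorem D1 (p : Par K D) : 1 ≤ Fintype.card D := by
  have := p.hD
  exact Fintype.card_pos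

theorem O1L : p.O1 ≤ LinearMap.ker p.L := by
  intro x hx
  obtain ⟨c, hc, h⟩ := p.mem_O1.mp hx
  rw [LinearMap.mem_ker, L_ap, h, p.hLam c hc]

theorem L0O1 : p.O1 ≤ LinearMap.ker p.L0 := by
  intro x hx
  obtain ⟨c, hc, h⟩ := p.mem_O1.mp hx
  rw [LinearMap.mem_ker, L0_ap, h, mask_self, p.hLam c hc]
  rintro ⟨i, b, d⟩ hb
  rw [p.emb_ap, if_neg]
  rintro ⟨_, h⟩
  simp [h] at hb

theorem L00 : ∀ x ∈ span K (p.ps '' p.Yt 0), p.L0 x = p.L x := by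
  intro x hx
  induction hx using span_induction with
  | mem x h =>
    rw [L0_ap, L_ap, mask_self]
    obtain ⟨y, (⟨β, rfl, hb⟩ | ⟨s, rfl, hs⟩), rfl⟩ := h
    · intro β' h'
      have : β' ≠ β := by rintro rfl; simp [h'] at hb
      simp [Pi.single_apply, this]
    · intro β' h'
      simp [mt, hs, h']
  | zero => simp
  | add x y _ _ hx hy => simp [hx, hy]
  | smul t x _ hx => simp [hx]

theorem L0N : ∀ x ∈ span K (p.ps '' p.Yt p.N), p.L0 x = 0 := by
  intro x hx
  induction hx using span_induction with
  | mem x h =>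
    rw [L0_ap, mask_zero, map_zero]
    obtain ⟨y, (⟨β, rfl, hb⟩ | ⟨s, rfl, hs⟩), rfl⟩ := h
    · intro β' h'
      have : β' ≠ β := by rintro rfl; simp [h'] at hb
      simp [Pi.single_apply, this]
    · intro β' h'
      simp [mt, hs, h']
  | zero => simp
  | add x y _ _ hx hy => simp [hx, hy]
  | smul t x _ hx => simp [hx]

/-- balanced differences -/
def zv (q : p.B × p.B) : p.V :=
  (p.f (Pi.single q.1 1))⁻¹ • p.ps (Sum.inl q.1) - (p.f (Pi.single q.2 1))⁻¹ • p.ps (Sum.inl q.2)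

theorem zv_L (q : p.B × p.B) : p.L (p.zv q) = 0 := by
  simp [zv, L_ap, p.f1]

theorem zv_mem {q : p.B × p.B} {Z : Set p.Y} (h1 : Sum.inl q.1 ∈ Z) (h2 : Sum.inl q.2 ∈ Z) :
    p.zv q ∈ span K (p.ps '' Z) :=
  sub_mem (smul_mem _ _ (subset_span ⟨_, h1, rfl⟩)) (smul_mem _ _ (subset_span ⟨_, h2, rfl⟩))

theorem zz : ∃ z ∈ span K (p.ps '' Set.univ), p.L z = 0 ∧ p.L0 z ≠ 0 := by
  obtain ⟨d⟩ := p.hD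
  refine ⟨p.zv ((p.i0, false, d), (p.i0, true, d)), p.zv_mem trivial trivial, p.zv_L _, ?_⟩
  have h1 : p.mask (Pi.single (p.i0, false, d) 1) = Pi.single (p.i0, false, d) 1 := by
    refine p.mask_self fun β hb => ?_
    have : β ≠ (p.i0, false, d) := by rintro rfl; simp at hb
    simp [Pi.single_apply, this]
  have h2 : p.mask (Pi.single (p.i0, true, d) 1) = 0 := by
    refine p.mask_zero fun β hb => ?_
    have : β ≠ (p.i0, true, d) := by rintro rfl; simp at hb
    simp [Pi.single_apply, this]
  rw [L0_ap]
  simp [zv, h1, h2, p.f1]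

theorem inl_mem (β : p.B) : ((Pi.single β 1, 0, 0) : p.V) ∈
    span K (p.ps '' p.Yt 0) ⊔ span K (p.ps '' p.Yt p.N) := by
  cases hb : β.2.1 with
  | false =>
    exact mem_sup_left (subset_span ⟨Sum.inl β, Or.inl ⟨β, rfl, by simp [hb]⟩, rfl⟩)
  | true =>
    exact mem_sup_right (subset_span ⟨Sum.inl β, Or.inl ⟨β, rfl, by simp [hb]⟩, rfl⟩)

theorem spYY : span K (p.ps '' Set.univ) ≤ span K (p.ps '' p.Yt 0) ⊔ span K (p.ps '' p.Yt p.N) := by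
  rw [span_le]
  rintro _ ⟨y, _, rfl⟩
  cases y with
  | inl β => exact p.inl_mem β
  | inr s =>
    exact p.star_mem s (mem_sup_left (p.pt_mem (Nat.zero_le _))) fun β _ => p.inl_mem β

theorem top : p.O1 ⊔ span K (p.ps '' p.Yt 0) ⊔ span K (p.ps '' p.Yt p.N) = ⊤ := by
  rw [eq_top_iff, sup_assoc]
  rintro ⟨v, z⟩ _
  have h1 : ((0, z) : p.V) ∈ p.O1 := p.mem_O1.mpr ⟨0, zero_mem _, by simp⟩
  have h2 := p.mem_of_single v fun β _ => p.inl_mem β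
  have := add_mem (mem_sup_left (T := span K (p.ps '' p.Yt 0) ⊔ span K (p.ps '' p.Yt p.N)) h1)
    (mem_sup_right (S := p.O1) h2)
  have e : ((0, z) : p.V) + (v, 0, 0) = (v, z) := by ext <;> simp
  rwa [e] at this

theorem fr_ker (U : Submodule K p.V) (l : p.V →ₗ[K] K) :
    finrank K U ≤ finrank K ↥(U ⊓ LinearMap.ker l) + 1 := by
  have h1 := Submodule.finrank_sup_add_finrank_inf_eq U (LinearMap.ker l)
  have h2 := l.finrank_range_add_finrank_ker
  have h3 := finrank_le (LinearMap.range l)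
  have h4 := finrank_le (U ⊔ LinearMap.ker l)
  rw [finrank_self] at h3
  omega

theorem fr3 : (p.N+1) * Fintype.card D ≤
    finrank K ↥(span K (p.ps '' Set.univ) ⊓ LinearMap.ker p.L ⊓ LinearMap.ker p.L0) := by
  have h1 := p.fr_ker (span K (p.ps '' Set.univ)) p.L
  have h2 := p.fr_ker (span K (p.ps '' Set.univ) ⊓ LinearMap.ker p.L) p.L0
  have h3 := p.fr_ge (Z := Set.univ) (F := univ) (fun _ _ _ _ => trivial) (s := 0) trivial le_rfl
  simp only [card_univ, Fintype.card_prod, Fintype.card_bool, Fintype.card_fin] at h3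
  have h4 := p.D1
  have h5 := p.hN
  nlinarith

theorem c6 (Z : Set p.Y) (h : p.pt ∈ span K (p.ps '' Z)) :
    ∃ z ∈ Set.range p.zv, z ∈ span K (p.ps '' Z) ∧ p.L z = 0 ∧ z ∉ p.O1 := by
  obtain ⟨d⟩ := p.hD
  have := p.hN
  obtain ⟨i1, hi1⟩ : ∃ i1 : Fin p.N, i1 ≠ p.i0 := by
    have : Nontrivial (Fin p.N) := Fin.nontrivial_iff_two_le.mpr (by omega)
    exact exists_ne _
  obtain ⟨b1, hb1⟩ := p.side h i1
  obtain ⟨b0, hb0⟩ := p.side h p.i0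
  refine ⟨_, ⟨((i1, b1, d), (p.i0, b0, d)), rfl⟩, p.zv_mem (hb1 d) (hb0 d), p.zv_L _, ?_⟩
  intro hO
  obtain ⟨c, hc, h⟩ := p.mem_O1.mp hO
  have := congrFun h (i1, b1, d)
  rw [p.emb_ap, if_neg (fun h => hi1 h.1)] at this
  have h2 : ((p.i0, b0, d) : p.B) ≠ (i1, b1, d) := fun e => hi1 (Prod.mk.inj e).1.symm
  simp [zv, Pi.single_apply, h2.symm, p.f1] at this

theorem c7 : ¬ p.O1 ≤ span K (p.ps '' Set.univ) := by
  intro h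
  have h1 := p.D1
  have h2 := p.hN
  have h3 := p.lam_le
  have h4 := p.he
  have he : 0 < p.e := by nlinarith
  have hm : ((0, 0, fun _ => 1) : p.V) ∈ p.O1 := p.mem_O1.mpr ⟨0, zero_mem _, by simp⟩
  have := (p.data (h hm)).1
  have := congrFun this ⟨0, he⟩
  simp at this

theorem Yt0_sub {Z : Set p.Y} (h : ∀ i, p.full Z i false) (hs : Sum.inr 0 ∈ Z) : p.Yt 0 ⊆ Z := by
  rintro y (⟨⟨i, b, d⟩, rfl, hb⟩ | ⟨s, rfl, hs'⟩)
  · have : b = false := by simpa using hb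
    subst this
    exact h i d
  · have : s = 0 := Fin.ext hs'
    rw [this]; exact hs

theorem YtN_sub {Z : Set p.Y} (h : ∀ i, p.full Z i true) (hs : Sum.inr (Fin.last p.N) ∈ Z) :
    p.Yt p.N ⊆ Z := by
  rintro y (⟨⟨i, b, d⟩, rfl, hb⟩ | ⟨s, rfl, hs'⟩)
  · have : b = true := by simpa using hb
    subst this
    exact h i d
  · have : s = Fin.last p.N := Fin.ext hs'
    rw [this]; exact hs

theorem c9 (Z Z' : Set p.Y) (hd : Disjoint Z Z') (h : p.pt ∈ span K (p.ps '' Z))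
    (h' : p.pt ∈ span K (p.ps '' Z')) :
    (p.Yt 0 ⊆ Z ∧ p.Yt p.N ⊆ Z') ∨ (p.Yt p.N ⊆ Z ∧ p.Yt 0 ⊆ Z') := by
  obtain ⟨T, a0, a1, a2, a3⟩ := p.ptdata h
  obtain ⟨T', b0, b1, b2, b3⟩ := p.ptdata h'
  obtain ⟨d⟩ := p.hD
  rw [Set.disjoint_left] at hd
  have hN := p.hN
  have k0 : T 1 ≠ T 0 → Sum.inr 0 ∈ Z := fun hn => by
    by_contra hc; exact hn (a2 0 hc)
  have k0' : T' 1 ≠ T' 0 → Sum.inr 0 ∈ Z' := fun hn => by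
    by_contra hc; exact hn (b2 0 hc)
  have kN : T (p.N+1) ≠ T p.N → Sum.inr (Fin.last p.N) ∈ Z := fun hn => by
    by_contra hc; exact hn (a2 (Fin.last _) hc)
  have kN' : T' (p.N+1) ≠ T' p.N → Sum.inr (Fin.last p.N) ∈ Z' := fun hn => by
    by_contra hc; exact hn (b2 (Fin.last _) hc)
  rcases comb_c9 p.N (by omega) (p.full Z) (p.full Z') T T' a0 a1 b0 b1 a3 b3
    (fun i b x y => hd (x d) (y d)) (fun s hs => by
      by_cases hc : Sum.inr ⟨s, by omega⟩ ∈ Z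
      · exact Or.inr (b2 ⟨s, by omega⟩ (hd hc))
      · exact Or.inl (a2 ⟨s, by omega⟩ hc)) with ⟨u1, u2, u3, u4⟩ | ⟨u1, u2, u3, u4⟩
  · exact Or.inl ⟨p.Yt0_sub u1 (k0 u3), p.YtN_sub u2 (kN' u4)⟩
  · exact Or.inr ⟨p.YtN_sub u1 (kN u3), p.Yt0_sub u2 (k0' u4)⟩

theorem cLP (k : ℕ) (Z : ℕ → Set p.Y) (hp : ∀ j ≤ k, p.pt ∈ span K (p.ps '' Z j))
    (hd : Disjoint (Z 0) (Z k))
    (hr : ∀ j < k, finrank K ↥(span K (p.ps '' Z j) ⊔ span K (p.ps '' Z (j+1))) ≤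
      (p.N+1) * Fintype.card D + 1) :
    p.N ≤ k ∧ (k = p.N → (∀ y, ∃ j ≤ k, y ∈ Z j) ∧
      ∃ j < k, (p.N+1) * Fintype.card D + 1 ≤
        finrank K ↥(span K (p.ps '' Z j) ⊔ span K (p.ps '' Z (j+1)))) := by
  classical
  have hN := p.hN
  have hD := p.D1
  have hdata : ∀ j, ∃ T : ℕ → K, j ≤ k → (T 0 = 0 ∧ T (p.N+1) = 1 ∧
      (∀ s, Sum.inr s ∉ Z j → T (s.1+1) = T s.1) ∧
      (∀ i b, ¬ p.full (Z j) i b → T (i.1+1) = tau K b)) := by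
    intro j
    by_cases hj : j ≤ k
    · obtain ⟨T, hT⟩ := p.ptdata (hp j hj)
      exact ⟨T, fun _ => hT⟩
    · exact ⟨0, fun h => absurd h hj⟩
  choose T hT using hdata
  have lb : ∀ j < k, ∀ S : Finset (Fin p.N), (∀ i ∈ S, Dbl (fun j => p.full (Z j)) j i) →
      (p.N + S.card) * Fintype.card D + 1 ≤
        finrank K ↥(span K (p.ps '' Z j) ⊔ span K (p.ps '' Z (j+1))) := by
    intro j hj S hS
    choose b hb using p.side (hp j hj.le)
    obtain ⟨s, hs⟩ := p.star_ex (hp j hj.le)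
    let F : Finset (Fin p.N × Bool) := univ.image (fun i => (i, b i)) ∪ S.image (fun i => (i, !(b i)))
    have hF : F.card = p.N + S.card := by
      rw [card_union_of_disjoint, card_image_of_injective _ (fun i i' h => (Prod.mk.inj h).1),
        card_image_of_injective _ (fun i i' h => (Prod.mk.inj h).1)]
      · simp
      · rw [Finset.disjoint_left]
        intro x hx hx'
        simp only [mem_image, mem_univ, true_and] at hx hx'
        obtain ⟨i, rfl⟩ := hx
        obtain ⟨i', _, h⟩ := hx'
        obtain ⟨rfl, h2⟩ := Prod.mk.inj h
        simp at h2
    have hU : span K (p.ps '' (Z j ∪ Z (j+1))) ≤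
        span K (p.ps '' Z j) ⊔ span K (p.ps '' Z (j+1)) := by
      rw [Set.image_union, span_union]
    rw [← hF]
    refine p.fr_ge ?_ (s := s) (Or.inl hs) hU
    intro i b' hi
    have : p.full (Z j) i b' ∨ p.full (Z (j+1)) i b' := by
      simp only [F, mem_union, mem_image, mem_univ, true_and] at hi
      rcases hi with ⟨i', h⟩ | ⟨i', hi', h⟩
      · obtain ⟨rfl, rfl⟩ := Prod.mk.inj h
        exact Or.inl (hb _)
      · obtain ⟨rfl, rfl⟩ := Prod.mk.inj h
        exact hS _ hi' _
    intro d
    rcases this with h | h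
    · exact Or.inl (h d)
    · exact Or.inr (h d)
  obtain ⟨d0⟩ := p.hD
  rw [Set.disjoint_left] at hd
  have key := comb_LP (K := K) p.N k (fun j => p.full (Z j)) T (fun j hj => (hT j hj).1)
    (fun j hj => (hT j hj).2.1) (fun j hj => (hT j hj).2.2.2)
    (fun i b x y => hd (x d0) (y d0)) (by
      intro j hj i i' hi hi'
      by_contra hne
      have h1 := lb j hj {i, i'} (by
        intro x hx
        simp only [mem_insert, mem_singleton] at hx
        rcases hx with rfl | rfl
        · exact hi
        · exact hi')
      rw [card_pair hne] at h1
      have h2 := hr j hj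
      nlinarith)
  refine ⟨key.1, fun hk => ?_⟩
  obtain ⟨k1, k2, k3⟩ := key.2 hk
  refine ⟨?_, ?_⟩
  · rintro (⟨i, b, d⟩ | s)
    · obtain ⟨j, hj, h⟩ := k1 i b
      exact ⟨j, hj, h d⟩
    · obtain ⟨j, hj, h⟩ := k3 s.1 (by omega)
      refine ⟨j, hj, ?_⟩
      by_contra hc
      exact h ((hT j hj).2.2.1 s hc)
  · obtain ⟨i, hi⟩ := k2 0 (by omega)
    refine ⟨0, by omega, ?_⟩
    have := lb 0 (by omega) {i} (by simpa using hi)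
    simpa using this

theorem frY {j : ℕ} (hj : j ≤ p.N) :
    finrank K (span K (p.ps '' p.Yt j)) = p.N * Fintype.card D + 1 := by
  rw [p.Yt_eq hj, frT, card_Ft]

theorem frYY {j : ℕ} (hj : j < p.N) :
    finrank K ↥(span K (p.ps '' p.Yt j) ⊔ span K (p.ps '' p.Yt (j+1))) =
      (p.N+1) * Fintype.card D + 1 := by
  have hc : (insert ((⟨j, hj⟩ : Fin p.N), true) (p.Ft j)).card = p.N + 1 := by
    rw [card_insert_of_notMem, card_Ft]
    rw [mem_Ft]; simp
  rw [← hc, ← p.frT _ ⟨j, by omega⟩]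
  have e : span K (p.ps '' p.Yt j) ⊔ span K (p.ps '' p.Yt (j+1)) =
      span K (p.ps '' p.ZF (insert ((⟨j, hj⟩ : Fin p.N), true) (p.Ft j)) ⟨j, by omega⟩) := by
    have s1 : p.Yt j ⊆ p.ZF (insert ((⟨j, hj⟩ : Fin p.N), true) (p.Ft j)) ⟨j, by omega⟩ := by
      rw [p.Yt_eq hj.le]
      rintro y (⟨β, rfl, hb⟩ | rfl)
      · exact Or.inl ⟨β, rfl, mem_insert_of_mem hb⟩
      · exact Or.inr rfl
    have s2 : ∀ β : p.B, β.2.1 = decide (β.1.1 < j+1) → ((Pi.single β 1, 0, 0) : p.V) ∈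
        span K (p.ps '' p.ZF (insert ((⟨j, hj⟩ : Fin p.N), true) (p.Ft j)) ⟨j, by omega⟩) := by
      rintro ⟨i, b, d⟩ hb
      refine subset_span ⟨Sum.inl (i, b, d), Or.inl ⟨_, rfl, ?_⟩, rfl⟩
      simp only at hb ⊢
      rw [mem_insert, mem_Ft]
      by_cases hi : i.1 = j
      · left
        simp [hb, hi]
        exact Fin.ext hi
      · right
        rw [hb]
        congr 1
        apply propext
        omega
    apply le_antisymm
    · refine sup_le (span_mono (Set.image_mono s1)) ?_
      rw [span_le]
      rintro _ ⟨y, (⟨β, rfl, hb⟩ | ⟨s, rfl, hs⟩), rfl⟩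
      · exact s2 β hb
      · exact p.star_mem s (span_mono (Set.image_mono s1) (p.pt_mem hj.le))
          (by rw [hs]; exact s2)
    · rw [span_le]
      rintro _ ⟨y, (⟨⟨i, b, d⟩, rfl, hb⟩ | rfl), rfl⟩
      · rw [mem_insert, mem_Ft] at hb
        rcases hb with h | h
        · obtain ⟨rfl, rfl⟩ := Prod.mk.inj h
          exact mem_sup_right (subset_span ⟨_, Or.inl ⟨_, rfl, by simp⟩, rfl⟩)
        · exact mem_sup_left (subset_span ⟨_, Or.inl ⟨_, rfl, h⟩, rfl⟩)
      · exact mem_sup_left (subset_span ⟨_, Or.inr ⟨_, rfl, rfl⟩, rfl⟩)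
  rw [e]

theorem frO1Y : finrank K ↥(p.O1 ⊔ span K (p.ps '' p.Yt 0)) + 1 + finrank K p.Lam ≤
    (p.N+1) * Fintype.card D + (p.N * Fintype.card D + 1) := by
  have h1 := Submodule.finrank_sup_add_finrank_inf_eq p.O1 (span K (p.ps '' p.Yt 0))
  rw [p.frO1, p.frY (Nat.zero_le _)] at h1
  let g : (p.Lam × K) →ₗ[K] p.V := p.o1 ∘ₗ LinearMap.id.prodMap (LinearMap.inl K K (Fin p.e → K))
  have hg : ∀ c t, g (c, t) = (p.emb c.1, t, 0) := fun c t => rfl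
  have hinj : Function.Injective g := by
    refine p.o1_inj.comp ?_
    rintro ⟨c, t⟩ ⟨c', t'⟩ h
    simpa using h
  have h2 := LinearMap.finrank_range_of_inj hinj
  rw [finrank_prod, finrank_self] at h2
  have h3 : LinearMap.range g ≤ p.O1 ⊓ span K (p.ps '' p.Yt 0) := by
    rintro _ ⟨⟨c, t⟩, rfl⟩
    rw [hg]
    refine ⟨p.mem_O1.mpr ⟨c.1, c.2, rfl⟩, ?_⟩
    have k1 : ((p.emb c.1, 0, 0) : p.V) ∈ span K (p.ps '' p.Yt 0) := by
      refine p.mem_of_single _ ?_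
      rintro ⟨i, b, d⟩ hne
      rw [p.emb_ap] at hne
      have hb : b = false := by
        by_contra hb
        exact hne (if_neg fun h => hb h.2)
      exact subset_span ⟨Sum.inl (i, b, d), Or.inl ⟨_, rfl, by simp [hb]⟩, rfl⟩
    have k2 := smul_mem _ t (p.pt_mem (Nat.zero_le p.N))
    have := add_mem k1 k2
    simpa [pt] using this
  have h4 := finrank_mono h3
  omega

/-- the rigid part of the construction -/
noncomputable def base : Base K p.V p.Y where
  ψ := p.ps
  L := p.L
  L0 := p.L0
  p0 := p.pt
  O1 := p.O1
  N := p.N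
  a := (p.N+1) * Fintype.card D
  b := 2 * (p.N * Fintype.card D) - finrank K p.Lam
  Ys := p.Yt
  ZZ := Set.range p.zv
  ZZfin := Set.finite_range _
  a2 := by
    have := p.D1; have := p.hN; nlinarith
  b2 := by
    have h1 := p.D1; have h2 := p.hN; have h3 := p.lam_le
    have : 2 + Fintype.card D ≤ 2 * (p.N * Fintype.card D) := by nlinarith
    omega
  Yne := ⟨Sum.inr 0⟩
  frV := by
    have h := p.frV
    have h1 := p.D1; have h2 := p.hN; have h3 := p.lam_le
    have : Fintype.card D ≤ 2 * (p.N * Fintype.card D) := by nlinarith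
    omega
  frO1 := p.frO1
  O1L := p.O1L
  p0O1 := p.mem_O1.mpr ⟨0, zero_mem _, by simp [pt]⟩
  p0ne := by
    intro h
    have := congrArg (fun x : p.V => x.2.1) h
    simp [pt] at this
  Ly := by
    rintro (β | s)
    · exact p.f1 β
    · exact p.f2 s
  L0O1 := p.L0O1
  L00 := p.L00
  L0N := p.L0N
  zz := p.zz
  spYY := p.spYY
  top := p.top
  fr3 := p.fr3
  c6 := p.c6
  c7 := p.c7
  c9 := p.c9
  cLP := p.cLP
  cc := p.N * Fintype.card D + 1
  lam := finrank K p.Lam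
  pY := fun j hj => p.pt_mem hj
  frY := fun j hj => p.frY hj
  frYY := fun j hj => p.frYY hj
  frO1Y := p.frO1Y
  num := by
    have h1 := p.D1; have h2 := p.hN; have h3 := p.lam_le
    have : Fintype.card D ≤ 2 * (p.N * Fintype.card D) := by nlinarith
    omega

end Par
end KinserAux

set_option linter.unusedSectionVars false
set_option linter.unusedVariables false
set_option linter.unusedSimpArgs false

namespace KinserAux
open Module Submodule
open Gen2 (Gr H1s Hs)

theorem lindep_congr {K V W F : Type} [Field K] [AddCommGroup V] [Module K V] [AddCommGroup W]
    [Module K W] [Fintype F] (v : F → V) (w : F → W)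
    (h : ∀ l : F → K, ∑ x, l x • v x = 0 ↔ ∑ x, l x • w x = 0) (J : Set F) :
    LinearIndepOn K v J ↔ LinearIndepOn K w J := by
  have e1 : ∀ l : F →₀ K, Finsupp.linearCombination K v l = ∑ x, l x • v x := fun l => by
    rw [Finsupp.linearCombination_apply, Finsupp.sum_fintype _ _ (by simp)]
  have e2 : ∀ l : F →₀ K, Finsupp.linearCombination K w l = ∑ x, l x • w x := fun l => by
    rw [Finsupp.linearCombination_apply, Finsupp.sum_fintype _ _ (by simp)]
  simp only [linearIndepOn_iff, e1, e2, h]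

section
variable {K F W : Type} [Field K] [Infinite K] [Fintype F] [DecidableEq F] [AddCommGroup W] [Module K W]
  (p : Par K (Option F)) (w : F → W)
  (g : Gen1 p.base) (k : Gen2 g)

/-- the contracted label -/
def y0 : Gr p.base := Sum.inr (Sum.inl (p.i0, false, none))
/-- the embedding of the given matroid -/
def sF (x : F) : Gr p.base := Sum.inr (Sum.inl (p.i0, false, some x))
/-- the contracted set -/
def Cs : Set (Gr p.base) := insert (y0 p) (H1s p.base)

theorem emb_single (o : Option F) (t : K) :
    p.emb (Pi.single o t) = t • Pi.single (p.i0, false, o) 1 := by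
  ext ⟨i, b, d⟩
  rw [p.emb_ap]
  simp only [Pi.smul_apply, Pi.single_apply, Prod.mk.injEq, smul_eq_mul, mul_ite, mul_one, mul_zero]
  by_cases h1 : i = p.i0 <;> by_cases h2 : b = false <;> simp [h1, h2]


theorem y0_notMem : y0 p ∉ H1s p.base := by
  rintro ⟨i, hi⟩
  simp [y0] at hi

theorem span_Cs : span K (k.ph '' Cs p) = p.O1 ⊔ span K {p.ps (Sum.inl (p.i0, false, none))} := by
  have h1 : span K (k.ph '' H1s p.base) = p.O1 := k.cfg_H1
  rw [Cs, Set.image_insert_eq, span_insert, h1, sup_comm]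
  rfl

theorem ind_Cs : LinearIndepOn K k.ph (Cs p) := by
  have h1 : span K (k.ph '' H1s p.base) = p.O1 := k.cfg_H1
  rw [Cs, linearIndepOn_insert (y0_notMem p), h1]
  refine ⟨k.ind_H _ ?_, ?_⟩
  · refine ⟨?_, ?_⟩
    · rintro _ ⟨i, rfl⟩
      exact ⟨_, rfl⟩
    · intro h
      have hb := p.base.b2
      obtain ⟨i, hi⟩ := h ⟨Sum.inr ⟨0, by omega⟩, rfl⟩
      simp at hi
  · intro h
    exact p.base.Ly (Sum.inl (p.i0, false, none)) (p.O1L h)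

theorem sF_inj : Function.Injective (sF p) := by
  intro x y h
  simpa [sF] using h

theorem disj (J : Set F) : Disjoint (Cs p) (sF p '' J) := by
  rw [Set.disjoint_right]
  rintro _ ⟨x, _, rfl⟩ h
  rcases h with h | ⟨i, hi⟩
  · simp [sF, y0] at h
  · simp [sF] at hi

theorem sum_sF (l : F → K) : ∑ x, l x • p.ps (Sum.inl (p.i0, false, some x)) =
    (p.emb (fun o => o.elim 0 l), 0, 0) := by
  have e : p.emb (fun o => o.elim 0 l) =
      ∑ x, l x • (Pi.single (p.i0, false, some x) 1 : p.B → K) := by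
    have : (fun o : Option F => o.elim 0 l) = ∑ x, Pi.single (some x) (l x) := by
      ext o
      cases o with
      | none => simp [Finset.sum_apply, Pi.single_apply]
      | some y => simp [Finset.sum_apply, Pi.single_apply]
    rw [this, map_sum]
    exact sum_congr rfl fun x _ => emb_single p _ _
  rw [e]
  ext x
  · simp [Prod.fst_sum]
  · simp [Prod.snd_sum]
  · simp [Prod.snd_sum]

theorem key (hw : ∀ c : Option F → K, c ∈ p.Lam ↔ p.f (p.emb c) = 0 ∧ ∑ x, c (some x) • w x = 0)
    (l : F → K) :
    ((p.emb (fun o => o.elim 0 l), 0, 0) : p.V) ∈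
      p.O1 ⊔ span K {p.ps (Sum.inl (p.i0, false, none))} ↔ ∑ x, l x • w x = 0 := by
  constructor
  · intro h
    obtain ⟨u, hu, v, hv, e⟩ := mem_sup.mp h
    obtain ⟨t, rfl⟩ := mem_span_singleton.mp hv
    obtain ⟨c, hc, hcu⟩ := p.mem_O1.mp hu
    have e1 := congrArg Prod.fst e
    simp only [Prod.fst_add, hcu, Prod.smul_fst, Par.ps_inl] at e1
    rw [← emb_single, ← map_add] at e1
    have e2 : c + Pi.single none t = fun o => o.elim 0 l := by
      rw [← sub_eq_zero]
      apply p.emb_inj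
      rw [map_sub, e1, sub_self]
    rw [← ((hw c).mp hc).2]
    refine sum_congr rfl fun x _ => ?_
    have := congrFun e2 (some x)
    simp at this
    rw [this]
  · intro h
    let c0 : Option F → K := fun o => o.elim 0 l
    let t := p.f (p.emb c0) / p.f (Pi.single (p.i0, false, none) 1)
    have ht : t * p.f (Pi.single (p.i0, false, none) 1) = p.f (p.emb c0) :=
      div_mul_cancel₀ _ (p.f1 _)
    have hc : c0 - Pi.single none t ∈ p.Lam := by
      rw [hw]
      constructor
      · rw [map_sub, map_sub, emb_single, map_smul, smul_eq_mul, ht, sub_self]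
      · rw [← h]
        refine sum_congr rfl fun x _ => ?_
        simp [c0]
    refine mem_sup.mpr ⟨(p.emb (c0 - Pi.single none t), 0, 0), p.mem_O1.mpr ⟨_, hc, rfl⟩,
      t • p.ps (Sum.inl (p.i0, false, none)), smul_mem _ _ (mem_span_singleton_self _), ?_⟩
    rw [map_sub, emb_single]
    ext x <;> simp [c0]

theorem ind_iff (hw : ∀ c : Option F → K, c ∈ p.Lam ↔ p.f (p.emb c) = 0 ∧ ∑ x, c (some x) • w x = 0)
    (J : Set F) : LinearIndepOn K k.ph (Cs p ∪ sF p '' J) ↔ LinearIndepOn K w J := by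
  rw [linearIndepOn_union_iff_quotient (disj p J), and_iff_right (ind_Cs p g k)]
  have : LinearIndepOn K (mkQ (span K (k.ph '' Cs p)) ∘ k.ph) (sF p '' J) ↔
      LinearIndepOn K ((mkQ (span K (k.ph '' Cs p)) ∘ k.ph) ∘ sF p) J :=
    ⟨fun h => h.comp_of_image (sF_inj p).injOn, fun h => h.image_of_comp _ _⟩
  rw [this]
  apply lindep_congr
  intro l
  rw [← key p w hw l, ← sum_sF, ← span_Cs p g k, ← Submodule.Quotient.mk_eq_zero,
    ← mkQ_apply, map_sum]
  simp only [map_smul]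
  rfl

theorem minor_ind (hw : ∀ c : Option F → K, c ∈ p.Lam ↔ p.f (p.emb c) = 0 ∧ ∑ x, c (some x) • w x = 0)
    (J : Set F) : (k.cfg.mat.con (Cs p)).Indep (sF p '' J) ↔ LinearIndepOn K w J := by
  have hcon : k.cfg.mat.con (Cs p) = k.cfg.mat.contract (Cs p) := rfl
  have hC : k.cfg.mat.Indep (Cs p) := Or.inl (ind_Cs p g k)
  rw [hcon, hC.contract_indep_iff, and_iff_right (disj p J).symm, Set.union_comm,
    ← ind_iff p w g k hw]
  constructor
  · rintro (h | h)
    · exact h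
    · exfalso
      have : y0 p ∈ Cs p ∪ sF p '' J := Or.inl (Or.inl rfl)
      rw [h] at this
      obtain ⟨i, hi⟩ := this
      simp [y0] at hi
  · exact fun h => Or.inl h

end

theorem exists_par {K F W : Type} [Field K] [Infinite K] [Fintype F] [DecidableEq F]
    [AddCommGroup W] [Module K W] (w : F → W) (N : ℕ) (hN : 3 ≤ N) :
    ∃ p : Par K (Option F), p.N = N ∧
      ∀ c : Option F → K, c ∈ p.Lam ↔ p.f (p.emb c) = 0 ∧ ∑ x, c (some x) • w x = 0 := by
  let i0 : Fin N := ⟨0, by omega⟩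
  obtain ⟨f, hf⟩ := Module.exists_dual_forall_apply_ne_zero (K := K)
    (Sum.elim (fun β : Fin N × Bool × Option F => (Pi.single β 1 : Fin N × Bool × Option F → K))
      (fun s : Fin (N+1) => mt K N (Option F) s.1)) (by
      rintro (β | s)
      · simp
      · intro h
        have := congrFun h (i0, decide (i0.1 < s.1), none)
        simp [mt] at this)
  let emb : (Option F → K) →ₗ[K] (Fin N × Bool × Option F → K) :=
    LinearMap.pi fun β => if β.1 = i0 ∧ β.2.1 = false then LinearMap.proj β.2.2 else 0
  have emb_ap : ∀ c i b d, emb c (i, b, d) = if i = i0 ∧ b = false then c d else 0 := by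
    intro c i b d
    simp only [emb, LinearMap.pi_apply]
    split_ifs <;> simp
  let wl : (Option F → K) →ₗ[K] W := ∑ x : F, (LinearMap.proj (some x)).smulRight (w x)
  have wl_ap : ∀ c, wl c = ∑ x, c (some x) • w x := by
    intro c; simp [wl, LinearMap.sum_apply]
  let Lam : Submodule K (Option F → K) := LinearMap.ker (f ∘ₗ emb) ⊓ LinearMap.ker wl
  have hl : finrank K Lam ≤ Fintype.card (Option F) := by
    have := finrank_le Lam
    rwa [finrank_fintype_fun_eq_card] at this
  have hd : 1 ≤ Fintype.card (Option F) := Fintype.card_pos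
  have h2 : Fintype.card (Option F) + 1 ≤ (N+1) * Fintype.card (Option F) := by nlinarith
  refine ⟨⟨N, hN, ⟨none⟩, i0, f, fun β => hf (Sum.inl β), fun s => hf (Sum.inr s), emb, emb_ap,
    Lam, ?_, (N+1) * Fintype.card (Option F) - 1 - finrank K Lam, by omega⟩, rfl, ?_⟩
  · intro c hc
    exact hc.1
  · intro c
    rw [← wl_ap]
    exact Iff.rfl

end KinserAux

/-- Every finite matroid representable over an infinite field is (up to isomorphism) a
minor of an excluded minor for `K (n+1)` which lies in `K n`. -/
theorem Matroid.exists_excludedMinor_kinser {α : Type} {n : ℕ} (hn : 5 ≤ n)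
    (𝕂 : Type) [Field 𝕂] [Infinite 𝕂] (M : Matroid α) [M.Finite] (hM : M.IsRepOver 𝕂) :
    ∃ (β : Type) (N : Matroid β), N.Finite ∧
      (∃ M' : Matroid β, M'.IsMinorOf N ∧ M.IsIsoTo M') ∧
      N.MemKinserClass n ∧ ¬ N.MemKinserClass (n + 1) ∧
      ∀ P : Matroid β, P.IsProperMinorOf N → P.MemKinserClass (n + 1) := by

  classical
  obtain ⟨W, _, _, φ, hφ⟩ := hM
  have : Fintype ↥M.E := (Matroid.ground_finite M).fintype
  obtain ⟨p, hN, hw⟩ := KinserAux.exists_par (K := 𝕂) (fun x : ↥M.E => φ x.1) (n-2) (by omega)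
  obtain ⟨g⟩ := p.base.gen1
  obtain ⟨k⟩ := g.gen2
  refine ⟨_, k.cfg.mat, ⟨Set.toFinite _⟩, ?_, k.final hn hN⟩
  refine ⟨(k.cfg.mat.con (KinserAux.Cs p)).del
    ((KinserAux.Cs p)ᶜ \ Set.range (KinserAux.sF p)), ⟨_, _, Set.subset_univ _, Set.subset_univ _,
    ?_, rfl⟩, ?_⟩
  · rw [Set.disjoint_left]
    exact fun x hx h => h.1 hx
  have hdis := KinserAux.disj p Set.univ
  rw [Set.image_univ, Set.disjoint_left] at hdis
  have hE : ((k.cfg.mat.con (KinserAux.Cs p)).del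
      ((KinserAux.Cs p)ᶜ \ Set.range (KinserAux.sF p))).E = Set.range (KinserAux.sF p) := by
    change (Set.univ \ KinserAux.Cs p) \ ((KinserAux.Cs p)ᶜ \ Set.range (KinserAux.sF p)) = _
    ext x
    constructor
    · rintro ⟨⟨_, h1⟩, h2⟩
      by_contra h3
      exact h2 ⟨h1, h3⟩
    · intro h
      exact ⟨⟨trivial, fun hc => hdis hc h⟩, fun h2 => h2.2 h⟩
  refine ⟨fun x => if h : x ∈ M.E then KinserAux.sF p ⟨x, h⟩ else KinserAux.y0 p, ?_, ?_⟩
  · rw [hE]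
    refine ⟨?_, ?_, ?_⟩
    · intro x hx
      exact ⟨⟨x, hx⟩, by simp [hx]⟩
    · intro x hx y hy h
      simp only [hx, hy, dif_pos] at h
      simpa using KinserAux.sF_inj p h
    · rintro _ ⟨⟨x, hx⟩, rfl⟩
      exact ⟨x, hx, by simp [hx]⟩
  · intro I hI
    have e : (fun x => if h : x ∈ M.E then KinserAux.sF p ⟨x, h⟩ else KinserAux.y0 p) '' I =
        KinserAux.sF p '' (Subtype.val ⁻¹' I) := by
      ext y
      constructor
      · rintro ⟨x, hx, rfl⟩
        exact ⟨⟨x, hI hx⟩, hx, by simp [hI hx]⟩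
      · rintro ⟨⟨x, hx⟩, hx', rfl⟩
        exact ⟨x, hx', by simp [hx]⟩
    rw [e, hφ, and_iff_right hI]
    have h1 : ((k.cfg.mat.con (KinserAux.Cs p)).del
        ((KinserAux.Cs p)ᶜ \ Set.range (KinserAux.sF p))).Indep (KinserAux.sF p '' (Subtype.val ⁻¹' I))
        ↔ (k.cfg.mat.con (KinserAux.Cs p)).Indep (KinserAux.sF p '' (Subtype.val ⁻¹' I)) := by
      have h2 : KinserAux.sF p '' (Subtype.val ⁻¹' I) ⊆ ((k.cfg.mat.con (KinserAux.Cs p)).del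
          ((KinserAux.Cs p)ᶜ \ Set.range (KinserAux.sF p))).E := by
        rw [hE]; exact Set.image_subset_range _ _
      exact Matroid.restrict_indep_iff.trans (and_iff_left h2)
    rw [h1, KinserAux.minor_ind p _ g k hw]
    have h3 : Subtype.val '' (Subtype.val ⁻¹' I : Set ↥M.E) = I := by
      rw [Subtype.image_preimage_coe, Set.inter_eq_right.mpr hI]
    have h4 : LinearIndepOn 𝕂 φ (Subtype.val '' (Subtype.val ⁻¹' I : Set ↥M.E)) ↔
        LinearIndepOn 𝕂 (fun x : ↥M.E => φ x.1) (Subtype.val ⁻¹' I) :=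
      ⟨fun h => h.comp_of_image Subtype.val_injective.injOn,
        fun h => LinearIndepOn.image_of_comp (s := (Subtype.val ⁻¹' I : Set ↥M.E)) Subtype.val φ h⟩
    rw [h3] at h4
    exact h4
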